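/- Every nearly Gorenstein Stanley–Reisner ring of Krull dimension greater than two is Gorenstein. That is, if Δ is a simplicial complex with dim Δ ≥ 2 and R = 𝕜[Δ] is Cohen–Macaulay with tr(ω_R) ⊇ 𝔐_R, then R is Gorenstein. -/

import Mathlib

/-! # Preliminaries

Self-contained definitions: simplicial complexes, simplicial homology, Stanley–Reisner rings,
canonical modules, canonical traces, and the various Gorenstein-type conditions. -/

open CategoryTheory

/-- An abstract simplicial complex on the vertex set `Fin n` (the empty set is a face). -/
structure SC (n : ℕ) where
  faces : Finset (Finset (Fin n))
  empty_mem : ∅ ∈ faces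
  down_closed : ∀ {σ τ : Finset (Fin n)}, σ ∈ faces → τ ⊆ σ → τ ∈ faces

namespace SC

variable {n : ℕ} (Δ : SC n)

/-- The dimension of a simplicial complex, as an integer (the complex `{∅}` has
dimension `-1`). -/
def dim : ℤ := ((Δ.faces.sup Finset.card : ℕ) : ℤ) - 1

/-- `v` is a vertex of `Δ`. -/
def IsVertex (v : Fin n) : Prop := {v} ∈ Δ.faces

/-- A facet is a face which is maximal by inclusion. -/
def IsFacet (σ : Finset (Fin n)) : Prop :=
  σ ∈ Δ.faces ∧ ∀ τ ∈ Δ.faces, σ ⊆ τ → σ = τ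

/-- A cone point is a vertex contained in every facet. -/
def IsConePoint (v : Fin n) : Prop :=
  Δ.IsVertex v ∧ ∀ σ, Δ.IsFacet σ → v ∈ σ

/-- A simplicial complex is connected if it has a vertex and any two vertices are joined
by a path of edges. -/
def Connected : Prop :=
  (∃ v, Δ.IsVertex v) ∧ ∀ u v, Δ.IsVertex u → Δ.IsVertex v →
    Relation.ReflTransGen (fun a b => ({a, b} : Finset (Fin n)) ∈ Δ.faces) u v

/-- A simplicial complex is strongly connected if any two facets are joined by a chain of
facets in which consecutive facets intersect in a face of dimension `dim Δ - 1`. -/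
def StronglyConnected : Prop :=
  ∀ σ τ, Δ.IsFacet σ → Δ.IsFacet τ →
    Relation.ReflTransGen
      (fun α β => Δ.IsFacet α ∧ Δ.IsFacet β ∧ ((α ∩ β).card : ℤ) - 1 = Δ.dim - 1) σ τ

/-- A pseudomanifold: strongly connected, and every face of dimension `dim Δ - 1` is
contained in exactly two facets. -/
def IsPseudomanifold : Prop :=
  Δ.StronglyConnected ∧
    ∀ τ ∈ Δ.faces, (τ.card : ℤ) - 1 = Δ.dim - 1 →
      {σ : Finset (Fin n) | Δ.IsFacet σ ∧ τ ⊆ σ}.ncard = 2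

/-- The link of a face `σ` of `Δ`. -/
def link (σ : Finset (Fin n)) (hσ : σ ∈ Δ.faces) : SC n where
  faces := Δ.faces.filter fun τ => τ ∩ σ = ∅ ∧ τ ∪ σ ∈ Δ.faces
  empty_mem := by
    simp only [Finset.mem_filter]
    exact ⟨Δ.empty_mem, by simp, by simpa using hσ⟩
  down_closed := by
    intro σ' τ' h hsub
    simp only [Finset.mem_filter] at h ⊢
    refine ⟨Δ.down_closed h.1 hsub, ?_, ?_⟩
    · have := h.2.1
      rw [Finset.eq_empty_iff_forall_notMem] at this ⊢
      intro x hx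
      exact this x (Finset.mem_inter.mpr
        ⟨hsub (Finset.mem_inter.mp hx).1, (Finset.mem_inter.mp hx).2⟩)
    · exact Δ.down_closed h.2.2 (Finset.union_subset_union hsub (le_refl σ))

/-- A complex is normal if the link of every face of dimension `≤ dim Δ - 2` is connected. -/
def Normal : Prop :=
  ∀ σ (hσ : σ ∈ Δ.faces), (σ.card : ℤ) - 1 ≤ Δ.dim - 2 → (Δ.link σ hσ).Connected

/-! ## Simplicial homology -/

/-- Faces of `Δ` of cardinality `c` containing the face `σ`.  These index a basis of the
`c`-th chain group of the pair `(Δ, cost_Δ σ)` (for `σ = ∅` this is the augmented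
(reduced) chain complex of `Δ`, since the empty face is included in chain degree `0`). -/
def RFace (σ : Finset (Fin n)) (c : ℕ) : Type :=
  {τ : Finset (Fin n) // τ ∈ Δ.faces ∧ σ ⊆ τ ∧ τ.card = c}

instance (σ : Finset (Fin n)) (c : ℕ) : Fintype (Δ.RFace σ c) :=
  inferInstanceAs (Fintype {τ : Finset (Fin n) // τ ∈ Δ.faces ∧ σ ⊆ τ ∧ τ.card = c})

instance (σ : Finset (Fin n)) (c : ℕ) : DecidableEq (Δ.RFace σ c) :=
  inferInstanceAs (DecidableEq {τ : Finset (Fin n) // τ ∈ Δ.faces ∧ σ ⊆ τ ∧ τ.card = c})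

variable (R : Type) [CommRing R]

/-- Chains of the pair `(Δ, cost_Δ σ)` with coefficients in `R`. -/
abbrev relChain (σ : Finset (Fin n)) (c : ℕ) : Type := Δ.RFace σ c → R

/-- The matrix of the simplicial boundary map of the pair `(Δ, cost_Δ σ)`: the coefficient of
`ρ` in `∂ τ` is `(-1)^j` if `ρ` is obtained from `τ` by deleting its `(j+1)`-st vertex (the
deleted vertex not belonging to `σ`), and `0` otherwise. -/
def relBMat (σ : Finset (Fin n)) (i : ℕ) :
    Matrix (Δ.RFace σ i) (Δ.RFace σ (i + 1)) R :=
  fun ρ τ => ∑ v ∈ τ.1, if v ∉ σ ∧ τ.1.erase v = ρ.1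
    then (-1 : R) ^ ((τ.1.filter (fun w => w < v)).card) else 0

/-- The boundary map of the chain complex of the pair `(Δ, cost_Δ σ)`. -/
noncomputable def relBoundary (σ : Finset (Fin n)) (i : ℕ) :
    Δ.relChain R σ (i + 1) →ₗ[R] Δ.relChain R σ i :=
  (Δ.relBMat R σ i).mulVecLin

/-- The relative simplicial homology `H_d(Δ, cost_Δ σ; R)` (`d ≥ 0`). -/
noncomputable def relHomology (σ : Finset (Fin n)) (d : ℕ) : Type :=
  LinearMap.ker (Δ.relBoundary R σ d) ⧸
    Submodule.comap (LinearMap.ker (Δ.relBoundary R σ d)).subtype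
      (LinearMap.range (Δ.relBoundary R σ (d + 1)))

noncomputable instance (σ : Finset (Fin n)) (d : ℕ) : AddCommGroup (Δ.relHomology R σ d) :=
  inferInstanceAs (AddCommGroup (LinearMap.ker (Δ.relBoundary R σ d) ⧸
    Submodule.comap (LinearMap.ker (Δ.relBoundary R σ d)).subtype
      (LinearMap.range (Δ.relBoundary R σ (d + 1)))))

noncomputable instance (σ : Finset (Fin n)) (d : ℕ) : Module R (Δ.relHomology R σ d) :=
  inferInstanceAs (Module R (LinearMap.ker (Δ.relBoundary R σ d) ⧸
    Submodule.comap (LinearMap.ker (Δ.relBoundary R σ d)).subtype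
      (LinearMap.range (Δ.relBoundary R σ (d + 1)))))

/-- Reduced simplicial homology `H̃_d(Δ; R)` for `d ≥ 0`: the homology of the augmented chain
complex, i.e. of the pair `(Δ, cost_Δ ∅)`. -/
noncomputable abbrev reducedHomology (d : ℕ) : Type := Δ.relHomology R ∅ d

/-- Reduced simplicial homology in degree `-1`. -/
noncomputable def reducedHomologyNeg : Type :=
  (⊤ : Submodule R (Δ.relChain R ∅ 0)) ⧸
    Submodule.comap (⊤ : Submodule R (Δ.relChain R ∅ 0)).subtype
      (LinearMap.range (Δ.relBoundary R ∅ 0))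

noncomputable instance : AddCommGroup (Δ.reducedHomologyNeg R) :=
  inferInstanceAs (AddCommGroup ((⊤ : Submodule R (Δ.relChain R ∅ 0)) ⧸
    Submodule.comap (⊤ : Submodule R (Δ.relChain R ∅ 0)).subtype
      (LinearMap.range (Δ.relBoundary R ∅ 0))))

noncomputable instance : Module R (Δ.reducedHomologyNeg R) :=
  inferInstanceAs (Module R ((⊤ : Submodule R (Δ.relChain R ∅ 0)) ⧸
    Submodule.comap (⊤ : Submodule R (Δ.relChain R ∅ 0)).subtype
      (LinearMap.range (Δ.relBoundary R ∅ 0))))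

/-- Cycles of the non-augmented chain complex of `Δ` in dimension `d` (for `d = 0` every
`0`-chain is a cycle). -/
noncomputable def cyclesUnred (d : ℕ) : Submodule R (Δ.relChain R ∅ (d + 1)) :=
  if d = 0 then ⊤ else LinearMap.ker (Δ.relBoundary R ∅ d)

/-- (Unreduced) simplicial homology `H_d(Δ; R)`. -/
noncomputable def homologyUnred (d : ℕ) : Type :=
  Δ.cyclesUnred R d ⧸
    Submodule.comap (Δ.cyclesUnred R d).subtype (LinearMap.range (Δ.relBoundary R ∅ (d + 1)))

noncomputable instance (d : ℕ) : AddCommGroup (Δ.homologyUnred R d) :=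
  inferInstanceAs (AddCommGroup (Δ.cyclesUnred R d ⧸
    Submodule.comap (Δ.cyclesUnred R d).subtype (LinearMap.range (Δ.relBoundary R ∅ (d + 1)))))

noncomputable instance (d : ℕ) : Module R (Δ.homologyUnred R d) :=
  inferInstanceAs (Module R (Δ.cyclesUnred R d ⧸
    Submodule.comap (Δ.cyclesUnred R d).subtype (LinearMap.range (Δ.relBoundary R ∅ (d + 1)))))

/-- `Δ` is `R`-orientable if `H_d(Δ; R) ≠ 0`, where `d = dim Δ`. -/
def Orientable : Prop :=
  ∃ d : ℕ, Δ.dim = (d : ℤ) ∧ Nontrivial (Δ.homologyUnred R d)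

/-- A `k`-homology sphere condition for a single complex `Γ`:
`H̃_i(Γ; k) = k` for `i = dim Γ` and `0` otherwise. -/
def HomologySphereCond (Γ : SC n) : Prop :=
  (∀ i : ℕ, ((i : ℤ) = Γ.dim → Nonempty ((Γ.reducedHomology R i) ≃ₗ[R] R)) ∧
    ((i : ℤ) ≠ Γ.dim → Subsingleton (Γ.reducedHomology R i))) ∧
  ((-1 : ℤ) = Γ.dim → Nonempty ((Γ.reducedHomologyNeg R) ≃ₗ[R] R)) ∧
  ((-1 : ℤ) ≠ Γ.dim → Subsingleton (Γ.reducedHomologyNeg R))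

/-- `Δ` is a `k`-homology manifold: it is connected and the link of every nonempty face has
the reduced homology of a sphere of its dimension. -/
def IsHomologyManifold : Prop :=
  Δ.Connected ∧ ∀ σ (hσ : σ ∈ Δ.faces), σ ≠ ∅ → HomologySphereCond R (Δ.link σ hσ)

/-- `Δ` is isomorphic to the disjoint union of `m` vertices. -/
def IsDisjointVertices (m : ℕ) : Prop :=
  ∃ v : Fin m → Fin n, Function.Injective v ∧
    ∀ σ : Finset (Fin n), σ ∈ Δ.faces ↔ (σ = ∅ ∨ ∃ i, σ = {v i})

/-- `Δ` is isomorphic to a path of length `m` (with `m` edges and `m+1` vertices). -/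
def IsPathComplex (m : ℕ) : Prop :=
  ∃ v : Fin (m + 1) → Fin n, Function.Injective v ∧
    ∀ σ : Finset (Fin n), σ ∈ Δ.faces ↔
      (σ = ∅ ∨ (∃ i, σ = {v i}) ∨ ∃ i : Fin m, σ = {v i.castSucc, v i.succ})

end SC

/-! ## Commutative algebra -/

/-- The `i`-th Ext module `Ext^i_R(M, N)` of two `R`-modules, as an object of `ModuleCat R`. -/
noncomputable def extMod (R : Type) [CommRing R] (M N : Type) [AddCommGroup M] [Module R M]
    [AddCommGroup N] [Module R N] (i : ℕ) : ModuleCat R :=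
  ((Ext R (ModuleCat R) i).obj (Opposite.op (ModuleCat.of R M))).obj (ModuleCat.of R N)

/-- The trace ideal of an `R`-module `M`: the sum of the images of all `R`-linear maps
`M → R`. -/
noncomputable def traceIdeal (R : Type) [CommRing R] (M : Type) [AddCommGroup M] [Module R M] :
    Ideal R :=
  ⨆ f : M →ₗ[R] R, LinearMap.range f

/-- A Noetherian ring `R` with a distinguished maximal ideal `𝔪` (a local ring, or a graded
ring with its graded maximal ideal) is Cohen--Macaulay when `depth = dim`, i.e. (by the
Ext-characterisation of depth) `Ext^i_R(R/𝔪, R) = 0` for all `i < dim R`. -/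
def IsCohenMacaulayAt (R : Type) [CommRing R] (𝔪 : Ideal R) : Prop :=
  IsNoetherianRing R ∧
    ∀ i : ℕ, (i : WithBot (WithTop ℕ)) < ringKrullDim R → Subsingleton (extMod R (R ⧸ 𝔪) R i)

/-- A Noetherian ring `R` with a distinguished maximal ideal `𝔪` (a local ring, or a graded
ring with its graded maximal ideal) is Gorenstein when `Ext^i_R(R/𝔪, R)` vanishes for
`i ≠ dim R` and is isomorphic to `R/𝔪` for `i = dim R`. -/
def IsGorensteinAt (R : Type) [CommRing R] (𝔪 : Ideal R) : Prop :=
  IsNoetherianRing R ∧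
    ∀ i : ℕ, ((i : WithBot (WithTop ℕ)) = ringKrullDim R →
        Nonempty ((extMod R (R ⧸ 𝔪) R i) ≃ₗ[R] (R ⧸ 𝔪))) ∧
      ((i : WithBot (WithTop ℕ)) ≠ ringKrullDim R → Subsingleton (extMod R (R ⧸ 𝔪) R i))

/-- A Noetherian local ring is Gorenstein. -/
def IsGorensteinLocalRing (A : Type) [CommRing A] [IsLocalRing A] : Prop :=
  IsGorensteinAt A (IsLocalRing.maximalIdeal A)

section Graded

variable (k : Type) [Field k] {n : ℕ}

/-- An ideal of a polynomial ring is homogeneous (graded) if it contains all homogeneous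
components of its elements. -/
def IsHomogIdeal (I : Ideal (MvPolynomial (Fin n) k)) : Prop :=
  ∀ p ∈ I, ∀ d : ℕ, MvPolynomial.homogeneousComponent d p ∈ I

/-- The graded (irrelevant) maximal ideal of `k[x_1,…,x_n]/I`, generated by the images of the
variables. -/
noncomputable def quotMax (I : Ideal (MvPolynomial (Fin n) k)) :
    Ideal (MvPolynomial (Fin n) k ⧸ I) :=
  Ideal.span (Set.range fun i : Fin n => Ideal.Quotient.mk I (MvPolynomial.X i))

/-- The degree `j` component of the standard graded ring `k[x_1,…,x_n]/I`, as a
`k`-subspace. -/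
noncomputable def quotGrade (I : Ideal (MvPolynomial (Fin n) k)) (j : ℕ) :
    Submodule k (MvPolynomial (Fin n) k ⧸ I) :=
  (MvPolynomial.homogeneousSubmodule (Fin n) k j).map (Ideal.Quotient.mkₐ k I).toLinearMap

/-- The `ℤ^n`-graded component of `k[x_1,…,x_n]/I` of multidegree `a`: the `k`-line spanned by
the image of the monomial `x^a`. -/
noncomputable def quotMonomialGrade (I : Ideal (MvPolynomial (Fin n) k)) (a : Fin n → ℕ) :
    Submodule k (MvPolynomial (Fin n) k ⧸ I) :=
  Submodule.span k
    {Ideal.Quotient.mk I (MvPolynomial.monomial (Finsupp.equivFunOnFinite.symm a) (1 : k))}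

/-- The standard graded ring `R = k[x_1,…,x_n]/I` is Gorenstein on the punctured spectrum if
`R_𝔭` is Gorenstein for every graded prime `𝔭` other than the graded maximal ideal. -/
def GorensteinPunctured (I : Ideal (MvPolynomial (Fin n) k)) : Prop :=
  ∀ (𝔭 : Ideal (MvPolynomial (Fin n) k ⧸ I)) [𝔭.IsPrime],
    IsHomogIdeal k (𝔭.comap (Ideal.Quotient.mk I)) → 𝔭 ≠ quotMax k I →
      IsGorensteinLocalRing (Localization.AtPrime 𝔭)

/-- `ω` is a canonical module of the standard graded ring `R = k[x_1,…,x_n]/I`, `d = dim R`,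
when `ω ≅ Ext^{n-d}_S(R, S)` for `S = k[x_1,…,x_n]` (by graded local duality this is, up to
shift, the Matlis dual of the top local cohomology module `H^d_𝔪(R)`). -/
def IsCanonicalModuleQ (I : Ideal (MvPolynomial (Fin n) k)) (ω : Type) [AddCommGroup ω]
    [Module (MvPolynomial (Fin n) k ⧸ I) ω] : Prop :=
  Module.Finite (MvPolynomial (Fin n) k ⧸ I) ω ∧
    ∃ d : ℕ, ringKrullDim (MvPolynomial (Fin n) k ⧸ I) = (d : WithBot (WithTop ℕ)) ∧
      letI : Module (MvPolynomial (Fin n) k) ω := Module.compHom ω (Ideal.Quotient.mk I)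
      Nonempty (ω ≃ₗ[MvPolynomial (Fin n) k]
        (extMod (MvPolynomial (Fin n) k) (MvPolynomial (Fin n) k ⧸ I)
          (MvPolynomial (Fin n) k) (n - d)))

/-- A `ℤ`-grading on a module `ω` over `R = k[x_1,…,x_n]/I` compatible with the standard
grading of `R`. -/
def IsCompatibleGrading (I : Ideal (MvPolynomial (Fin n) k)) (ω : Type) [AddCommGroup ω]
    [Module (MvPolynomial (Fin n) k ⧸ I) ω] [Module k ω] (gr : ℤ → Submodule k ω) : Prop :=
  DirectSum.IsInternal gr ∧
    ∀ (i : ℕ) (j : ℤ) (r : MvPolynomial (Fin n) k ⧸ I) (m : ω),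
      r ∈ quotGrade k I i → m ∈ gr j → r • m ∈ gr ((i : ℤ) + j)

/-- The minimal number of generators of a module `M` over `R = k[…]/I` with graded maximal
ideal `𝔪`: the `k`-dimension of `M/𝔪M`. -/
noncomputable def muGen (R : Type) [CommRing R] [Algebra k R] (𝔪 : Ideal R) (M : Type)
    [AddCommGroup M] [Module R M] : ℕ :=
  letI : Module k (M ⧸ (𝔪 • (⊤ : Submodule R M))) :=
    Module.compHom (M ⧸ (𝔪 • (⊤ : Submodule R M))) (algebraMap k R)
  Module.finrank k (M ⧸ (𝔪 • (⊤ : Submodule R M)))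

/-- The Hilbert--Samuel function `j ↦ dim_k M/𝔪^j M` of a module. -/
noncomputable def hilbSam (R : Type) [CommRing R] [Algebra k R] (𝔪 : Ideal R) (M : Type)
    [AddCommGroup M] [Module R M] (j : ℕ) : ℕ :=
  letI : Module k (M ⧸ ((𝔪 ^ j) • (⊤ : Submodule R M))) :=
    Module.compHom (M ⧸ ((𝔪 ^ j) • (⊤ : Submodule R M))) (algebraMap k R)
  Module.finrank k (M ⧸ ((𝔪 ^ j) • (⊤ : Submodule R M)))

/-- `M` is an Ulrich module with respect to `𝔪`: its minimal number of generators `μ(M)`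
equals its multiplicity `e(𝔪; M) = lim_j t!·dim_k(M/𝔪^j M)/j^t`, where `t = dim M`. -/
def IsUlrich (R : Type) [CommRing R] [Algebra k R] (𝔪 : Ideal R) (M : Type) [AddCommGroup M]
    [Module R M] : Prop :=
  ∃ t : ℕ, ringKrullDim (R ⧸ Module.annihilator R M) = (t : WithBot (WithTop ℕ)) ∧
    Filter.Tendsto
      (fun j : ℕ => ((t.factorial : ℝ) * (hilbSam k R 𝔪 M j : ℝ)) / (j : ℝ) ^ t)
      Filter.atTop (nhds ((muGen k R 𝔪 M : ℝ)))

end Graded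

section SR

variable (k : Type) [Field k] {n : ℕ}

/-- The Stanley--Reisner ideal of `Δ`: generated by the squarefree monomials supported on
non-faces of `Δ`. -/
noncomputable def srIdeal (Δ : SC n) : Ideal (MvPolynomial (Fin n) k) :=
  Ideal.span {m | ∃ σ : Finset (Fin n), σ ∉ Δ.faces ∧ m = ∏ i ∈ σ, MvPolynomial.X i}

/-- The Stanley--Reisner ring `k[Δ]`. -/
abbrev SRRing (Δ : SC n) : Type := MvPolynomial (Fin n) k ⧸ srIdeal k Δ

/-- The graded maximal ideal of `k[Δ]`. -/
noncomputable abbrev srMax (Δ : SC n) : Ideal (SRRing k Δ) := quotMax k (srIdeal k Δ)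

/-- The value at `j` of the Hilbert function of the (canonically graded) canonical module of
`k[Δ]`, as computed by Gräbe's theorem:
`dim_k [ω]_j = Σ_{a ∈ ℕ^n, |a| = j} dim_k H_{dim Δ}(Δ, cost_Δ(supp a); k)`. -/
noncomputable def canonicalHilbert (Δ : SC n) (j : ℕ) : ℕ :=
  ∑ a ∈ (Fintype.piFinset fun _ : Fin n => Finset.range (j + 1)).filter
      (fun a => ∑ i, a i = j),
    Module.finrank k
      (Δ.relHomology k (Finset.univ.filter fun i => a i ≠ 0) (Δ.faces.sup Finset.card - 1))

/-- A `ℤ`-grading `gr` on a module `ω` over `k[Δ]` is the canonical grading of the canonical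
module if it is a compatible grading, is supported in nonnegative degrees, and its Hilbert
function is the one given by Gräbe's theorem. -/
def IsCanonicallyGraded (Δ : SC n) (ω : Type) [AddCommGroup ω] [Module (SRRing k Δ) ω]
    [Module k ω] (gr : ℤ → Submodule k ω) : Prop :=
  IsCompatibleGrading k (srIdeal k Δ) ω gr ∧ (∀ j : ℤ, j < 0 → gr j = ⊥) ∧
    ∀ j : ℕ, Module.finrank k (gr (j : ℤ)) = canonicalHilbert k Δ j

/-- A `ℤ^n`-grading `grN` on a module `ω` over `k[Δ]` (supported in `ℕ^n`) is the canonical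
multigrading of the canonical module if it is an internal direct sum, is compatible with the
`ℤ^n`-grading of `k[Δ]`, and its multigraded Hilbert function is the one given by Gräbe's
theorem: `dim_k [ω]_a = dim_k H_{dim Δ}(Δ, cost_Δ(supp a); k)`. -/
def IsCanonicallyMultiGraded (Δ : SC n) (ω : Type) [AddCommGroup ω] [Module (SRRing k Δ) ω]
    [Module k ω] (grN : (Fin n → ℕ) → Submodule k ω) : Prop :=
  DirectSum.IsInternal grN ∧
    (∀ (a b : Fin n → ℕ) (r : SRRing k Δ) (m : ω),
      r ∈ quotMonomialGrade k (srIdeal k Δ) a → m ∈ grN b → r • m ∈ grN (a + b)) ∧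
    ∀ a : Fin n → ℕ, Module.finrank k (grN a) =
      Module.finrank k
        (Δ.relHomology k (Finset.univ.filter fun i => a i ≠ 0) (Δ.faces.sup Finset.card - 1))

end SR

/-- The chain map `C_•(Δ, cost_Δ τ) → C_•(Δ, cost_Δ σ)` (for `τ ⊆ σ`) induced by the
inclusion `cost_Δ τ ⊆ cost_Δ σ`: basis faces not containing `σ` are sent to `0`. -/
def SC.relChainMap {n : ℕ} (Δ : SC n) (R : Type) [CommRing R] (τ σ : Finset (Fin n)) (c : ℕ) :
    Δ.relChain R τ c →ₗ[R] Δ.relChain R σ c :=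
  Matrix.mulVecLin (fun (β : Δ.RFace σ c) (α : Δ.RFace τ c) => if α.1 = β.1 then (1 : R) else 0)

set_option synthInstance.maxHeartbeats 1000000 in
/-- `R = k[x_1,…,x_n]/I` is almost Gorenstein with respect to a canonical module `ω` with
(canonical) grading `gr`: writing `a = a_R` for the `a`-invariant (so `-a` is the least degree
of `ω`), there is an injective degree-zero `R`-linear map `φ : R → ω(-a)` whose cokernel is
zero or an Ulrich module. -/
def IsAlmostGorenstein (k : Type) [Field k] {n : ℕ} (I : Ideal (MvPolynomial (Fin n) k))
    (ω : Type) [AddCommGroup ω] [Module (MvPolynomial (Fin n) k ⧸ I) ω] [Module k ω]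
    (gr : ℤ → Submodule k ω) : Prop :=
  ∃ a : ℤ, (gr (-a) ≠ ⊥ ∧ ∀ j : ℤ, j < -a → gr j = ⊥) ∧
    ∃ φ : (MvPolynomial (Fin n) k ⧸ I) →ₗ[MvPolynomial (Fin n) k ⧸ I] ω,
      Function.Injective φ ∧
      (∀ (i : ℕ) (r : MvPolynomial (Fin n) k ⧸ I),
        r ∈ quotGrade k I i → φ r ∈ gr ((i : ℤ) - a)) ∧
      (Subsingleton (ω ⧸ LinearMap.range φ) ∨
        IsUlrich k (MvPolynomial (Fin n) k ⧸ I) (quotMax k I) (ω ⧸ LinearMap.range φ))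



namespace NG
open CategoryTheory Abelian

section ExtKit

variable {R : Type} [CommRing R]
variable {M M' M'' : Type} [AddCommGroup M] [Module R M] [AddCommGroup M'] [Module R M']
  [AddCommGroup M''] [Module R M'']
variable {A B C : Type} [AddCommGroup A] [Module R A] [AddCommGroup B] [Module R B]
  [AddCommGroup C] [Module R C]
variable {A' B' C' : Type} [AddCommGroup A'] [Module R A'] [AddCommGroup B'] [Module R B']
  [AddCommGroup C'] [Module R C']
variable {Y Y' : Type} [AddCommGroup Y] [Module R Y] [AddCommGroup Y'] [Module R Y']

/-- Ext groups of modules, via Mathlib's derived-category `Ext`. -/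
def EX (R : Type) [CommRing R] (M Y : Type) [AddCommGroup M] [Module R M]
    [AddCommGroup Y] [Module R Y] (i : ℕ) : Type :=
  Abelian.Ext (ModuleCat.of R M) (ModuleCat.of R Y) i

noncomputable instance (i : ℕ) : AddCommGroup (EX R M Y i) :=
  inferInstanceAs (AddCommGroup (Abelian.Ext (ModuleCat.of R M) (ModuleCat.of R Y) i))

noncomputable instance (i : ℕ) : Module R (EX R M Y i) :=
  inferInstanceAs (Module R (Abelian.Ext (ModuleCat.of R M) (ModuleCat.of R Y) i))

/-- contravariant functoriality -/
noncomputable def pre (Y : Type) [AddCommGroup Y] [Module R Y] (f : M →ₗ[R] M') (i : ℕ) :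
    EX R M' Y i →ₗ[R] EX R M Y i :=
  Abelian.Ext.bilinearCompOfLinear R (ModuleCat.of R M) (ModuleCat.of R M') (ModuleCat.of R Y)
    0 i i (zero_add i) (Abelian.Ext.mk₀ (ModuleCat.ofHom f))

lemma pre_apply (f : M →ₗ[R] M') (i : ℕ) (x : EX R M' Y i) :
    pre Y f i x = (Abelian.Ext.mk₀ (ModuleCat.ofHom f)).comp
      (show Abelian.Ext (ModuleCat.of R M') (ModuleCat.of R Y) i from x) (zero_add i) := rfl

lemma pre_id (i : ℕ) (x : EX R M Y i) : pre Y (LinearMap.id : M →ₗ[R] M) i x = x :=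
  Abelian.Ext.mk₀_id_comp (X := ModuleCat.of R M) (Y := ModuleCat.of R Y) x

lemma pre_pre (f : M →ₗ[R] M') (g : M' →ₗ[R] M'') (i : ℕ) (x : EX R M'' Y i) :
    pre Y f i (pre Y g i x) = pre Y (g ∘ₗ f) i x := by
  exact Abelian.Ext.mk₀_comp_mk₀_assoc (ModuleCat.ofHom f) (ModuleCat.ofHom g)
    (show Abelian.Ext (ModuleCat.of R M'') (ModuleCat.of R Y) i from x)

lemma pre_zero (i : ℕ) (x : EX R M' Y i) : pre Y (0 : M →ₗ[R] M') i x = 0 := by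
  have : ModuleCat.ofHom (0 : M →ₗ[R] M') = 0 := rfl
  rw [pre_apply, this, Abelian.Ext.mk₀_zero, Abelian.Ext.zero_comp]
  rfl

lemma pre_add (f g : M →ₗ[R] M') (i : ℕ) (x : EX R M' Y i) :
    pre Y (f + g) i x = pre Y f i x + pre Y g i x := by
  have : ModuleCat.ofHom (f + g) = ModuleCat.ofHom f + ModuleCat.ofHom g := rfl
  rw [pre_apply, this, Abelian.Ext.mk₀_add, Abelian.Ext.add_comp]
  rfl

lemma pre_smul (r : R) (f : M →ₗ[R] M') (i : ℕ) (x : EX R M' Y i) :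
    pre Y (r • f) i x = r • pre Y f i x := by
  have : ModuleCat.ofHom (r • f) = r • ModuleCat.ofHom f := rfl
  rw [pre_apply, this, Abelian.Ext.mk₀_smul, Abelian.Ext.smul_comp]
  rfl

lemma pre_sum {ι : Type} (s : Finset ι) (f : ι → (M →ₗ[R] M')) (i : ℕ) (x : EX R M' Y i) :
    pre Y (∑ j ∈ s, f j) i x = ∑ j ∈ s, pre Y (f j) i x := by
  classical
  induction s using Finset.induction_on with
  | empty => simp [pre_zero]
  | insert a s ha ih => simp [Finset.sum_insert ha, pre_add, ih]

/-- an isomorphism induces an isomorphism on Ext -/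
noncomputable def preEquiv (Y : Type) [AddCommGroup Y] [Module R Y] (e : M ≃ₗ[R] M') (i : ℕ) :
    EX R M' Y i ≃ₗ[R] EX R M Y i :=
  LinearEquiv.ofLinearMap (pre Y e.toLinearMap i) (pre Y e.symm.toLinearMap i)
    (by ext x; simp [pre_pre, pre_id])
    (by ext x; simp [pre_pre, pre_id])

/-- Data of a short exact sequence -/
structure SES (f : A →ₗ[R] B) (g : B →ₗ[R] C) : Prop where
  inj : Function.Injective f
  surj : Function.Surjective g
  exact : Function.Exact f g

lemma SES.comp_eq_zero {f : A →ₗ[R] B} {g : B →ₗ[R] C} (h : SES f g) : g ∘ₗ f = 0 :=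
  h.exact.linearMap_comp_eq_zero

/-- short complex -/
noncomputable abbrev SES.sc {f : A →ₗ[R] B} {g : B →ₗ[R] C} (h : SES f g) :
    ShortComplex (ModuleCat R) :=
  ShortComplex.mk (ModuleCat.ofHom f) (ModuleCat.ofHom g)
    (by rw [← ModuleCat.ofHom_comp, h.comp_eq_zero]; rfl)

lemma SES.shortExact {f : A →ₗ[R] B} {g : B →ₗ[R] C} (h : SES f g) : h.sc.ShortExact where
  exact := (ShortComplex.ShortExact.moduleCat_exact_iff_function_exact _).mpr h.exact
  mono_f := (ModuleCat.mono_iff_injective _).mpr h.inj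
  epi_g := (ModuleCat.epi_iff_surjective _).mpr h.surj

/-- connecting map -/
noncomputable def SES.δ {f : A →ₗ[R] B} {g : B →ₗ[R] C} (h : SES f g)
    (Y : Type) [AddCommGroup Y] [Module R Y] (i : ℕ) :
    EX R A Y i →ₗ[R] EX R C Y (i + 1) :=
  Abelian.Ext.bilinearCompOfLinear R (ModuleCat.of R C) (ModuleCat.of R A) (ModuleCat.of R Y)
    1 i (i + 1) (add_comm 1 i) h.shortExact.extClass

lemma SES.pre_pre_eq_zero {f : A →ₗ[R] B} {g : B →ₗ[R] C} (h : SES f g) (i : ℕ)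
    (x : EX R C Y i) : pre Y f i (pre Y g i x) = 0 := by
  rw [pre_pre, h.comp_eq_zero, pre_zero]

lemma SES.δ_pre {f : A →ₗ[R] B} {g : B →ₗ[R] C} (h : SES f g) (i : ℕ)
    (x : EX R B Y i) : h.δ Y i (pre Y f i x) = 0 :=
  h.shortExact.extClass_comp_assoc (Y := ModuleCat.of R Y) x (h := add_comm 1 i)

lemma SES.pre_δ {f : A →ₗ[R] B} {g : B →ₗ[R] C} (h : SES f g) (i : ℕ)
    (x : EX R A Y i) : pre Y g (i+1) (h.δ Y i x) = 0 :=
  h.shortExact.comp_extClass_assoc (Y := ModuleCat.of R Y) x (add_comm 1 i)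

lemma SES.exact₂ {f : A →ₗ[R] B} {g : B →ₗ[R] C} (h : SES f g) (i : ℕ)
    (x : EX R B Y i) (hx : pre Y f i x = 0) : ∃ y, pre Y g i y = x :=
  Abelian.Ext.contravariant_sequence_exact₂ h.shortExact (ModuleCat.of R Y) x hx

lemma SES.exact₁ {f : A →ₗ[R] B} {g : B →ₗ[R] C} (h : SES f g) (i : ℕ)
    (x : EX R A Y i) (hx : h.δ Y i x = 0) : ∃ y, pre Y f i y = x :=
  Abelian.Ext.contravariant_sequence_exact₁ h.shortExact (ModuleCat.of R Y) x (add_comm 1 i) hx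

lemma SES.exact₃ {f : A →ₗ[R] B} {g : B →ₗ[R] C} (h : SES f g) (i : ℕ)
    (x : EX R C Y (i+1)) (hx : pre Y g (i+1) x = 0) : ∃ y, h.δ Y i y = x :=
  Abelian.Ext.contravariant_sequence_exact₃ h.shortExact (ModuleCat.of R Y) x hx (add_comm 1 i)

lemma SES.pre_inj {f : A →ₗ[R] B} {g : B →ₗ[R] C} (h : SES f g)
    (x : EX R C Y 0) (hx : pre Y g 0 x = 0) : x = 0 := by
  have : Epi (ModuleCat.ofHom g) := (ModuleCat.epi_iff_surjective _).mpr h.surj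
  refine Abelian.Ext.precomp_mk₀_injective_of_epi (ModuleCat.of R Y) (ModuleCat.ofHom g) ?_
  exact hx.trans (map_zero ((Abelian.Ext.mk₀ (ModuleCat.ofHom g)).precomp
    (ModuleCat.of R Y) (zero_add 0))).symm

lemma ext_assoc_aux {X₁ X₂ X₃ X₄ : ModuleCat.{0} R} (α : Abelian.Ext X₁ X₂ 1) (β : X₂ ⟶ X₃)
    (γ : X₁ ⟶ X₄) (ε : Abelian.Ext X₄ X₃ 1)
    (h : α.comp (Abelian.Ext.mk₀ β) (add_zero 1) = (Abelian.Ext.mk₀ γ).comp ε (zero_add 1))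
    {Z : ModuleCat.{0} R} (i : ℕ) (x : Abelian.Ext X₃ Z i) :
    α.comp ((Abelian.Ext.mk₀ β).comp x (zero_add i)) (add_comm 1 i) =
      (Abelian.Ext.mk₀ γ).comp (ε.comp x (add_comm 1 i)) (zero_add (i+1)) := by
  rw [← Abelian.Ext.comp_assoc (a₁₂ := 1) _ _ _ (by lia) (by lia) (by lia), h,
    Abelian.Ext.comp_assoc (a₂₃ := i + 1) _ _ _ (by lia) (by lia) (by lia)]

lemma SES.δ_nat {f : A →ₗ[R] B} {g : B →ₗ[R] C} (h : SES f g)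
    {f' : A' →ₗ[R] B'} {g' : B' →ₗ[R] C'} (h' : SES f' g')
    (a : A →ₗ[R] A') (b : B →ₗ[R] B') (c : C →ₗ[R] C')
    (hab : f' ∘ₗ a = b ∘ₗ f) (hbc : g' ∘ₗ b = c ∘ₗ g) (i : ℕ) (x : EX R A' Y i) :
    h.δ Y i (pre Y a i x) = pre Y c (i+1) (h'.δ Y i x) := by
  let φ : h.sc ⟶ h'.sc :=
    { τ₁ := ModuleCat.ofHom a
      τ₂ := ModuleCat.ofHom b
      τ₃ := ModuleCat.ofHom c
      comm₁₂ := by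
        change ModuleCat.ofHom (f' ∘ₗ a) = ModuleCat.ofHom (b ∘ₗ f)
        rw [hab]
      comm₂₃ := by
        change ModuleCat.ofHom (g' ∘ₗ b) = ModuleCat.ofHom (c ∘ₗ g)
        rw [hbc] }
  have := ShortComplex.ShortExact.extClass_naturality h.shortExact h'.shortExact φ
  exact ext_assoc_aux _ _ _ _ this i x

/-- covariant functoriality -/
noncomputable def post (M : Type) [AddCommGroup M] [Module R M] (f : Y →ₗ[R] Y') (i : ℕ) :
    EX R M Y i →ₗ[R] EX R M Y' i :=
  (Abelian.Ext.bilinearCompOfLinear R (ModuleCat.of R M) (ModuleCat.of R Y) (ModuleCat.of R Y')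
    i 0 i (add_zero i)).flip (Abelian.Ext.mk₀ (ModuleCat.ofHom f))

lemma post_smul_id (r : R) (i : ℕ) (x : EX R M Y i) :
    post M (r • (LinearMap.id : Y →ₗ[R] Y)) i x = r • x :=
  (Abelian.Ext.smul_eq_comp_mk₀ (X := ModuleCat.of R M) (Y := ModuleCat.of R Y) x r).symm

/-- covariant vanishing in the third spot. -/
lemma SES.covariant_subsingleton₃ {f : A →ₗ[R] B} {g : B →ₗ[R] C} (h : SES f g) (i : ℕ)
    (h1 : Subsingleton (EX R M A (i+1))) (h2 : Subsingleton (EX R M B i)) :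
    Subsingleton (EX R M C i) := by
  refine subsingleton_of_forall_eq 0 fun x => ?_
  obtain ⟨y, hy⟩ := Abelian.Ext.covariant_sequence_exact₃ (ModuleCat.of R M) h.shortExact x rfl
    (h1.elim _ _)
  have : y = 0 := h2.elim _ _
  rw [← hy, this, Abelian.Ext.zero_comp]; rfl

/-- covariant vanishing in the second spot. -/
lemma SES.covariant_subsingleton₂ {f : A →ₗ[R] B} {g : B →ₗ[R] C} (h : SES f g) (i : ℕ)
    (h1 : Subsingleton (EX R M A i)) (h2 : Subsingleton (EX R M C i)) :
    Subsingleton (EX R M B i) := by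
  refine subsingleton_of_forall_eq 0 fun x => ?_
  obtain ⟨y, hy⟩ := Abelian.Ext.covariant_sequence_exact₂ (ModuleCat.of R M) h.shortExact x
    (h2.elim _ _)
  have : y = 0 := h1.elim _ _
  rw [← hy, this, Abelian.Ext.zero_comp]; rfl

/-- degree zero -/
noncomputable def hom0 : EX R M Y 0 ≃ₗ[R] (M →ₗ[R] Y) :=
  (Abelian.Ext.linearEquiv₀ (R := R) (X := ModuleCat.of R M) (Y := ModuleCat.of R Y)).trans
    ModuleCat.homLinearEquiv

lemma hom0_symm (f : M →ₗ[R] Y) :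
    hom0.symm f = (show EX R M Y 0 from Abelian.Ext.mk₀ (ModuleCat.ofHom f)) := rfl

lemma pre_hom0_symm (f : M →ₗ[R] M') (g : M' →ₗ[R] Y) :
    pre Y f 0 (hom0.symm g) = hom0.symm (g ∘ₗ f) := by
  rw [pre_apply, hom0_symm, hom0_symm]
  exact Abelian.Ext.mk₀_comp_mk₀ _ _

lemma hom0_pre (f : M →ₗ[R] M') (x : EX R M' Y 0) :
    hom0 (pre Y f 0 x) = hom0 x ∘ₗ f := by
  obtain ⟨g, rfl⟩ := hom0.symm.surjective x
  simp [pre_hom0_symm]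

lemma subsingleton_of_free [Module.Free R M] (i : ℕ) : Subsingleton (EX R M Y (i+1)) :=
  haveI : Projective (ModuleCat.of R M) := by
    rw [← IsProjective.iff_projective]; infer_instance
  Abelian.Ext.subsingleton_of_projective (ModuleCat.of R M) (ModuleCat.of R Y) i

end ExtKit
end NG


namespace NG
open CategoryTheory Abelian

section Bridge

variable {R : Type} [CommRing R] {X : ModuleCat.{0} R} (P : ProjectiveResolution X)
  (Y : ModuleCat.{0} R)

lemma extMk_eq_zero_iff0 (f : P.complex.X 0 ⟶ Y) (m : ℕ) (hm : 0 + 1 = m)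
    (hf : P.complex.d m 0 ≫ f = 0) :
    P.extMk f m hm hf = 0 ↔ f = 0 := by
  simp only [← P.extEquivCohomologyClass.apply_eq_iff_eq,
    ProjectiveResolution.extEquivCohomologyClass_extMk,
    ProjectiveResolution.extEquivCohomologyClass_zero,
    CochainComplex.HomComplex.CohomologyClass.mk_eq_zero_iff]
  rw [CochainComplex.HomComplex.Cocycle.toSingleMk_mem_coboundaries_iff _ _ _ _ _ 1 (by simp)]
  have hz : Limits.IsZero (P.cochainComplex.X 1) :=
    P.cochainComplex.isZero_of_isStrictlyLE 0 1 (by lia)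
  constructor
  · rintro ⟨g, hg⟩
    have : g = 0 := hz.eq_of_src _ _
    rw [this, Limits.comp_zero] at hg
    rw [← cancel_epi (P.cochainComplexXIso (-(0:ℕ)) 0 rfl).hom]
    simpa using hg.symm
  · rintro rfl
    exact ⟨0, by simp⟩

lemma smul_extMk {n : ℕ} (r : R) (f : P.complex.X n ⟶ Y) (m : ℕ) (hm : n + 1 = m)
    (hf : P.complex.d m n ≫ f = 0) :
    r • P.extMk f m hm hf = P.extMk (r • f) m hm (by rw [Linear.comp_smul, hf, smul_zero]) := by
  rw [Abelian.Ext.smul_eq_comp_mk₀, ProjectiveResolution.extMk_comp_mk₀]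
  simp

/-- cocycles to Ext -/
noncomputable def cocToExt (p n : ℕ) :
    LinearMap.ker ((P.complex.linearYonedaObj R Y).sc' p n (n+1)).g.hom →ₗ[R] Abelian.Ext X Y n where
  toFun f := P.extMk (n := n) f.1 (n+1) rfl f.2
  map_add' _ _ := (P.add_extMk _ _ _ _ _ _).symm
  map_smul' _ _ := (smul_extMk P Y _ _ _ _ _).symm

lemma cocToExt_surj (p n : ℕ) : Function.Surjective (cocToExt P Y p n) := fun α => by
  obtain ⟨f, hf, h⟩ := P.extMk_surjective α (n+1) rfl
  exact ⟨⟨f, hf⟩, h⟩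

lemma bridge_aux (n p : ℕ) (hp : (ComplexShape.up ℕ).prev n = p) :
    Nonempty ((P.complex.linearYonedaObj R Y).homology n ≃ₗ[R] Abelian.Ext X Y n) := by
  let T := P.complex.linearYonedaObj R Y
  let e1 : T.homology n ≅ (T.sc' p n (n+1)).moduleCatLeftHomologyData.H :=
    (ShortComplex.homologyMapIso (T.isoSc' p n (n+1) hp (by simp))) ≪≫
      (T.sc' p n (n+1)).moduleCatHomologyIso
  have hker : LinearMap.range (T.sc' p n (n+1)).moduleCatToCycles
      = LinearMap.ker (cocToExt P Y p n) := by
    ext ⟨f, hf⟩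
    rw [LinearMap.mem_range, LinearMap.mem_ker]
    rcases n with _ | n
    · have : p = 0 := by rw [← hp]; simp
      subst this
      refine Iff.trans ?_ (extMk_eq_zero_iff0 P Y f 1 rfl hf).symm
      have hd : T.d 0 0 = 0 := T.shape _ _ (by simp)
      constructor
      · rintro ⟨g, hg⟩
        have h2 := congrArg Subtype.val hg
        change (T.d 0 0).hom g = f at h2
        rw [hd] at h2
        exact h2.symm
      · intro h
        refine ⟨0, Subtype.ext ?_⟩
        rw [map_zero]; exact h.symm
    · have : p = n := by rw [← hp]; simp
      subst this
      refine Iff.trans ?_ (P.extMk_eq_zero_iff f (p+1+1) rfl hf p rfl).symm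
      constructor
      · rintro ⟨g, hg⟩
        exact ⟨g, congrArg Subtype.val hg⟩
      · rintro ⟨g, hg⟩
        exact ⟨g, Subtype.ext hg⟩
  exact ⟨e1.toLinearEquiv.trans ((Submodule.quotEquivOfEq _ _ hker).trans
    ((cocToExt P Y p n).quotKerEquivOfSurjective (cocToExt_surj P Y p n)))⟩

end Bridge

lemma bridge (R : Type) [CommRing R] (M Y : Type) [AddCommGroup M] [Module R M]
    [AddCommGroup Y] [Module R Y] (i : ℕ) : Nonempty (extMod R M Y i ≃ₗ[R] EX R M Y i) := by
  obtain ⟨e⟩ := bridge_aux (projectiveResolution (ModuleCat.of R M)) (ModuleCat.of R Y) i _ rfl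
  exact ⟨((projectiveResolution (ModuleCat.of R M)).isoExt i (ModuleCat.of R Y)).toLinearEquiv.trans e⟩

instance finite_EX (R : Type) [CommRing R] [IsNoetherianRing R] (M Y : Type) [AddCommGroup M]
    [Module R M] [AddCommGroup Y] [Module R Y] [Module.Finite R M] [Module.Finite R Y] (i : ℕ) :
    Module.Finite R (EX R M Y i) :=
  ModuleCat.finite_ext R (ModuleCat.of R M) (ModuleCat.of R Y) i

end NG


namespace NG

/-- `E` vanishes after localizing at `m`. -/
def Null {P : Type} [CommRing P] (m : Ideal P) (E : Type) [AddCommGroup E] [Module P E] : Prop :=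
  ∀ x : E, ∃ s : P, s ∉ m ∧ s • x = 0

section NullSec

variable {P : Type} [CommRing P] (m : Ideal P) [hm : m.IsMaximal]
variable {A B C : Type} [AddCommGroup A] [Module P A] [AddCommGroup B] [Module P B]
  [AddCommGroup C] [Module P C]

lemma one_notMem : (1 : P) ∉ m := fun h => hm.ne_top (m.eq_top_iff_one.mpr h)

variable {m}

lemma mul_notMem {a b : P} (ha : a ∉ m) (hb : b ∉ m) : a * b ∉ m := fun h =>
  (hm.isPrime.mem_or_mem h).elim ha hb

lemma Null.of_subsingleton [Subsingleton A] : Null m A := fun _ =>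
  ⟨1, one_notMem m, Subsingleton.elim _ _⟩

lemma Null.of_inj (h : Null m B) (f : A →ₗ[P] B) (hf : Function.Injective f) : Null m A := by
  intro x
  obtain ⟨s, hs, h0⟩ := h (f x)
  exact ⟨s, hs, hf (by rw [map_smul, h0, map_zero])⟩

lemma Null.of_surj (h : Null m A) (f : A →ₗ[P] B) (hf : Function.Surjective f) : Null m B := by
  intro y
  obtain ⟨x, rfl⟩ := hf y
  obtain ⟨s, hs, h0⟩ := h x
  exact ⟨s, hs, by rw [← map_smul, h0, map_zero]⟩

lemma Null.of_exact (hA : Null m A) (hC : Null m C) (f : A →ₗ[P] B) (g : B →ₗ[P] C)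
    (h : ∀ x, g x = 0 → ∃ y, f y = x) : Null m B := by
  intro x
  obtain ⟨s, hs, h0⟩ := hC (g x)
  obtain ⟨y, hy⟩ := h (s • x) (by rw [map_smul, h0])
  obtain ⟨t, ht, h1⟩ := hA y
  refine ⟨t * s, mul_notMem ht hs, ?_⟩
  rw [mul_smul, ← hy, ← map_smul, h1, map_zero]

lemma Null.nakayama [Module.Finite P A] (y : P) (hy : y ∈ m)
    (h : ∀ x : A, ∃ s : P, s ∉ m ∧ ∃ z : A, s • x = y • z) : Null m A := by
  have h1 : (⊤ : Submodule P A) ≤ m • ⊤ := by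
    intro x _
    obtain ⟨s, hs, z, hz⟩ := h x
    obtain ⟨t, a, ha, hta⟩ := hm.exists_inv hs
    have : x = (t * s) • x + a • x := by rw [← add_smul, hta, one_smul]
    rw [this, mul_smul, hz]
    refine add_mem (Submodule.smul_mem _ _ (Submodule.smul_mem_smul hy trivial))
      (Submodule.smul_mem_smul ha trivial)
  obtain ⟨r, hr, h2⟩ := Submodule.exists_sub_one_mem_and_smul_eq_zero_of_fg_of_le_smul m ⊤
    (Module.Finite.fg_top) h1
  refine fun x => ⟨r, fun hrm => one_notMem m ?_, h2 x trivial⟩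
  have := sub_mem hrm hr
  simpa using this

/-- if everything is killed by `m`, Null means zero -/
lemma Null.subsingleton (h : Null m A) (hk : ∀ a ∈ m, ∀ x : A, a • x = 0) : Subsingleton A := by
  refine subsingleton_of_forall_eq 0 fun x => ?_
  obtain ⟨s, hs, h0⟩ := h x
  obtain ⟨t, a, ha, hta⟩ := hm.exists_inv hs
  have : x = (t * s) • x + a • x := by rw [← add_smul, hta, one_smul]
  rw [this, mul_smul, h0, hk a ha, smul_zero, add_zero]

/-- multiplication by an element: short exact sequence -/
lemma ses_smul (y : P) (hy : ∀ x : A, y • x = 0 → x = 0) :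
    SES (y • (LinearMap.id : A →ₗ[P] A))
      (Submodule.mkQ (LinearMap.range (y • (LinearMap.id : A →ₗ[P] A)))) where
  inj := by
    rw [injective_iff_map_eq_zero]; exact hy
  surj := Submodule.mkQ_surjective _
  exact := LinearMap.exact_iff.mpr (Submodule.ker_mkQ _)

/-- the main inductive step: pass from `N/yN` to `N` -/
lemma Null.step [IsNoetherianRing P] {Y : Type} [AddCommGroup Y] [Module P Y] [Module.Finite P Y]
    [Module.Finite P A] (y : P) (hym : y ∈ m) (hy : ∀ x : A, y • x = 0 → x = 0) (i : ℕ)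
    (h : Null m (EX P (A ⧸ LinearMap.range (y • (LinearMap.id : A →ₗ[P] A))) Y (i+1))) :
    Null m (EX P A Y i) := by
  have hses := ses_smul y hy
  refine Null.nakayama y hym fun x => ?_
  obtain ⟨s, hs, h0⟩ := h (hses.δ Y i x)
  rw [← map_smul] at h0
  obtain ⟨z, hz⟩ := hses.exact₁ i _ h0
  rw [pre_smul, pre_id] at hz
  exact ⟨s, hs, z, hz.symm⟩

lemma Null.ses_middle {f : A →ₗ[P] B} {g : B →ₗ[P] C} (h : SES f g) {Y : Type} [AddCommGroup Y]
    [Module P Y] (i : ℕ) (hA : Null m (EX P A Y i)) (hC : Null m (EX P C Y i)) :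
    Null m (EX P B Y i) :=
  Null.of_exact hC hA (pre Y g i) (pre Y f i) (fun x hx => h.exact₂ i x hx)

lemma Null.equiv (h : Null m A) (e : A ≃ₗ[P] B) : Null m B :=
  h.of_inj e.symm.toLinearMap e.symm.injective

end NullSec

theorem claim {P : Type} [CommRing P] [IsNoetherianRing P] (m : Ideal P) [hm : m.IsMaximal]
    {ι : Type} [Fintype ι] [DecidableEq ι] (p : ι → P) (hpm : ∀ i, p i ∈ m)
    (hp : ∀ q : Ideal P, q.IsPrime → (∀ i, p i ∈ q) → q = m)
    (Y : Type) [AddCommGroup Y] [Module P Y] [Module.Finite P Y] (t : ℕ) :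
    ∀ (J : Finset ι), Jᶜ.card = t → ∀ (N : Type) [AddCommGroup N] [Module P N] [Module.Finite P N],
      (∀ j ∈ J, ∃ e : ℕ, ∀ x : N, (p j) ^ e • x = 0) → ∀ i : ℕ,
      (∀ l ≤ t, Subsingleton (EX P (P ⧸ m) Y (i + l))) → Null m (EX P N Y i) := by
  induction t using Nat.strong_induction_on with
  | _ t ih =>
  intro J hJ N _ _ hN hkill i hvan
  revert hkill
  refine IsNoetherianRing.induction_on_isQuotientEquivQuotientPrime (A := P)
    (motive := fun N _ _ _ => (∀ j ∈ J, ∃ e : ℕ, ∀ x : N, (p j) ^ e • x = 0) →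
      Null m (EX P N Y i)) hN ?_ ?_ ?_
  · intro N _ _ _ _ _
    have : Subsingleton (EX P N Y i) := by
      refine subsingleton_of_forall_eq 0 fun x => ?_
      have h := pre_id (R := P) i x
      have h0 : (LinearMap.id : N →ₗ[P] N) = 0 := Subsingleton.elim _ _
      rw [h0, pre_zero] at h
      exact h.symm
    exact Null.of_subsingleton
  · intro N _ _ _ q e hkill
    refine Null.equiv (A := EX P (P ⧸ q.1) Y i) ?_ (preEquiv Y e i)
    have hq := q.2
    have hJq : ∀ j ∈ J, p j ∈ q.1 := by
      intro j hj
      obtain ⟨n, hn⟩ := hkill j hj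
      have := hn (e.symm 1)
      rw [← map_smul, LinearEquiv.map_eq_zero_iff] at this
      have h2 : (Ideal.Quotient.mk q.1) (p j ^ n) = 0 := by
        rw [← this, Algebra.smul_def, mul_one]; rfl
      exact hq.mem_of_pow_mem _ (Ideal.Quotient.eq_zero_iff_mem.mp h2)
    by_cases hall : ∀ j, p j ∈ q.1
    · have := hp q.1 hq hall
      rw [this]
      have := hvan 0 (Nat.zero_le _)
      exact Null.of_subsingleton
    · push Not at hall
      obtain ⟨j, hj⟩ := hall
      have hjJ : j ∉ J := fun h => hj (hJq j h)
      have hreg : ∀ x : P ⧸ q.1, p j • x = 0 → x = 0 := by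
        intro x hx
        rw [Algebra.smul_def] at hx
        rcases mul_eq_zero.mp hx with h | h
        · exact absurd (Ideal.Quotient.eq_zero_iff_mem.mp h) hj
        · exact h
      have hcard : (insert j J)ᶜ.card < t := by
        rw [← hJ]
        apply Finset.card_lt_card
        rw [Finset.compl_insert]
        exact Finset.erase_ssubset (by simpa using hjJ)
      refine Null.step (p j) (hpm j) hreg i ?_
      refine ih _ hcard (insert j J) rfl _ ?_ (i+1) ?_
      · intro l hl
        rcases Finset.mem_insert.mp hl with rfl | hl
        · refine ⟨1, fun x => ?_⟩
          obtain ⟨x, rfl⟩ := Submodule.mkQ_surjective _ x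
          rw [pow_one, ← map_smul]
          exact (Submodule.Quotient.mk_eq_zero _).mpr ⟨x, rfl⟩
        · refine ⟨1, fun x => ?_⟩
          obtain ⟨x, rfl⟩ := Submodule.mkQ_surjective _ x
          obtain ⟨x, rfl⟩ := Ideal.Quotient.mk_surjective x
          rw [pow_one, ← map_smul]
          have : p l • (Ideal.Quotient.mk q.1 x) = 0 := by
            rw [Algebra.smul_def]
            have : algebraMap P (P ⧸ q.1) (p l) = 0 :=
              Ideal.Quotient.eq_zero_iff_mem.mpr (hJq l hl)
            rw [this, zero_mul]
          rw [this, map_zero]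
      · intro l hl
        have := hvan (l+1) (by omega)
        rwa [add_assoc, add_comm 1 l]
  · intro N₁ _ _ _ N₂ _ _ _ N₃ _ _ _ f g hf hg hfg h1 h3 hkill
    refine Null.ses_middle ⟨hf, hg, hfg⟩ i (h1 ?_) (h3 ?_)
    · intro j hj
      obtain ⟨e, he⟩ := hkill j hj
      exact ⟨e, fun x => hf (by rw [map_smul, he, map_zero])⟩
    · intro j hj
      obtain ⟨e, he⟩ := hkill j hj
      refine ⟨e, fun x => ?_⟩
      obtain ⟨x, rfl⟩ := hg x
      rw [← map_smul, he, map_zero]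

end NG


namespace NG
open MvPolynomial

section SRBasics

variable {k : Type} [Field k] {n : ℕ}

/-- indicator exponent -/
noncomputable def ind (σ : Finset (Fin n)) : Fin n →₀ ℕ := ∑ i ∈ σ, Finsupp.single i 1

lemma ind_apply (σ : Finset (Fin n)) (i : Fin n) : ind σ i = if i ∈ σ then 1 else 0 := by
  classical
  simp [ind, Finsupp.finsetSum_apply, Finsupp.single_apply]

lemma ind_support (σ : Finset (Fin n)) : (ind σ).support = σ := by
  ext i; simp [ind_apply]

lemma ind_le_iff (σ : Finset (Fin n)) (a : Fin n →₀ ℕ) : ind σ ≤ a ↔ σ ⊆ a.support := by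
  constructor
  · intro h i hi
    have := h i
    simp only [ind_apply, hi, if_true] at this
    simp; omega
  · intro h i
    rw [ind_apply]
    split_ifs with hi
    · have := h hi
      simp at this; omega
    · exact Nat.zero_le _

lemma support_add (a b : Fin n →₀ ℕ) : (a + b).support = a.support ∪ b.support := by
  ext i; simp; omega

lemma support_mono {a b : Fin n →₀ ℕ} (h : a ≤ b) : a.support ⊆ b.support := by
  intro i hi
  have := h i
  simp at hi ⊢; omega

variable (k) in
/-- the squarefree monomial of `σ` -/
noncomputable def xm (σ : Finset (Fin n)) : MvPolynomial (Fin n) k := ∏ i ∈ σ, X i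

lemma xm_eq (σ : Finset (Fin n)) : xm k σ = monomial (ind σ) 1 := by
  unfold xm ind
  rw [monomial_sum_one]
  rfl

lemma mem_sr {Γ : SC n} {p : MvPolynomial (Fin n) k} :
    p ∈ srIdeal k Γ ↔ ∀ a : Fin n →₀ ℕ, a.support ∈ Γ.faces → p.coeff a = 0 := by
  have : srIdeal k Γ = Ideal.span ((fun s => monomial s (1 : k)) '' (ind '' {σ | σ ∉ Γ.faces})) := by
    unfold srIdeal
    congr 1
    ext m
    simp only [Set.mem_ofPred_eq, Set.mem_image, exists_exists_and_eq_and]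
    refine exists_congr fun σ => and_congr_right fun _ => ?_
    rw [← xm_eq]
    exact eq_comm
  rw [this, mem_ideal_span_monomial_image]
  constructor
  · intro h a ha
    by_contra hc
    obtain ⟨_, ⟨σ, hσ, rfl⟩, hs⟩ := h a (by simpa using hc)
    exact hσ (Γ.down_closed ha ((ind_le_iff _ _).mp hs))
  · intro h a ha
    refine ⟨_, ⟨a.support, fun hf => ?_, rfl⟩, (ind_le_iff _ _).mpr le_rfl⟩
    simp [h a hf] at ha

lemma coeff_xm_mul (σ : Finset (Fin n)) (p : MvPolynomial (Fin n) k) (a : Fin n →₀ ℕ) :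
    coeff a (xm k σ * p) = if σ ⊆ a.support then coeff (a - ind σ) p else 0 := by
  rw [xm_eq, coeff_monomial_mul']
  simp [ind_le_iff]

open Classical in
/-- coefficient functional -/
noncomputable def cf {Γ : SC n} (a : Fin n →₀ ℕ) (x : SRRing k Γ) : k :=
  if a.support ∈ Γ.faces then coeff a (Quotient.out x) else 0

/-- quotient map -/
noncomputable abbrev mk (Γ : SC n) : MvPolynomial (Fin n) k →+* SRRing k Γ :=
  Ideal.Quotient.mk (srIdeal k Γ)

lemma mk_surj {Γ : SC n} (x : SRRing k Γ) : ∃ p, mk Γ p = x := Ideal.Quotient.mk_surjective x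

lemma cf_mk {Γ : SC n} {a : Fin n →₀ ℕ} (ha : a.support ∈ Γ.faces) (p : MvPolynomial (Fin n) k) :
    cf a (mk Γ p) = coeff a p := by
  have h : mk Γ (Quotient.out (mk Γ p)) = mk Γ p := Quotient.out_eq _
  rw [Ideal.Quotient.mk_eq_mk_iff_sub_mem, mem_sr] at h
  have := h a ha
  rw [coeff_sub, sub_eq_zero] at this
  rw [cf, if_pos ha, this]

lemma cf_of_not {Γ : SC n} {a : Fin n →₀ ℕ} (ha : a.support ∉ Γ.faces) (x : SRRing k Γ) :
    cf a x = 0 := by rw [cf, if_neg ha]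

lemma mk_eq_zero {Γ : SC n} {p : MvPolynomial (Fin n) k} :
    mk Γ p = 0 ↔ ∀ a : Fin n →₀ ℕ, a.support ∈ Γ.faces → p.coeff a = 0 := by
  rw [Ideal.Quotient.eq_zero_iff_mem, mem_sr]

lemma cf_add {Γ : SC n} (a : Fin n →₀ ℕ) (x y : SRRing k Γ) : cf a (x + y) = cf a x + cf a y := by
  obtain ⟨p, rfl⟩ := mk_surj x
  obtain ⟨q, rfl⟩ := mk_surj y
  by_cases ha : a.support ∈ Γ.faces
  · rw [← map_add, cf_mk ha, cf_mk ha, cf_mk ha, coeff_add]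
  · simp [cf_of_not ha]

/-- coefficient functional as additive map -/
noncomputable def cfHom {Γ : SC n} (a : Fin n →₀ ℕ) : SRRing k Γ →+ k :=
  AddMonoidHom.mk' (cf a) (cf_add a)

lemma cf_zero {Γ : SC n} (a : Fin n →₀ ℕ) : cf a (0 : SRRing k Γ) = 0 := (cfHom a).map_zero

lemma cf_neg {Γ : SC n} (a : Fin n →₀ ℕ) (x : SRRing k Γ) : cf a (-x) = - cf a x :=
  (cfHom a).map_neg x

lemma cf_sub {Γ : SC n} (a : Fin n →₀ ℕ) (x y : SRRing k Γ) : cf a (x - y) = cf a x - cf a y :=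
  (cfHom a).map_sub x y

lemma cf_sum {Γ : SC n} (a : Fin n →₀ ℕ) {ι : Type} (s : Finset ι) (f : ι → SRRing k Γ) :
    cf a (∑ i ∈ s, f i) = ∑ i ∈ s, cf a (f i) :=
  map_sum (cfHom a) f s

lemma smul_mk {Γ : SC n} (p q : MvPolynomial (Fin n) k) : p • mk Γ q = mk Γ (p * q) := rfl

lemma cf_C_smul {Γ : SC n} (a : Fin n →₀ ℕ) (c : k) (x : SRRing k Γ) :
    cf a ((C c : MvPolynomial (Fin n) k) • x) = c * cf a x := by
  obtain ⟨p, rfl⟩ := mk_surj x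
  by_cases ha : a.support ∈ Γ.faces
  · rw [smul_mk, cf_mk ha, cf_mk ha, coeff_C_mul]
  · simp [cf_of_not ha]

lemma cf_monomial_smul {Γ : SC n} {a : Fin n →₀ ℕ} (ha : a.support ∈ Γ.faces) (b : Fin n →₀ ℕ)
    (c : k) (x : SRRing k Γ) :
    cf a ((monomial b c : MvPolynomial (Fin n) k) • x) = if b ≤ a then c * cf (a - b) x else 0 := by
  obtain ⟨p, rfl⟩ := mk_surj x
  rw [smul_mk, cf_mk ha, coeff_monomial_mul']
  split_ifs with h
  · rw [cf_mk (Γ.down_closed ha (support_mono tsub_le_self))]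
  · rfl

lemma cf_xm_smul {Γ : SC n} {a : Fin n →₀ ℕ} (ha : a.support ∈ Γ.faces) (σ : Finset (Fin n))
    (x : SRRing k Γ) :
    cf a (xm k σ • x) = if σ ⊆ a.support then cf (a - ind σ) x else 0 := by
  rw [xm_eq, cf_monomial_smul ha]
  simp [ind_le_iff]

lemma cf_ext {Γ : SC n} {x y : SRRing k Γ} (h : ∀ a, a.support ∈ Γ.faces → cf a x = cf a y) :
    x = y := by
  obtain ⟨p, rfl⟩ := mk_surj x
  obtain ⟨q, rfl⟩ := mk_surj y
  rw [← sub_eq_zero, ← map_sub, mk_eq_zero]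
  intro a ha
  have := h a ha
  rw [cf_mk ha, cf_mk ha] at this
  rw [coeff_sub, this, sub_self]

/-- multiplication maps between Stanley-Reisner rings -/
noncomputable def mm (p : MvPolynomial (Fin n) k) (Γ Γ' : SC n)
    (h : ∀ q ∈ srIdeal k Γ, p * q ∈ srIdeal k Γ') :
    SRRing k Γ →ₗ[MvPolynomial (Fin n) k] SRRing k Γ' :=
  Submodule.mapQ (srIdeal k Γ) (srIdeal k Γ') (LinearMap.mulLeft _ p) h

lemma mm_mk (p : MvPolynomial (Fin n) k) (Γ Γ' : SC n)
    (h : ∀ q ∈ srIdeal k Γ, p * q ∈ srIdeal k Γ') (q : MvPolynomial (Fin n) k) :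
    mm p Γ Γ' h (mk Γ q) = mk Γ' (p * q) := rfl

lemma mm_comp (p q : MvPolynomial (Fin n) k) (Γ Γ' Γ'' : SC n)
    (h : ∀ r ∈ srIdeal k Γ, p * r ∈ srIdeal k Γ')
    (h' : ∀ r ∈ srIdeal k Γ', q * r ∈ srIdeal k Γ'')
    (h'' : ∀ r ∈ srIdeal k Γ, (q * p) * r ∈ srIdeal k Γ'') :
    mm q Γ' Γ'' h' ∘ₗ mm p Γ Γ' h = mm (q * p) Γ Γ'' h'' := by
  refine LinearMap.ext fun x => ?_
  obtain ⟨r, rfl⟩ := mk_surj x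
  simp only [LinearMap.comp_apply, mm_mk, mul_assoc]

/-- full simplex on `σ` -/
def simplex (σ : Finset (Fin n)) : SC n where
  faces := σ.powerset
  empty_mem := by simp
  down_closed := by
    intro a b ha hb
    simp only [Finset.mem_powerset] at *
    exact hb.trans ha

lemma mem_simplex {σ τ : Finset (Fin n)} : τ ∈ (simplex σ).faces ↔ τ ⊆ σ := by
  simp [simplex]

/-- faces of card at most `s` -/
def skel (Γ : SC n) (s : ℕ) : SC n where
  faces := Γ.faces.filter fun σ => σ.card ≤ s
  empty_mem := by simp [Γ.empty_mem]
  down_closed := by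
    intro a b ha hb
    simp only [Finset.mem_filter] at *
    exact ⟨Γ.down_closed ha.1 hb, (Finset.card_le_card hb).trans ha.2⟩

lemma mem_skel {Γ : SC n} {s : ℕ} {σ : Finset (Fin n)} :
    σ ∈ (skel Γ s).faces ↔ σ ∈ Γ.faces ∧ σ.card ≤ s := by simp [skel]

/-- faces of card `s` -/
abbrev Fc (Γ : SC n) (s : ℕ) : Type := {σ : Finset (Fin n) // σ ∈ Γ.faces ∧ σ.card = s}

variable (k) in
/-- the product of coordinate rings of the faces of card `s` -/
abbrev PF (Γ : SC n) (s : ℕ) : Type := ∀ σ : Fc Γ s, SRRing k (simplex σ.1)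

/-- restriction -/
lemma one_mul_mem {Γ Γ' : SC n} (h : Γ'.faces ⊆ Γ.faces) :
    ∀ q ∈ srIdeal k Γ, 1 * q ∈ srIdeal k Γ' := by
  intro q hq
  rw [one_mul]
  rw [mem_sr] at *
  exact fun a ha => hq a (h ha)

/-- restriction map -/
noncomputable def res {Γ Γ' : SC n} (h : Γ'.faces ⊆ Γ.faces) :
    SRRing k Γ →ₗ[MvPolynomial (Fin n) k] SRRing k Γ' := mm 1 Γ Γ' (one_mul_mem h)

lemma res_mk {Γ Γ' : SC n} (h : Γ'.faces ⊆ Γ.faces) (q : MvPolynomial (Fin n) k) :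
    res h (mk Γ q) = mk Γ' q := by
  unfold res
  rw [mm_mk, one_mul]

lemma cf_res {Γ Γ' : SC n} (h : Γ'.faces ⊆ Γ.faces) {a : Fin n →₀ ℕ} (ha : a.support ∈ Γ'.faces)
    (x : SRRing k Γ) : cf a (res h x) = cf a x := by
  obtain ⟨p, rfl⟩ := mk_surj x
  rw [res_mk, cf_mk ha, cf_mk (h ha)]

lemma res_surj {Γ Γ' : SC n} (h : Γ'.faces ⊆ Γ.faces) : Function.Surjective (res (k := k) h) := by
  intro x
  obtain ⟨p, rfl⟩ := mk_surj x
  exact ⟨mk Γ p, res_mk h p⟩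

/-- multiplication by `x_τ`, allowed when faces of `Γ'` containing `τ` are faces of `Γ`. -/
lemma xm_mul_mem {Γ Γ' : SC n} {τ : Finset (Fin n)}
    (h : ∀ σ ∈ Γ'.faces, τ ⊆ σ → σ ∈ Γ.faces) :
    ∀ q ∈ srIdeal k Γ, xm k τ * q ∈ srIdeal k Γ' := by
  intro q hq
  rw [mem_sr] at *
  intro a ha
  rw [coeff_xm_mul]
  split_ifs with hs
  · exact hq _ (Γ.down_closed (h _ ha hs) (support_mono tsub_le_self))
  · rfl

/-- multiplication by `x_τ` -/
noncomputable def mx {Γ Γ' : SC n} (τ : Finset (Fin n))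
    (h : ∀ σ ∈ Γ'.faces, τ ⊆ σ → σ ∈ Γ.faces) :
    SRRing k Γ →ₗ[MvPolynomial (Fin n) k] SRRing k Γ' := mm (xm k τ) Γ Γ' (xm_mul_mem h)

lemma cf_mx {Γ Γ' : SC n} (τ : Finset (Fin n))
    (h : ∀ σ ∈ Γ'.faces, τ ⊆ σ → σ ∈ Γ.faces) {a : Fin n →₀ ℕ} (ha : a.support ∈ Γ'.faces)
    (x : SRRing k Γ) :
    cf a (mx τ h x) = if τ ⊆ a.support then cf (a - ind τ) x else 0 := by
  obtain ⟨p, rfl⟩ := mk_surj x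
  unfold mx
  rw [mm_mk, cf_mk ha, coeff_xm_mul]
  split_ifs with hs
  · rw [cf_mk (Γ.down_closed (h _ ha hs) (support_mono tsub_le_self))]
  · rfl

lemma mx_mk {Γ Γ' : SC n} (τ : Finset (Fin n))
    (h : ∀ σ ∈ Γ'.faces, τ ⊆ σ → σ ∈ Γ.faces) (p : MvPolynomial (Fin n) k) :
    mx τ h (mk Γ p) = mk Γ' (xm k τ * p) := rfl

lemma Fc.top {Γ : SC n} {s : ℕ} (hΓ : ∀ σ ∈ Γ.faces, σ.card ≤ s) (σ : Fc Γ s) :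
    ∀ τ ∈ Γ.faces, σ.1 ⊆ τ → τ ∈ (simplex σ.1).faces := by
  intro τ hτ h
  rw [mem_simplex]
  exact (Finset.eq_of_subset_of_card_le h (by rw [σ.2.2]; exact hΓ τ hτ)).ge

/-- the map `∏ k[σ] → k[Γ]` given by multiplication by `x_σ` -/
noncomputable def skI {Γ : SC n} {s : ℕ} (hΓ : ∀ σ ∈ Γ.faces, σ.card ≤ s) :
    PF k Γ s →ₗ[MvPolynomial (Fin n) k] SRRing k Γ :=
  ∑ σ : Fc Γ s, mx σ.1 (Fc.top hΓ σ) ∘ₗ LinearMap.proj σ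

lemma skel_sub (Γ : SC n) (s : ℕ) : (skel Γ s).faces ⊆ Γ.faces := fun _ h => (mem_skel.mp h).1

lemma cf_skI {Γ : SC n} {s : ℕ} (hΓ : ∀ σ ∈ Γ.faces, σ.card ≤ s) {a : Fin n →₀ ℕ}
    (σ : Fc Γ s) (ha : a.support = σ.1) (y : PF k Γ s) :
    cf a (skI hΓ y) = cf (a - ind σ.1) (y σ) := by
  have hf : a.support ∈ Γ.faces := by rw [ha]; exact σ.2.1
  rw [skI, LinearMap.sum_apply, cf_sum, Finset.sum_eq_single σ]
  · simp only [LinearMap.comp_apply]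
    rw [cf_mx _ _ hf, if_pos ha.ge]; rfl
  · intro τ _ hne
    simp only [LinearMap.comp_apply]
    rw [cf_mx _ _ hf, if_neg]
    rw [ha]
    intro hs
    exact hne (Subtype.ext (Finset.eq_of_subset_of_card_le hs (by rw [σ.2.2, τ.2.2])))
  · simp

lemma cf_skI_of_lt {Γ : SC n} {s : ℕ} (hΓ : ∀ σ ∈ Γ.faces, σ.card ≤ s) {a : Fin n →₀ ℕ}
    (ha : a.support.card < s) (y : PF k Γ s) :
    cf a (skI hΓ y) = 0 := by
  by_cases hf : a.support ∈ Γ.faces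
  · rw [skI, LinearMap.sum_apply, cf_sum]
    refine Finset.sum_eq_zero fun σ _ => ?_
    simp only [LinearMap.comp_apply]
    rw [cf_mx _ _ hf, if_neg]
    intro hs
    have := Finset.card_le_card hs
    rw [σ.2.2] at this
    omega
  · exact cf_of_not hf _

lemma support_add_ind_sub {a : Fin n →₀ ℕ} {σ : Finset (Fin n)} (h : a.support ⊆ σ) :
    (a + ind σ).support = σ := by
  rw [support_add, ind_support]
  exact Finset.union_eq_right.mpr h

/-- The skeleton sequence. -/
lemma ses_skel {Γ : SC n} {s : ℕ} (hΓ : ∀ σ ∈ Γ.faces, σ.card ≤ s + 1) :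
    SES (skI (k := k) hΓ) (res (skel_sub Γ s)) where
  inj := by
    rw [injective_iff_map_eq_zero]
    intro y hy
    funext σ
    refine cf_ext fun a ha => ?_
    have h := cf_skI hΓ (a := a + ind σ.1) σ (support_add_ind_sub (mem_simplex.mp ha)) y
    rw [hy, cf_zero] at h
    rw [add_tsub_cancel_right] at h
    rw [← h]
    exact (cf_zero a).symm
  surj := res_surj _
  exact := by
    intro x
    constructor
    · intro hx
      obtain ⟨p, rfl⟩ := mk_surj x
      refine ⟨fun σ => mk _ (∑ a ∈ p.support.filter (fun a => a.support = σ.1),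
        monomial (a - ind σ.1) (coeff a p)), ?_⟩
      refine cf_ext fun b hb => ?_
      rcases (hΓ _ hb).lt_or_eq with hlt | heq
      · rw [cf_skI_of_lt hΓ hlt]
        have hb' : b.support ∈ (skel Γ s).faces := mem_skel.mpr ⟨hb, by omega⟩
        rw [← cf_res (skel_sub Γ s) hb', hx, cf_zero]
      · have hs : (b - ind b.support).support ⊆ b.support := support_mono tsub_le_self
        rw [cf_skI hΓ (⟨b.support, hb, heq⟩ : Fc Γ (s+1)) rfl, cf_mk hb, cf_mk (mem_simplex.mpr hs)]
        rw [coeff_sum, Finset.sum_eq_single b]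
        · simp
        · intro c hc hne
          rw [coeff_monomial, if_neg]
          intro h
          simp only [Finset.mem_filter] at hc
          apply hne
          have h1 : ind b.support ≤ b := (ind_le_iff _ _).mpr le_rfl
          have h2 : ind b.support ≤ c := (ind_le_iff _ _).mpr hc.2.ge
          rw [← tsub_add_cancel_of_le h1, ← tsub_add_cancel_of_le h2, h]
        · intro hb'
          rw [coeff_monomial, if_pos rfl]
          by_contra hc
          exact hb' (by simp [hc])
    · rintro ⟨y, rfl⟩
      refine cf_ext fun a ha => ?_
      rw [cf_res _ ha, cf_zero, cf_skI_of_lt]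
      have := (mem_skel.mp ha).2
      omega

/-- multiplication by a variable on a simplex -/
lemma ses_var {ρ F : Finset (Fin n)} {s : Fin n} (hs : s ∉ ρ) (hF : F = insert s ρ) :
    SES (mx (k := k) (Γ := simplex F) (Γ' := simplex F) {s} (fun _ h _ => h))
      (res (Γ := simplex F) (Γ' := simplex ρ) (fun τ h => by
        rw [mem_simplex] at *; rw [hF]; exact h.trans (Finset.subset_insert _ _))) where
  inj := by
    rw [injective_iff_map_eq_zero]
    intro y hy
    refine cf_ext fun a ha => ?_
    have hf : (a + ind {s}).support ∈ (simplex F).faces := by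
      rw [mem_simplex] at *
      rw [support_add, ind_support]
      exact Finset.union_subset ha (by simp [hF])
    have h := cf_mx {s} (fun _ h _ => h) hf y
    rw [hy, cf_zero, support_add, ind_support, if_pos Finset.subset_union_right,
      add_tsub_cancel_right] at h
    rw [← h, cf_zero]
  surj := res_surj _
  exact := by
    intro x
    constructor
    · intro hx
      obtain ⟨p, rfl⟩ := mk_surj x
      refine ⟨mk _ (p.divMonomial (ind {s})), ?_⟩
      refine cf_ext fun a ha => ?_
      rw [mx_mk, cf_mk ha, cf_mk ha, coeff_xm_mul]
      split_ifs with h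
      · rw [coeff_divMonomial, add_tsub_cancel_of_le ((ind_le_iff _ _).mpr h)]
      · have ha' : a.support ∈ (simplex ρ).faces := by
          rw [mem_simplex] at *
          intro i hi
          have h1 := ha hi
          rw [hF, Finset.mem_insert] at h1
          rcases h1 with rfl | h1
          · exact absurd (by simpa using hi) h
          · exact h1
        have h2 := congrArg (cf a) hx
        rw [cf_res _ ha', cf_zero, cf_mk ha] at h2
        exact h2.symm
    · rintro ⟨y, rfl⟩
      refine cf_ext fun a ha => ?_
      have ha' : a.support ∈ (simplex F).faces := by
        rw [mem_simplex] at *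
        rw [hF]; exact ha.trans (Finset.subset_insert _ _)
      rw [cf_res _ ha, cf_zero, cf_mx _ _ ha', if_neg]
      intro h
      exact hs ((mem_simplex.mp ha) (h (by simp)))

end SRBasics
end NG


namespace NG
open MvPolynomial

section SimplexExt

variable {k : Type} [Field k] {n : ℕ}

lemma simplex_univ_sr : srIdeal k (simplex (Finset.univ : Finset (Fin n))) = ⊥ := by
  rw [eq_bot_iff]
  intro p hp
  rw [mem_sr] at hp
  rw [Submodule.mem_bot]
  ext a
  rw [hp a (by simp [mem_simplex])]
  simp

/-- `u` generates `E` with annihilator `I`. -/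
structure Gen {P : Type} [CommRing P] {E : Type} [AddCommGroup E] [Module P E] (I : Ideal P) (u : E) :
    Prop where
  gen : ∀ x : E, ∃ p : P, x = p • u
  ann : ∀ p : P, p • u = 0 ↔ p ∈ I

lemma Gen.equiv {P : Type} [CommRing P] {E : Type} [AddCommGroup E] [Module P E] {I : Ideal P} {u : E}
    (h : Gen I u) : ∃ e : (P ⧸ I) ≃ₗ[P] E, ∀ p : P, e (Ideal.Quotient.mk I p) = p • u := by
  have hk : LinearMap.ker (LinearMap.toSpanSingleton P E u) = I := by
    ext p
    rw [LinearMap.mem_ker, LinearMap.toSpanSingleton_apply, h.ann]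
  refine ⟨(Submodule.quotEquivOfEq I _ hk.symm).trans
    (LinearMap.quotKerEquivOfSurjective (LinearMap.toSpanSingleton P E u) ?_), fun p => ?_⟩
  · intro x
    obtain ⟨p, hp⟩ := h.gen x
    exact ⟨p, hp.symm⟩
  · rfl

lemma mx_eq_smul {Γ : SC n} (τ : Finset (Fin n)) (h) :
    mx (k := k) (Γ := Γ) (Γ' := Γ) τ h = xm k τ • LinearMap.id := by
  refine LinearMap.ext fun x => ?_
  obtain ⟨p, rfl⟩ := mk_surj x
  rfl

lemma cancel_xm_simplex {F τ : Finset (Fin n)} (hτ : τ ⊆ F) {p : MvPolynomial (Fin n) k}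
    (h : xm k τ * p ∈ srIdeal k (simplex F)) : p ∈ srIdeal k (simplex F) := by
  rw [mem_sr] at *
  intro a ha
  rw [mem_simplex] at ha
  have := h (a + ind τ) (by
    rw [mem_simplex, support_add, ind_support]; exact Finset.union_subset ha hτ)
  rwa [coeff_xm_mul, support_add, ind_support, if_pos Finset.subset_union_right,
    add_tsub_cancel_right] at this

lemma mem_insert_sr {ρ F : Finset (Fin n)} {s : Fin n} (hs : s ∉ ρ) (hF : F = insert s ρ)
    {p : MvPolynomial (Fin n) k} : p ∈ srIdeal k (simplex ρ) ↔
      ∃ q, p - xm k {s} * q ∈ srIdeal k (simplex F) := by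
  have h := (ses_var (k := k) hs hF).exact (mk _ p)
  rw [res_mk, Ideal.Quotient.eq_zero_iff_mem] at h
  rw [h]
  constructor
  · rintro ⟨y, hy⟩
    obtain ⟨q, rfl⟩ := mk_surj y
    refine ⟨q, ?_⟩
    rw [mx_mk, eq_comm, ← sub_eq_zero, ← map_sub, Ideal.Quotient.eq_zero_iff_mem] at hy
    exact hy
  · rintro ⟨q, hq⟩
    refine ⟨mk _ q, ?_⟩
    rw [mx_mk, eq_comm, ← sub_eq_zero, ← map_sub, Ideal.Quotient.eq_zero_iff_mem]
    exact hq

/-- main step -/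
lemma ext_simplex_step {ρ F : Finset (Fin n)} {s : Fin n} (hs : s ∉ ρ) (hF : F = insert s ρ) (j : ℕ)
    (h1 : ∀ i, i ≠ j → Subsingleton (EX (MvPolynomial (Fin n) k) (SRRing k (simplex F))
      (MvPolynomial (Fin n) k) i))
    (u : EX (MvPolynomial (Fin n) k) (SRRing k (simplex F)) (MvPolynomial (Fin n) k) j)
    (hu : Gen (srIdeal k (simplex F)) u) :
    (∀ i, i ≠ j + 1 → Subsingleton (EX (MvPolynomial (Fin n) k) (SRRing k (simplex ρ))
      (MvPolynomial (Fin n) k) i)) ∧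
    Gen (srIdeal k (simplex ρ)) ((ses_var (k := k) hs hF).δ (MvPolynomial (Fin n) k) j u) := by
  set S := MvPolynomial (Fin n) k
  have hses := ses_var (k := k) hs hF
  have hpre : ∀ i (x : EX S (SRRing k (simplex F)) S i),
      pre S (mx (k := k) (Γ := simplex F) (Γ' := simplex F) {s} (fun _ h _ => h)) i x = xm k {s} • x := by
    intro i x
    rw [mx_eq_smul, pre_smul, pre_id]
  have hinj : ∀ x : EX S (SRRing k (simplex F)) S j, xm k {s} • x = 0 → x = 0 := by
    intro x hx
    obtain ⟨p, rfl⟩ := hu.gen x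
    rw [smul_smul, hu.ann] at hx
    exact (hu.ann p).mpr (cancel_xm_simplex (by simp [hF]) hx)
  refine ⟨?_, ?_, ?_⟩
  · intro i hi
    refine subsingleton_of_forall_eq 0 fun x => ?_
    have hx : pre S (res (k := k) (Γ := simplex F) (Γ' := simplex ρ) (fun τ h => by
        rw [mem_simplex] at *; rw [hF]; exact h.trans (Finset.subset_insert _ _))) i x = 0 := by
      by_cases hij : i = j
      · subst hij
        apply hinj
        rw [← hpre]
        exact hses.pre_pre_eq_zero i x
      · have := h1 i hij
        exact Subsingleton.elim _ _
    cases i with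
    | zero => exact hses.pre_inj x hx
    | succ i =>
      obtain ⟨y, rfl⟩ := hses.exact₃ i x hx
      have := h1 i (by omega)
      rw [Subsingleton.elim y 0, map_zero]
  · intro x
    have := h1 (j+1) (by omega)
    obtain ⟨y, rfl⟩ := hses.exact₃ j x (Subsingleton.elim _ _)
    obtain ⟨p, rfl⟩ := hu.gen y
    exact ⟨p, map_smul _ _ _⟩
  · intro p
    rw [← map_smul, mem_insert_sr hs hF]
    constructor
    · intro h
      obtain ⟨y, hy⟩ := hses.exact₁ j _ h
      obtain ⟨q, rfl⟩ := hu.gen y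
      refine ⟨q, ?_⟩
      rw [hpre, smul_smul, eq_comm, ← sub_eq_zero, ← sub_smul, hu.ann] at hy
      exact hy
    · rintro ⟨q, hq⟩
      rw [← hu.ann, sub_smul, sub_eq_zero] at hq
      rw [hq, mul_smul, ← hpre]
      exact hses.δ_pre j _

lemma ext_simplex_aux (t : ℕ) : ∀ F : Finset (Fin n), F.card + t = n →
    (∀ i, i ≠ t → Subsingleton (EX (MvPolynomial (Fin n) k) (SRRing k (simplex F))
      (MvPolynomial (Fin n) k) i)) ∧
    ∃ u : EX (MvPolynomial (Fin n) k) (SRRing k (simplex F)) (MvPolynomial (Fin n) k) t,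
      Gen (srIdeal k (simplex F)) u := by
  induction t with
  | zero =>
    intro F hF
    have : F = Finset.univ := by
      apply Finset.eq_univ_of_card
      simpa using hF
    subst this
    let e : SRRing k (simplex (Finset.univ : Finset (Fin n))) ≃ₗ[MvPolynomial (Fin n) k]
        MvPolynomial (Fin n) k :=
      (Submodule.quotEquivOfEqBot _ simplex_univ_sr)
    have hfree : Module.Free (MvPolynomial (Fin n) k)
      (SRRing k (simplex (Finset.univ : Finset (Fin n)))) := Module.Free.of_equiv e.symm
    refine ⟨?_, ?_⟩
    · intro i hi
      obtain ⟨j, rfl⟩ := Nat.exists_eq_succ_of_ne_zero hi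
      exact subsingleton_of_free j
    · refine ⟨hom0.symm e.toLinearMap, ?_, ?_⟩
      · intro x
        refine ⟨hom0 x (e.symm 1), ?_⟩
        apply hom0.injective
        rw [map_smul, LinearEquiv.apply_symm_apply]
        refine LinearMap.ext fun y => ?_
        obtain ⟨z, rfl⟩ := e.symm.surjective y
        rw [LinearMap.smul_apply]
        simp only [LinearEquiv.coe_coe, LinearEquiv.apply_symm_apply, smul_eq_mul]
        rw [mul_comm, ← smul_eq_mul, ← map_smul, ← map_smul, smul_eq_mul, mul_one]
      · intro p
        have hmem : p ∈ srIdeal k (simplex (Finset.univ : Finset (Fin n))) ↔ p = 0 := by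
          rw [simplex_univ_sr, Submodule.mem_bot]
        rw [← map_smul, LinearEquiv.map_eq_zero_iff, hmem]
        constructor
        · intro h
          have := LinearMap.congr_fun h (e.symm 1)
          simpa using this
        · rintro rfl
          simp
  | succ t ih =>
    intro ρ hρ
    obtain ⟨s, hs⟩ : ∃ s, s ∉ ρ := by
      by_contra hc
      push Not at hc
      have : ρ = Finset.univ := Finset.eq_univ_of_forall hc
      rw [this] at hρ
      simp at hρ
    obtain ⟨h1, u, hu⟩ := ih (insert s ρ) (by rw [Finset.card_insert_of_notMem hs]; omega)
    obtain ⟨h2, h3⟩ := ext_simplex_step hs rfl t h1 u hu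
    exact ⟨h2, _, h3⟩

variable (k) in
lemma ext_simplex_zero {F : Finset (Fin n)} {i : ℕ} (hi : F.card + i ≠ n) :
    Subsingleton (EX (MvPolynomial (Fin n) k) (SRRing k (simplex F)) (MvPolynomial (Fin n) k) i) := by
  have hF : F.card ≤ n := by simpa using Finset.card_le_univ F
  exact (ext_simplex_aux (n - F.card) F (by omega)).1 i (by omega)

variable (k) in
lemma ext_simplex_gen {F : Finset (Fin n)} {i : ℕ} (hi : F.card + i = n) :
    ∃ u : EX (MvPolynomial (Fin n) k) (SRRing k (simplex F)) (MvPolynomial (Fin n) k) i,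
      Gen (srIdeal k (simplex F)) u :=
  (ext_simplex_aux i F hi).2

/-- `Ext(k[Γ], S)` vanishes below the codimension. -/
lemma ext_sr_zero (s : ℕ) : ∀ (Γ : SC n), (∀ σ ∈ Γ.faces, σ.card ≤ s) → ∀ i, i + s < n →
    Subsingleton (EX (MvPolynomial (Fin n) k) (SRRing k Γ) (MvPolynomial (Fin n) k) i) := by
  induction s with
  | zero =>
    intro Γ hΓ i hi
    have : Γ = simplex ∅ := by
      obtain ⟨f, h1, h2⟩ := Γ
      simp only [simplex, SC.mk.injEq]
      ext σ
      simp only [Finset.powerset_empty, Finset.mem_singleton]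
      constructor
      · intro h; simpa using hΓ σ h
      · rintro rfl; exact h1
    subst this
    exact ext_simplex_zero k (by simp; omega)
  | succ s ih =>
    intro Γ hΓ i hi
    have hses := ses_skel (k := k) hΓ
    have h1 := ih (skel Γ s) (fun σ h => (mem_skel.mp h).2) i (by omega)
    refine subsingleton_of_forall_eq 0 fun x => ?_
    have hx : pre _ (skI (k := k) hΓ) i x = 0 := by
      have : (LinearMap.id : PF k Γ (s+1) →ₗ[MvPolynomial (Fin n) k] PF k Γ (s+1)) =
          ∑ σ : Fc Γ (s+1), (LinearMap.single _ _ σ) ∘ₗ LinearMap.proj σ := by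
        refine LinearMap.ext fun y => ?_
        rw [LinearMap.sum_apply]
        exact (LinearMap.sum_single_apply _ y).symm
      rw [← pre_id (M := PF k Γ (s+1)) i (pre _ (skI (k := k) hΓ) i x), this, pre_sum]
      refine Finset.sum_eq_zero fun σ _ => ?_
      rw [← pre_pre]
      have := ext_simplex_zero k (F := σ.1) (i := i) (by rw [σ.2.2]; omega)
      rw [Subsingleton.elim (pre _ _ i (pre _ _ i x)) 0, map_zero]
    obtain ⟨y, rfl⟩ := hses.exact₂ i x hx
    rw [Subsingleton.elim y 0, map_zero]

end SimplexExt
end NG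


namespace NG
open MvPolynomial

section Canon

variable {k : Type} [Field k] {n : ℕ}

lemma simplex_sub {Γ : SC n} {F : Finset (Fin n)} (hF : F ∈ Γ.faces) :
    (simplex F).faces ⊆ Γ.faces := fun _ h => Γ.down_closed hF (mem_simplex.mp h)

lemma simplex_mono {F G : Finset (Fin n)} (h : F ⊆ G) :
    (simplex F).faces ⊆ (simplex G).faces := fun _ h' => mem_simplex.mpr ((mem_simplex.mp h').trans h)

lemma skel_mono {Γ Γ' : SC n} (h : Γ'.faces ⊆ Γ.faces) (s : ℕ) :
    (skel Γ' s).faces ⊆ (skel Γ s).faces := fun _ h' => by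
  rw [mem_skel] at *; exact ⟨h h'.1, h'.2⟩

lemma card_simplex {F : Finset (Fin n)} {s : ℕ} (hF : F.card ≤ s) :
    ∀ σ ∈ (simplex F).faces, σ.card ≤ s := fun _ h =>
  (Finset.card_le_card (mem_simplex.mp h)).trans hF

lemma skel_top (Γ : SC n) {s : ℕ} {ρ : Finset (Fin n)} (hρ : ρ.card = s) :
    ∀ σ ∈ (skel Γ s).faces, ρ ⊆ σ → σ ∈ (simplex ρ).faces := by
  intro σ hσ h
  rw [mem_simplex, Finset.eq_of_subset_of_card_le h (by rw [hρ]; exact (mem_skel.mp hσ).2)]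

lemma cf_skI_zero {Γ : SC n} {s : ℕ} (hΓ : ∀ σ ∈ Γ.faces, σ.card ≤ s) {a : Fin n →₀ ℕ}
    (ha : a.support.card ≠ s) (y : PF k Γ s) : cf a (skI hΓ y) = 0 := by
  by_cases hf : a.support ∈ Γ.faces
  · exact cf_skI_of_lt hΓ (lt_of_le_of_ne (hΓ _ hf) ha) y
  · exact cf_of_not hf _

/-- restriction of tuples -/
noncomputable def resPF {Γ Γ' : SC n} (h : Γ'.faces ⊆ Γ.faces) (s : ℕ) :
    PF k Γ s →ₗ[MvPolynomial (Fin n) k] PF k Γ' s :=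
  LinearMap.pi fun σ => LinearMap.proj (⟨σ.1, h σ.2.1, σ.2.2⟩ : Fc Γ s)

lemma skI_resPF {Γ Γ' : SC n} (h : Γ'.faces ⊆ Γ.faces) {s : ℕ} (hΓ : ∀ σ ∈ Γ.faces, σ.card ≤ s)
    (hΓ' : ∀ σ ∈ Γ'.faces, σ.card ≤ s) :
    skI (k := k) hΓ' ∘ₗ resPF h s = res h ∘ₗ skI hΓ := by
  refine LinearMap.ext fun y => cf_ext fun a ha => ?_
  rw [LinearMap.comp_apply, LinearMap.comp_apply, cf_res h ha]
  by_cases hc : a.support.card = s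
  · rw [cf_skI hΓ' ⟨a.support, ha, hc⟩ rfl, cf_skI hΓ ⟨a.support, h ha, hc⟩ rfl]
    rfl
  · rw [cf_skI_zero hΓ' hc, cf_skI_zero hΓ hc]

lemma res_comp {Γ Γ' Γ'' : SC n} (h : Γ'.faces ⊆ Γ.faces) (h' : Γ''.faces ⊆ Γ'.faces)
    (h'' : Γ''.faces ⊆ Γ.faces) :
    res (k := k) h' ∘ₗ res h = res h'' := by
  refine LinearMap.ext fun y => ?_
  obtain ⟨p, rfl⟩ := mk_surj y
  rw [LinearMap.comp_apply, res_mk, res_mk, res_mk]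

/-- diagonal -/
noncomputable def diagPF (F : Finset (Fin n)) (s : ℕ) :
    SRRing k (simplex F) →ₗ[MvPolynomial (Fin n) k] PF k (simplex F) s :=
  LinearMap.pi fun σ => res (simplex_mono (mem_simplex.mp σ.2.1))

lemma skI_diagPF {F ρ : Finset (Fin n)} {v : Fin n} {s : ℕ} (hFs : F.card = s) (hv : v ∉ ρ)
    (hF : F = insert v ρ) :
    skI (k := k) (card_simplex hFs.le) ∘ₗ diagPF F s =
      mx (Γ := simplex F) (Γ' := simplex F) ρ (fun _ h _ => h) ∘ₗ
      mx (Γ := simplex F) (Γ' := simplex F) {v} (fun _ h _ => h) := by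
  refine LinearMap.ext fun y => cf_ext fun a ha => ?_
  rw [LinearMap.comp_apply, LinearMap.comp_apply, cf_mx _ _ ha]
  have hi : ind F = ind ρ + ind {v} := by
    rw [hF]; ext i
    simp only [ind_apply, Finsupp.add_apply, Finset.mem_insert, Finset.mem_singleton]
    by_cases h1 : i = v
    · subst h1; simp [hv]
    · simp [h1]
  have hsub : (a - ind ρ).support ∈ (simplex F).faces :=
    (simplex F).down_closed ha (support_mono tsub_le_self)
  by_cases hc : a.support.card = s
  · have haF : a.support = F := Finset.eq_of_subset_of_card_le (mem_simplex.mp ha) (by omega)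
    rw [cf_skI _ ⟨F, mem_simplex.mpr le_rfl, hFs⟩ haF, if_pos (by rw [haF, hF]; exact Finset.subset_insert _ _),
      cf_mx _ _ hsub, if_pos, hi, tsub_tsub]
    · have : (a - (ind ρ + ind {v})).support ∈ (simplex F).faces :=
        (simplex F).down_closed ha (support_mono tsub_le_self)
      exact cf_res (Finset.Subset.refl _) this y
    · have : v ∈ a.support := by rw [haF, hF]; exact Finset.mem_insert_self _ _
      simp [ind_apply, hv] at this ⊢
      omega
  · rw [cf_skI_zero _ hc]
    split_ifs with h1
    · rw [cf_mx _ _ hsub, if_neg]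
      intro h2
      apply hc
      have h3 : v ∈ a.support := support_mono tsub_le_self (h2 (by simp))
      have : F ⊆ a.support := by rw [hF]; exact Finset.insert_subset h3 h1
      have := (mem_simplex.mp ha).antisymm this
      rw [this, hFs]
    · rfl

variable {Γ : SC n} {s : ℕ}

/-- matrix entry of the connecting map -/
noncomputable def DD (hΓ : ∀ σ ∈ Γ.faces, σ.card ≤ s + 1) (c : ℕ) (F : Fc Γ (s+1)) (ρ : Fc Γ s) :
    EX (MvPolynomial (Fin n) k) (SRRing k (simplex F.1)) (MvPolynomial (Fin n) k) c →ₗ[MvPolynomial (Fin n) k]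
    EX (MvPolynomial (Fin n) k) (SRRing k (simplex ρ.1)) (MvPolynomial (Fin n) k) (c+1) :=
  pre _ (mx (k := k) (Γ := simplex ρ.1) (Γ' := skel Γ s) ρ.1 (skel_top Γ ρ.2.2)) (c+1) ∘ₗ
    (ses_skel (k := k) hΓ).δ _ c ∘ₗ pre _ (LinearMap.proj F) c

lemma DD_eq (hΓ : ∀ σ ∈ Γ.faces, σ.card ≤ s + 1) (c : ℕ) (F : Fc Γ (s+1)) (ρ : Fc Γ s)
    {v : Fin n} (hv : v ∉ ρ.1) (hF : F.1 = insert v ρ.1)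
    (z : EX (MvPolynomial (Fin n) k) (SRRing k (simplex F.1)) (MvPolynomial (Fin n) k) c) :
    DD hΓ c F ρ z = (ses_var (k := k) hv hF).δ _ c z := by
  have hsub := simplex_sub F.2.1
  have hcs := card_simplex F.2.2.le
  have hC := ses_skel (k := k) hcs
  have hA := ses_skel (k := k) hΓ
  have hB := ses_var (k := k) hv hF
  let F' : Fc (simplex F.1) (s+1) := ⟨F.1, mem_simplex.mpr le_rfl, F.2.2⟩
  let x := pre (MvPolynomial (Fin n) k) (LinearMap.proj (φ := fun σ : Fc (simplex F.1) (s+1) => SRRing k (simplex σ.1)) F' : PF k (simplex F.1) (s+1) →ₗ[MvPolynomial (Fin n) k] _) c z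
  have e1 : pre _ (LinearMap.proj F : PF k Γ (s+1) →ₗ[MvPolynomial (Fin n) k] _) c z =
      pre _ (resPF hsub (s+1)) c x := by
    rw [pre_pre]; rfl
  have e2 : pre _ (diagPF F.1 (s+1)) c x = z := by
    rw [pre_pre]
    have : (LinearMap.proj (φ := fun σ : Fc (simplex F.1) (s+1) => SRRing k (simplex σ.1)) F' ∘ₗ diagPF F.1 (s+1) : SRRing k (simplex F.1) →ₗ[MvPolynomial (Fin n) k] _) = LinearMap.id := by
      refine LinearMap.ext fun y => cf_ext fun a ha => cf_res (Finset.Subset.refl _) ha y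
    exact (congrArg (fun f => pre _ f c z) this).trans (pre_id c z)
  have h1 := hA.δ_nat hC (resPF hsub (s+1)) (res hsub) (res (skel_mono hsub s))
    (skI_resPF hsub hΓ hcs) ((res_comp _ _ (fun _ h => hsub (skel_sub _ _ h))).trans
      (res_comp _ _ _).symm) c x
  have h2 := hB.δ_nat hC (diagPF F.1 (s+1)) (mx ρ.1 (fun _ h _ => h))
    (mx (k := k) (Γ := simplex ρ.1) (Γ' := skel (simplex F.1) s) ρ.1 (skel_top _ ρ.2.2))
    (skI_diagPF F.2.2 hv hF) (by
      refine LinearMap.ext fun y => ?_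
      obtain ⟨p, rfl⟩ := mk_surj y
      simp only [LinearMap.comp_apply, mx_mk, res_mk]) c x
  rw [e2] at h2
  rw [h2, DD, LinearMap.comp_apply, LinearMap.comp_apply, e1, h1, pre_pre]
  congr 1
  have : res (k := k) (skel_mono hsub s) ∘ₗ mx (k := k) (Γ := simplex ρ.1) (Γ' := skel Γ s) ρ.1 (skel_top Γ ρ.2.2)
      = mx (k := k) (Γ := simplex ρ.1) (Γ' := skel (simplex F.1) s) ρ.1 (skel_top _ ρ.2.2) := by
    refine LinearMap.ext fun y => ?_
    obtain ⟨p, rfl⟩ := mk_surj y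
    simp only [LinearMap.comp_apply, mx_mk, res_mk]
  rw [this]

lemma DD_zero (hΓ : ∀ σ ∈ Γ.faces, σ.card ≤ s + 1) (c : ℕ) (hc : s + 1 + c = n) (F : Fc Γ (s+1)) (ρ : Fc Γ s)
    (h : ¬ ρ.1 ⊆ F.1)
    (z : EX (MvPolynomial (Fin n) k) (SRRing k (simplex F.1)) (MvPolynomial (Fin n) k) c) :
    DD hΓ c F ρ z = 0 := by
  obtain ⟨i, hi, hiF⟩ := Finset.not_subset.mp h
  obtain ⟨u, hu⟩ := ext_simplex_gen k (F := F.1) (i := c) (by rw [F.2.2, hc])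
  obtain ⟨w, hw⟩ := ext_simplex_gen k (F := ρ.1) (i := c+1) (by rw [ρ.2.2]; omega)
  obtain ⟨p, rfl⟩ := hu.gen z
  have h0 : xm k {i} • u = 0 := by
    rw [hu.ann, mem_sr]
    intro a ha
    rw [← mul_one (xm k {i}), coeff_xm_mul, if_neg]
    intro h
    exact hiF (mem_simplex.mp ha (h (by simp)))
  obtain ⟨q, hq⟩ := hw.gen (DD hΓ c F ρ (p • u))
  have h1 : xm k {i} • DD hΓ c F ρ (p • u) = 0 := by
    rw [← map_smul, smul_comm, h0, smul_zero, map_zero]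
  rw [hq, smul_smul, hw.ann] at h1
  rw [hq, hw.ann]
  exact cancel_xm_simplex (by simpa using hi) h1

/-- units modulo `P_ρ` are constant -/
lemma unit_const {ρ : Finset (Fin n)} {p q : MvPolynomial (Fin n) k}
    (h : q * p - 1 ∈ srIdeal k (simplex ρ)) :
    ∃ c : k, c ≠ 0 ∧ p - C c ∈ srIdeal k (simplex ρ) := by
  let r : MvPolynomial (Fin n) k →ₐ[k] MvPolynomial (Fin n) k := aeval fun i => if i ∈ ρ then X i else 0
  have hker : ∀ f ∈ srIdeal k (simplex ρ), r f = 0 := by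
    intro f hf
    have : srIdeal k (simplex ρ) ≤ RingHom.ker r := by
      unfold srIdeal
      rw [Ideal.span_le]
      rintro _ ⟨σ, hσ, rfl⟩
      rw [mem_simplex] at hσ
      obtain ⟨i, hi, hiρ⟩ := Finset.not_subset.mp hσ
      simp only [SetLike.mem_coe, RingHom.mem_ker, map_prod]
      refine Finset.prod_eq_zero hi ?_
      simp [r, hiρ]
    exact this hf
  have hX : ∀ f, f - r f ∈ srIdeal k (simplex ρ) := by
    intro f
    induction f using MvPolynomial.induction_on with
    | C a => simp [r]
    | add p q hp hq =>
      rw [map_add, add_sub_add_comm]; exact add_mem hp hq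
    | mul_X p i hp =>
      rw [map_mul]
      have : p * X i - r p * r (X i) = (p - r p) * X i + r p * (X i - r (X i)) := by ring
      rw [this]
      refine add_mem (Ideal.mul_mem_right _ _ hp) (Ideal.mul_mem_left _ _ ?_)
      by_cases hi : i ∈ ρ
      · simp [r, hi]
      · simp only [r, aeval_X, hi, if_false, sub_zero]
        refine Ideal.subset_span ⟨{i}, ?_, by simp⟩
        rw [mem_simplex]; simpa using hi
  have hu : IsUnit (r p) := by
    have := hker _ h
    rw [map_sub, map_mul, map_one, sub_eq_zero] at this
    exact IsUnit.of_mul_eq_one (r q) (by rw [mul_comm]; exact this)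
  rw [isUnit_iff_eq_C_of_isReduced] at hu
  obtain ⟨c, hc, he⟩ := hu
  exact ⟨c, hc.ne_zero, he ▸ hX p⟩

lemma DD_const (hΓ : ∀ σ ∈ Γ.faces, σ.card ≤ s + 1) (c : ℕ) (hc : s + 1 + c = n) (F : Fc Γ (s+1)) (ρ : Fc Γ s)
    {u : EX (MvPolynomial (Fin n) k) (SRRing k (simplex F.1)) (MvPolynomial (Fin n) k) c}
    (hu : Gen (srIdeal k (simplex F.1)) u)
    {w : EX (MvPolynomial (Fin n) k) (SRRing k (simplex ρ.1)) (MvPolynomial (Fin n) k) (c+1)}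
    (hw : Gen (srIdeal k (simplex ρ.1)) w) :
    ∃ a : k, DD hΓ c F ρ u = (C a : MvPolynomial (Fin n) k) • w ∧ (a ≠ 0 ↔ ρ.1 ⊆ F.1) := by
  by_cases h : ρ.1 ⊆ F.1
  · obtain ⟨v, hv, hF⟩ : ∃ v, v ∉ ρ.1 ∧ F.1 = insert v ρ.1 := by
      have h2 : (F.1 \ ρ.1).card = 1 := by
        rw [Finset.card_sdiff_of_subset h, F.2.2, ρ.2.2]; omega
      obtain ⟨v, hv⟩ := Finset.card_eq_one.mp h2
      have h3 : v ∈ F.1 \ ρ.1 := by rw [hv]; simp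
      refine ⟨v, (Finset.mem_sdiff.mp h3).2, ?_⟩
      rw [← Finset.sdiff_union_of_subset h, hv, Finset.insert_eq]
    have hz := ext_simplex_step hv hF c
      (fun i hi => ext_simplex_zero k (by rw [F.2.2]; omega)) u hu
    rw [← DD_eq hΓ c F ρ hv hF] at hz
    obtain ⟨q, hq⟩ := hz.2.gen w
    obtain ⟨p, hp⟩ := hw.gen (DD hΓ c F ρ u)
    rw [hp, smul_smul] at hq
    obtain ⟨a, ha, ha'⟩ := unit_const (k := k) (ρ := ρ.1) (p := p) (q := q) (by
      rw [← hw.ann, sub_smul, one_smul, ← hq, sub_self])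
    rw [← hw.ann, sub_smul, sub_eq_zero] at ha'
    exact ⟨a, hp.trans ha', by simp [ha, h]⟩
  · exact ⟨0, by rw [DD_zero hΓ c hc F ρ h]; simp, by simp [h]⟩

lemma pre_decomp {s : ℕ} (i : ℕ) (x : EX (MvPolynomial (Fin n) k) (PF k Γ s) (MvPolynomial (Fin n) k) i) :
    x = ∑ σ : Fc Γ s, pre _ (LinearMap.proj σ) i
      (pre _ (LinearMap.single (MvPolynomial (Fin n) k) (fun σ : Fc Γ s => SRRing k (simplex σ.1)) σ) i x) := by
  have : (LinearMap.id : PF k Γ s →ₗ[MvPolynomial (Fin n) k] PF k Γ s) =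
      ∑ σ : Fc Γ s, (LinearMap.single _ _ σ) ∘ₗ LinearMap.proj σ := by
    refine LinearMap.ext fun y => ?_
    rw [LinearMap.sum_apply]
    exact (LinearMap.sum_single_apply _ y).symm
  conv_lhs => rw [← pre_id (M := PF k Γ s) i x, this, pre_sum]
  refine Finset.sum_congr rfl fun σ _ => ?_
  rw [← pre_pre]

lemma skI_single {s : ℕ} (hΓ : ∀ σ ∈ Γ.faces, σ.card ≤ s) (F : Fc Γ s) :
    skI (k := k) hΓ ∘ₗ LinearMap.single (MvPolynomial (Fin n) k) (fun σ : Fc Γ s => SRRing k (simplex σ.1)) F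
      = mx F.1 (Fc.top hΓ F) := by
  refine LinearMap.ext fun y => ?_
  rw [skI, LinearMap.comp_apply, LinearMap.sum_apply, Finset.sum_eq_single F]
  · simp
  · intro G _ hG
    simp only [LinearMap.comp_apply, LinearMap.proj_apply, LinearMap.single_apply]
    rw [Pi.single_eq_of_ne hG, map_zero]
  · simp

variable (k) in
/-- ridge relations -/
def RidgeRel (Γ : SC n) (s : ℕ) (cc : Fc Γ (s+1) → Fc Γ s → k) (f : PF k Γ (s+1)) : Prop :=
  ∀ ρ : Fc Γ s, ∀ a : Fin n →₀ ℕ, a.support ⊆ ρ.1 → ∑ F, cc F ρ * cf a (f F) = 0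

theorem canon {t : ℕ} (hΓ : ∀ σ ∈ Γ.faces, σ.card ≤ t + 2) (c : ℕ) (hc : t + 2 + c = n) :
    ∃ cc : Fc Γ (t+2) → Fc Γ (t+1) → k, (∀ F ρ, cc F ρ ≠ 0 ↔ ρ.1 ⊆ F.1) ∧
    ∃ Ψ : EX (MvPolynomial (Fin n) k) (SRRing k Γ) (MvPolynomial (Fin n) k) c →ₗ[MvPolynomial (Fin n) k]
      PF k Γ (t+2), Function.Injective Ψ ∧ ∀ f, f ∈ LinearMap.range Ψ ↔ RidgeRel k Γ (t+1) cc f := by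
  choose u hu using fun F : Fc Γ (t+2) => ext_simplex_gen k (F := F.1) (i := c) (by rw [F.2.2, hc])
  choose w hw using fun ρ : Fc Γ (t+1) => ext_simplex_gen k (F := ρ.1) (i := c+1) (by rw [ρ.2.2]; omega)
  choose cc hcc hne using fun F ρ => DD_const (s := t+1) hΓ c hc F ρ (hu F) (hw ρ)
  refine ⟨cc, hne, ?_⟩
  choose e he using fun F => (hu F).equiv
  have hA := ses_skel (k := k) (s := t+1) hΓ
  have hz : Subsingleton (EX (MvPolynomial (Fin n) k) (SRRing k (skel Γ (t+1))) (MvPolynomial (Fin n) k) c) :=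
    ext_sr_zero (t+1) _ (fun σ h => (mem_skel.mp h).2) c (by omega)
  let Ψ : EX (MvPolynomial (Fin n) k) (SRRing k Γ) (MvPolynomial (Fin n) k) c →ₗ[MvPolynomial (Fin n) k]
      PF k Γ (t+2) := LinearMap.pi fun F => (e F).symm.toLinearMap ∘ₗ pre _ (mx F.1 (Fc.top hΓ F)) c
  have hΨ : ∀ x F, e F (Ψ x F) = pre _ (LinearMap.single (MvPolynomial (Fin n) k)
      (fun σ : Fc Γ (t+2) => SRRing k (simplex σ.1)) F) c (pre _ (skI hΓ) c x) := by
    intro x F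
    rw [pre_pre, skI_single]
    exact (e F).apply_symm_apply _
  have key : ∀ (f : PF k Γ (t+2)) (ρ : Fc Γ (t+1)),
      pre _ (mx (k := k) (Γ := simplex ρ.1) (Γ' := skel Γ (t+1)) ρ.1 (skel_top Γ ρ.2.2)) (c+1)
        (hA.δ _ c (∑ F, pre _ (LinearMap.proj F) c (e F (f F)))) = 0 ↔
      ∀ a : Fin n →₀ ℕ, a.support ⊆ ρ.1 → ∑ F, cc F ρ * cf a (f F) = 0 := by
    intro f ρ
    choose p hp using fun F => mk_surj (f F)
    rw [map_sum, map_sum]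
    have h1 : ∀ F, pre _ (mx (k := k) (Γ := simplex ρ.1) (Γ' := skel Γ (t+1)) ρ.1 (skel_top Γ ρ.2.2)) (c+1)
        (hA.δ _ c (pre _ (LinearMap.proj F) c (e F (f F)))) = (p F * C (cc F ρ)) • w ρ := by
      intro F
      rw [← hp F, he]
      change DD hΓ c F ρ (p F • u F) = _
      rw [map_smul, hcc, smul_smul]
    rw [Finset.sum_congr rfl fun F _ => h1 F, ← Finset.sum_smul, (hw ρ).ann, mem_sr]
    refine forall_congr' fun a => ?_
    rw [mem_simplex]
    refine imp_congr_right fun ha => ?_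
    rw [coeff_sum]
    have : ∀ F, coeff a (p F * C (cc F ρ)) = cc F ρ * cf a (f F) := by
      intro F
      by_cases hF : ρ.1 ⊆ F.1
      · rw [← hp F, cf_mk (mem_simplex.mpr (ha.trans hF)), mul_comm, coeff_C_mul]
      · have : cc F ρ = 0 := by
          by_contra h; exact hF ((hne F ρ).mp h)
        simp [this]
    rw [Finset.sum_congr rfl fun F _ => this F]
  refine ⟨Ψ, ?_, ?_⟩
  · rw [injective_iff_map_eq_zero]
    intro x hx
    have : pre _ (skI hΓ) c x = 0 := by
      rw [pre_decomp c (pre _ (skI hΓ) c x)]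
      refine Finset.sum_eq_zero fun F _ => ?_
      rw [← hΨ, hx]
      simp
    obtain ⟨y, rfl⟩ := hA.exact₂ c x this
    rw [Subsingleton.elim y 0, map_zero]
  · intro f
    constructor
    · rintro ⟨x, rfl⟩ ρ
      rw [← key]
      rw [Finset.sum_congr rfl fun F _ => congrArg _ (hΨ x F), ← pre_decomp, hA.δ_pre, map_zero]
    · intro hf
      have h0 : hA.δ _ c (∑ F, pre _ (LinearMap.proj F) c (e F (f F))) = 0 := by
        have hcard : ∀ σ ∈ (skel Γ (t+1)).faces, σ.card ≤ t + 1 := fun σ h => (mem_skel.mp h).2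
        have hA' := ses_skel (k := k) (Γ := skel Γ (t+1)) (s := t) hcard
        have hz' : Subsingleton (EX (MvPolynomial (Fin n) k) (SRRing k (skel (skel Γ (t+1)) t))
          (MvPolynomial (Fin n) k) (c+1)) :=
          ext_sr_zero t _ (fun σ h => (mem_skel.mp h).2) (c+1) (by omega)
        set z := hA.δ (MvPolynomial (Fin n) k) c (∑ F, pre _ (LinearMap.proj F) c (e F (f F))) with hzdef
        have : pre _ (skI hcard) (c+1) z = 0 := by
          rw [pre_decomp (c+1) (pre _ (skI hcard) (c+1) z)]
          refine Finset.sum_eq_zero fun ρ _ => ?_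
          have h3 := (key f ⟨ρ.1, skel_sub _ _ ρ.2.1, ρ.2.2⟩).mpr (hf _)
          rw [← hzdef] at h3
          have h4 : pre _ (LinearMap.single (MvPolynomial (Fin n) k)
              (fun σ : Fc (skel Γ (t+1)) (t+1) => SRRing k (simplex σ.1)) ρ) (c+1)
              (pre _ (skI hcard) (c+1) z) = 0 := by
            rw [pre_pre, skI_single]
            exact h3
          rw [h4, map_zero]
        obtain ⟨y, hy⟩ := hA'.exact₂ (c+1) z this
        rw [← hy, Subsingleton.elim y 0, map_zero]
      obtain ⟨x, hx⟩ := hA.exact₁ c _ h0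
      refine ⟨x, ?_⟩
      funext F
      apply (e F).injective
      rw [hΨ, hx, map_sum, Finset.sum_eq_single F]
      · rw [pre_pre]
        have : (LinearMap.proj (φ := fun σ : Fc Γ (t+2) => SRRing k (simplex σ.1)) F ∘ₗ LinearMap.single (MvPolynomial (Fin n) k)
          (fun σ : Fc Γ (t+2) => SRRing k (simplex σ.1)) F) = LinearMap.id := by
          refine LinearMap.ext fun y => ?_
          simp
        rw [this, pre_id]
      · intro G _ hG
        rw [pre_pre]
        have : (LinearMap.proj (φ := fun σ : Fc Γ (t+2) => SRRing k (simplex σ.1)) G ∘ₗ LinearMap.single (MvPolynomial (Fin n) k)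
          (fun σ : Fc Γ (t+2) => SRRing k (simplex σ.1)) F) = 0 := by
          refine LinearMap.ext fun y => ?_
          simp [Pi.single_eq_of_ne hG]
        rw [this, pre_zero]
      · simp

end Canon
end NG


namespace NG
open MvPolynomial

section Params

variable {k : Type} [Field k] {n : ℕ}

variable (k n) in
/-- the irrelevant ideal of the polynomial ring -/
noncomputable abbrev mS : Ideal (MvPolynomial (Fin n) k) := srIdeal k (simplex ∅)

lemma mem_mS {p : MvPolynomial (Fin n) k} : p ∈ mS k n ↔ coeff 0 p = 0 := by
  rw [mem_sr]
  constructor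
  · intro h; exact h 0 (by simp [mem_simplex])
  · intro h a ha
    rw [mem_simplex, Finset.subset_empty, Finsupp.support_eq_empty] at ha
    rw [ha, h]

instance mS_max : (mS k n).IsMaximal := by
  have : mS k n = RingHom.ker (constantCoeff : MvPolynomial (Fin n) k →+* k) := by
    ext p
    rw [mem_mS, RingHom.mem_ker, constantCoeff_eq]
  rw [this]
  exact RingHom.ker_isMaximal_of_surjective _ (fun c => ⟨C c, by simp⟩)

lemma srIdeal_le_mS (Γ : SC n) : srIdeal k Γ ≤ mS k n := by
  intro p hp
  rw [mem_sr] at hp ⊢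
  intro a ha
  exact hp a (Γ.down_closed Γ.empty_mem (mem_simplex.mp ha))

lemma X_mem_mS (i : Fin n) : (X i : MvPolynomial (Fin n) k) ∈ mS k n := by
  rw [mem_mS, coeff_zero_X]

lemma mS_le {q : Ideal (MvPolynomial (Fin n) k)} (h : ∀ i, X i ∈ q) : mS k n ≤ q := by
  unfold mS srIdeal
  rw [Ideal.span_le]
  rintro _ ⟨σ, hσ, rfl⟩
  rw [mem_simplex, Finset.subset_empty] at hσ
  obtain ⟨i, hi⟩ := Finset.nonempty_iff_ne_empty.mpr hσ
  exact q.mem_of_dvd (Finset.dvd_prod_of_mem _ hi) (h i)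

lemma srMax_eq_map (Γ : SC n) : srMax k Γ = (mS k n).map (mk Γ) := by
  apply le_antisymm
  · unfold srMax quotMax
    rw [Ideal.span_le]
    rintro _ ⟨i, rfl⟩
    exact Ideal.mem_map_of_mem _ (X_mem_mS i)
  · rw [Ideal.map_le_iff_le_comap]
    apply mS_le
    intro i
    exact Ideal.subset_span ⟨i, rfl⟩

lemma mk_mem_srMax {Γ : SC n} {p : MvPolynomial (Fin n) k} : mk Γ p ∈ srMax k Γ ↔ p ∈ mS k n := by
  rw [srMax_eq_map]
  have h := Ideal.comap_map_of_surjective (mk (k := k) Γ) Ideal.Quotient.mk_surjective (mS k n)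
  rw [← RingHom.ker_eq_comap_bot, Ideal.mk_ker, sup_eq_left.mpr (srIdeal_le_mS Γ)] at h
  rw [← Ideal.mem_comap, h]

instance srMax_max (Γ : SC n) : (srMax k Γ).IsMaximal := by
  rw [srMax_eq_map]
  refine Ideal.map_eq_top_or_isMaximal_of_surjective (mk (k := k) Γ) Ideal.Quotient.mk_surjective
    (I := mS k n) inferInstance |>.resolve_left ?_
  rw [← srMax_eq_map, ← ne_eq, Ideal.ne_top_iff_one]
  intro h
  have : mk (k := k) Γ 1 ∈ srMax k Γ := by rwa [map_one]
  rw [mk_mem_srMax, mem_mS, coeff_zero_one] at this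
  exact one_ne_zero this

variable (k n) in
/-- elementary symmetric polynomial -/
noncomputable def es (j : ℕ) : MvPolynomial (Fin n) k :=
  ∑ σ ∈ Finset.powersetCard j Finset.univ, xm k σ

lemma xm_mul_dvd (σ τ : Finset (Fin n)) : xm k (σ ∪ τ) ∣ xm k σ * xm k τ := by
  unfold xm
  rw [← Finset.prod_union_inter]
  exact dvd_mul_right _ _

lemma es_prime {q : Ideal (MvPolynomial (Fin n) k)} (hq : q.IsPrime)
    (h : ∀ i : Fin n, es k n (i+1) ∈ q) (t : ℕ) : ∀ σ : Finset (Fin n), σ.Nonempty → n < σ.card + t →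
      xm k σ ∈ q := by
  induction t with
  | zero =>
    intro σ hσ hc
    have hle := Finset.card_le_univ σ
    rw [Fintype.card_fin] at hle
    omega
  | succ t ih =>
    intro σ hσ hc
    have hle := Finset.card_le_univ σ
    rw [Fintype.card_fin] at hle
    have hpos := hσ.card_pos
    have h1 := q.mul_mem_left (xm k σ) (h ⟨σ.card-1, by omega⟩)
    have he : σ.card - 1 + 1 = σ.card := by omega
    simp only [he, es] at h1
    rw [Finset.mul_sum, ← Finset.add_sum_erase _ _
      (Finset.mem_powersetCard.mpr ⟨Finset.subset_univ σ, rfl⟩)] at h1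
    have h2 : ∑ τ ∈ (Finset.powersetCard σ.card Finset.univ).erase σ, xm k σ * xm k τ ∈ q := by
      refine Ideal.sum_mem _ fun τ hτ => ?_
      rw [Finset.mem_erase, Finset.mem_powersetCard] at hτ
      refine q.mem_of_dvd (xm_mul_dvd σ τ) (ih _ (hσ.mono Finset.subset_union_left) ?_)
      have : σ.card < (σ ∪ τ).card := by
        apply Finset.card_lt_card
        refine Finset.ssubset_iff_subset_ne.mpr ⟨Finset.subset_union_left, fun e => hτ.1 ?_⟩
        refine Finset.eq_of_subset_of_card_le ?_ (by omega)
        rw [e]; exact Finset.subset_union_right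
      omega
    have h3 := (Ideal.add_mem_iff_left _ h2).mp h1
    exact (hq.mem_or_mem h3).elim id id

lemma es_mem (j : ℕ) (hj : 1 ≤ j) : es k n j ∈ mS k n := by
  rw [mem_mS, es, coeff_sum]
  refine Finset.sum_eq_zero fun σ hσ => ?_
  rw [Finset.mem_powersetCard] at hσ
  rw [xm_eq, coeff_monomial, if_neg]
  intro h
  have := congrArg Finsupp.support h
  rw [ind_support] at this
  rw [this] at hσ
  simp at hσ; omega

lemma es_params {q : Ideal (MvPolynomial (Fin n) k)} (hq : q.IsPrime)
    (h : ∀ i : Fin n, es k n (i+1) ∈ q) : q = mS k n := by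
  refine ((mS_max (k := k) (n := n)).eq_of_le hq.ne_top (mS_le fun i => ?_)).symm
  have := es_prime hq h n {i} (by simp) (by simp)
  simpa [xm] using this

lemma es_params_R {Γ : SC n} (q : Ideal (SRRing k Γ)) (hq : q.IsPrime)
    (h : ∀ i : Fin n, mk Γ (es k n (i+1)) ∈ q) : q = srMax k Γ := by
  have h1 := es_params (hq.comap (mk Γ)) h
  rw [srMax_eq_map, ← h1, Ideal.map_comap_of_surjective _ Ideal.Quotient.mk_surjective]

lemma xm_eq_zero {Γ : SC n} {σ : Finset (Fin n)} (h : σ ∉ Γ.faces) : mk Γ (xm k σ) = 0 := by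
  rw [Ideal.Quotient.eq_zero_iff_mem]
  exact Ideal.subset_span ⟨σ, h, rfl⟩

lemma xm_ne_zero {Γ : SC n} {σ : Finset (Fin n)} (h : σ ∈ Γ.faces) : mk Γ (xm k σ) ≠ 0 := by
  intro h0
  rw [mk_eq_zero] at h0
  have := h0 (ind σ) (by rwa [ind_support])
  rw [xm_eq, coeff_monomial, if_pos rfl] at this
  exact one_ne_zero this

lemma killCompl_X_not {F : Finset (Fin n)} {i : Fin n} (hi : i ∉ F) :
    killCompl (R := k) (Subtype.val_injective (p := fun i => i ∈ F)) (X i) = 0 := by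
  rw [killCompl, aeval_X, dif_neg]
  rintro ⟨j, rfl⟩
  exact hi j.2

lemma dimF (F : Finset (Fin n)) : ringKrullDim (MvPolynomial {i // i ∈ F} k) = F.card := by
  rw [MvPolynomial.ringKrullDim_of_isNoetherianRing, ringKrullDim_eq_zero_of_field, zero_add,
    Nat.card_eq_fintype_card, Fintype.card_coe]

lemma le_dim {Γ : SC n} {F : Finset (Fin n)} (hF : F ∈ Γ.faces) :
    (F.card : WithBot ℕ∞) ≤ ringKrullDim (SRRing k Γ) := by
  rw [← dimF (k := k) F]
  let f := (killCompl (R := k) (Subtype.val_injective (p := fun i => i ∈ F))).toRingHom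
  refine ringKrullDim_le_of_surjective (Ideal.Quotient.lift (srIdeal k Γ) f ?_) ?_
  · intro p hp
    rw [← RingHom.mem_ker]
    revert hp p
    change srIdeal k Γ ≤ RingHom.ker f
    unfold srIdeal
    rw [Ideal.span_le]
    rintro _ ⟨σ, hσ, rfl⟩
    have : ¬ σ ⊆ F := fun h => hσ (Γ.down_closed hF h)
    rw [Finset.not_subset] at this
    obtain ⟨i, hi, hiF⟩ := this
    exact (RingHom.ker f).mem_of_dvd (Finset.dvd_prod_of_mem _ hi)
      (RingHom.mem_ker.mpr (killCompl_X_not hiF))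
  · apply Ideal.Quotient.lift_surjective_of_surjective
    intro p
    exact ⟨rename Subtype.val p, killCompl_rename_app _ p⟩

lemma dim_le {Γ : SC n} {d : ℕ} (hΓ : ∀ σ ∈ Γ.faces, σ.card ≤ d) :
    ringKrullDim (SRRing k Γ) ≤ d := by
  classical
  unfold ringKrullDim Order.krullDim
  refine iSup_le fun c => ?_
  let q := c.head.asIdeal
  have h1 : (c.length : WithBot ℕ∞) ≤ ringKrullDim (SRRing k Γ ⧸ q) := by
    rw [ringKrullDim_quotient]
    let c' : LTSeries (PrimeSpectrum.zeroLocus (q : Set (SRRing k Γ))) :=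
      { length := c.length
        toFun := fun i => ⟨c i, by
          rw [PrimeSpectrum.mem_zeroLocus]
          exact (LTSeries.head_le c i : c.head ≤ c i)⟩
        step := fun i => c.step i }
    exact le_iSup (fun p : LTSeries _ => (p.length : WithBot ℕ∞)) c'
  refine h1.trans ?_
  have hq : q.IsPrime := c.head.isPrime
  let F : Finset (Fin n) := Finset.univ.filter fun i => mk Γ (X i : MvPolynomial (Fin n) k) ∉ q
  have hF : F ∈ Γ.faces := by
    by_contra h
    have h0 : mk Γ (xm k F) ∈ q := by rw [xm_eq_zero h]; exact q.zero_mem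
    unfold xm at h0
    rw [map_prod, Ideal.IsPrime.prod_mem_iff] at h0
    obtain ⟨i, hi, hiq⟩ := h0
    exact (Finset.mem_filter.mp hi).2 hiq
  let g : MvPolynomial (Fin n) k →+* SRRing k Γ ⧸ q := (Ideal.Quotient.mk q).comp (mk Γ)
  have key : ∀ p : MvPolynomial (Fin n) k, g p = g (rename Subtype.val
      (killCompl (R := k) (Subtype.val_injective (p := fun i => i ∈ F)) p)) := by
    intro p
    induction p using MvPolynomial.induction_on with
    | C a => simp
    | add p q hp hq => simp only [map_add, hp, hq]
    | mul_X p i hp =>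
      rw [map_mul, map_mul, map_mul, map_mul, ← hp]
      congr 1
      by_cases hi : i ∈ F
      · have : (X i : MvPolynomial (Fin n) k) = rename Subtype.val (X (⟨i, hi⟩ : {i // i ∈ F})) := by
          simp
        conv_rhs => rw [this, killCompl_rename_app]
        simp
      · rw [killCompl_X_not hi, map_zero, map_zero]
        have : mk Γ (X i : MvPolynomial (Fin n) k) ∈ q := by
          by_contra h
          exact hi (Finset.mem_filter.mpr ⟨Finset.mem_univ _, h⟩)
        exact Ideal.Quotient.eq_zero_iff_mem.mpr this
  refine (ringKrullDim_le_of_surjective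
    (g.comp (rename (Subtype.val : {i // i ∈ F} → Fin n)).toRingHom) ?_).trans ?_
  · intro x
    obtain ⟨y, rfl⟩ := Ideal.Quotient.mk_surjective x
    obtain ⟨p, rfl⟩ := mk_surj y
    exact ⟨_, (key p).symm⟩
  · rw [dimF]
    exact_mod_cast hΓ F hF

end Params

end NG


namespace NG
open MvPolynomial

section PureConn

variable {k : Type} [Field k] {n : ℕ}

lemma cf_mul {Γ : SC n} {a : Fin n →₀ ℕ} (ha : a.support ∈ Γ.faces) (p : MvPolynomial (Fin n) k)
    (x : SRRing k Γ) :
    cf a (p • x) = ∑ b ∈ Finset.HasAntidiagonal.antidiagonal a, coeff b.1 p * cf b.2 x := by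
  obtain ⟨q, rfl⟩ := mk_surj x
  rw [smul_mk, cf_mk ha, coeff_mul]
  refine Finset.sum_congr rfl fun b hb => ?_
  rw [cf_mk]
  refine Γ.down_closed ha (support_mono ?_)
  rw [Finset.HasAntidiagonal.mem_antidiagonal] at hb
  rw [← hb]; exact le_add_self

lemma smul_inj {Γ : SC n} {p : MvPolynomial (Fin n) k} (hp : p ∉ mS k n) {x : SRRing k Γ}
    (hx : p • x = 0) : x = 0 := by
  rw [mem_mS] at hp
  have key : ∀ t : ℕ, ∀ a : Fin n →₀ ℕ, a.degree = t → a.support ∈ Γ.faces → cf a x = 0 := by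
    intro t
    induction t using Nat.strong_induction_on with
    | _ t ih =>
    intro a hat ha
    have h1 := cf_mul ha p x
    rw [hx, cf_zero, ← Finset.add_sum_erase _ _ (a := (0, a)) (by simp),
      Finset.sum_eq_zero, add_zero] at h1
    · exact (mul_eq_zero.mp h1.symm).resolve_left hp
    · intro b hb
      rw [Finset.mem_erase, Finset.HasAntidiagonal.mem_antidiagonal] at hb
      have hd : b.1.degree + b.2.degree = t := by rw [← map_add, hb.2, hat]
      have hne : b.1.degree ≠ 0 := by
        intro h0
        rw [Finsupp.degree_eq_zero_iff] at h0
        apply hb.1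
        rw [← hb.2, h0]
        ext <;> simp [h0]
      rw [ih b.2.degree (by omega) b.2 rfl, mul_zero]
      refine Γ.down_closed ha (support_mono ?_)
      rw [← hb.2]; exact le_add_self
  exact cf_ext fun a ha => by rw [key _ a rfl ha, cf_zero]

lemma cf_es {Γ : SC n} {a : Fin n →₀ ℕ} (ha : a.support ∈ Γ.faces) (j : ℕ) (x : SRRing k Γ) :
    cf a (es k n j • x) = ∑ σ ∈ Finset.powersetCard j a.support, cf (a - ind σ) x := by
  rw [es, Finset.sum_smul, cf_sum]
  simp_rw [cf_xm_smul ha]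
  rw [← Finset.sum_filter]
  refine Finset.sum_congr ?_ fun _ _ => rfl
  ext σ
  simp only [Finset.mem_filter, Finset.mem_powersetCard, Finset.subset_univ, true_and]
  tauto

lemma es_zero {Γ : SC n} {d j : ℕ} (hΓ : ∀ σ ∈ Γ.faces, σ.card ≤ d) (hj : d < j) (x : SRRing k Γ) :
    es k n j • x = 0 := by
  refine cf_ext fun a ha => ?_
  rw [cf_es ha, cf_zero, Finset.powersetCard_eq_empty.mpr, Finset.sum_empty]
  exact (hΓ _ ha).trans_lt hj

lemma sub_simplex {Γ : SC n} {F : Finset (Fin n)} (hF : F ∈ Γ.faces) :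
    (simplex F).faces ⊆ Γ.faces := fun _ h => Γ.down_closed hF (mem_simplex.mp h)

/-- vanishing hypothesis -/
def DepthGe (k : Type) [Field k] {n : ℕ} (Γ : SC n) (d : ℕ) : Prop :=
  ∀ i < d, Subsingleton (EX (SRRing k Γ) (SRRing k Γ ⧸ srMax k Γ) (SRRing k Γ) i)

/-- The claim specialised to the face ring and elementary symmetric parameters. -/
lemma null_of_kill {Γ : SC n} {d e i : ℕ} (hC : DepthGe k Γ d)
    (hei : e + i < d + 1)
    (N : Type) [AddCommGroup N] [Module (SRRing k Γ) N] [Module.Finite (SRRing k Γ) N]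
    (hk : ∀ j, e ≤ j → ∀ x : N, mk (k := k) Γ (es k n j) • x = 0) (he : 1 ≤ e) :
    Null (srMax k Γ) (EX (SRRing k Γ) N (SRRing k Γ) i) := by
  classical
  let J : Finset (Fin n) := Finset.univ.filter fun j => e ≤ (j : ℕ) + 1
  have hJ : Jᶜ.card ≤ e - 1 := by
    have : Jᶜ.card ≤ (Finset.range (e-1)).card := by
      refine Finset.card_le_card_of_injOn (fun j => (j : ℕ)) ?_ ?_
      · intro j hj
        simp only [J, Finset.coe_compl, Set.mem_compl_iff, Finset.mem_coe, Finset.mem_filter,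
          Finset.mem_univ, true_and, Finset.mem_range] at hj ⊢
        omega
      · intro a _ b _ h
        exact Fin.ext h
    simpa using this
  refine claim (srMax k Γ) (fun i : Fin n => mk Γ (es k n (i+1)))
    (fun i => mk_mem_srMax.mpr (es_mem _ (by omega))) es_params_R (SRRing k Γ) _ J rfl N ?_ i ?_
  · intro j hj
    refine ⟨1, fun x => ?_⟩
    rw [pow_one]
    exact hk _ (Finset.mem_filter.mp hj).2 x
  · intro l hl
    exact hC _ (by omega)

theorem pure_of_depth {Γ : SC n} {d : ℕ} (hΓ : ∀ σ ∈ Γ.faces, σ.card ≤ d) (hd1 : 1 ≤ d)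
    (hC : DepthGe k Γ d) {x : SRRing k Γ} (hx : ∀ F : Fc Γ d, res (sub_simplex F.2.1) x = 0) :
    x = 0 := by
  let T : Ideal (SRRing k Γ) :=
    { carrier := {x | ∀ F : Fc Γ d, res (sub_simplex F.2.1) x = 0}
      add_mem' := fun {a b} ha hb F => by rw [map_add, ha F, hb F, add_zero]
      zero_mem' := fun F => map_zero _
      smul_mem' := fun c x hx F => by
        obtain ⟨p, rfl⟩ := mk_surj c
        have : mk Γ p • x = p • x := rfl
        rw [this, map_smul, hx F, smul_zero] }
  have hk : ∀ j, d ≤ j → ∀ x : T, mk (k := k) Γ (es k n j) • x = 0 := by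
    intro j hj x
    apply Subtype.ext
    change es k n j • x.1 = 0
    refine cf_ext fun a ha => ?_
    rw [cf_es ha, cf_zero]
    refine Finset.sum_eq_zero fun σ hσ => ?_
    rw [Finset.mem_powersetCard] at hσ
    have h1 := hΓ _ ha
    have h2 : σ = a.support := Finset.eq_of_subset_of_card_le hσ.1 (by omega)
    have h3 : σ ∈ Γ.faces := h2 ▸ ha
    have h4 : (a - ind σ).support ⊆ σ := by
      rw [h2]; exact support_mono tsub_le_self
    have := x.2 ⟨σ, h3, by rw [h2] at hσ ⊢; omega⟩
    rw [← cf_res (sub_simplex h3) (mem_simplex.mpr h4), this, cf_zero]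
  have hnull := null_of_kill (i := 0) hC (by omega) T hk hd1
  obtain ⟨s, hs, h0⟩ := hnull (hom0.symm T.subtype)
  rw [← map_smul, map_eq_zero_iff _ (LinearEquiv.injective _)] at h0
  have h1 := LinearMap.congr_fun h0 ⟨x, hx⟩
  obtain ⟨p, rfl⟩ := mk_surj s
  exact smul_inj (fun h => hs (mk_mem_srMax.mpr h)) h1

theorem pure_faces {Γ : SC n} {d : ℕ} (hΓ : ∀ σ ∈ Γ.faces, σ.card ≤ d) (hd1 : 1 ≤ d)
    (hC : DepthGe k Γ d) {σ : Finset (Fin n)} (hσ : σ ∈ Γ.faces) : ∃ F : Fc Γ d, σ ⊆ F.1 := by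
  by_contra hne
  push Not at hne
  refine xm_ne_zero (k := k) hσ (pure_of_depth hΓ hd1 hC fun F => ?_)
  rw [res_mk]
  exact xm_eq_zero fun h => hne F (mem_simplex.mp h)

theorem connected_of_depth {Γ : SC n} {d : ℕ} (hΓ : ∀ σ ∈ Γ.faces, σ.card ≤ d) (hd2 : 2 ≤ d)
    (hC : DepthGe k Γ d) (τ : Finset (Fin n)) (h : Fc Γ d → k)
    (hh : ∀ F F' : Fc Γ d, τ ⊆ F.1 → τ ⊆ F'.1 → (F.1 ∩ F'.1).card = d - 1 → h F = h F')
    (F F' : Fc Γ d) (hF : τ ⊆ F.1) (hF' : τ ⊆ F'.1) : h F = h F' := by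
  classical
  let g : Fc Γ d → MvPolynomial (Fin n) k := fun F => C (h F) * xm k τ
  let I : Ideal (SRRing k Γ) :=
    { carrier := {y | ∃ z : SRRing k Γ, ∀ F : Fc Γ d,
        res (sub_simplex F.2.1) z = g F • res (sub_simplex F.2.1) y}
      add_mem' := by
        rintro a b ⟨z, hz⟩ ⟨w, hw⟩
        exact ⟨z + w, fun F => by rw [map_add, map_add, hz, hw, smul_add]⟩
      zero_mem' := ⟨0, fun F => by rw [map_zero, smul_zero]⟩
      smul_mem' := by
        rintro c x ⟨z, hz⟩
        obtain ⟨p, rfl⟩ := mk_surj c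
        refine ⟨p • z, fun F => ?_⟩
        have : mk Γ p • x = p • x := rfl
        rw [this, map_smul, hz F, map_smul, smul_comm] }
  have hI : ∀ j, d - 1 ≤ j → mk (k := k) Γ (es k n j) ∈ I := by
    intro j hj
    have hex : ∀ σ : Finset (Fin n), σ.card = j → ∃ c : k, ∀ F : Fc Γ d, σ ⊆ F.1 → τ ⊆ F.1 →
        h F = c := by
      intro σ hσ
      by_cases hF : ∃ F : Fc Γ d, σ ⊆ F.1 ∧ τ ⊆ F.1
      · obtain ⟨F, hF1, hF2⟩ := hF
        refine ⟨h F, fun F' h1 h2 => ?_⟩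
        by_cases hFF : F' = F
        · rw [hFF]
        refine hh F' F h2 hF2 ?_
        have h3 : σ.card ≤ (F'.1 ∩ F.1).card :=
          Finset.card_le_card (Finset.subset_inter h1 hF1)
        have h4 : (F'.1 ∩ F.1).card < d := by
          by_contra hge
          have e1 := Finset.eq_of_subset_of_card_le (Finset.inter_subset_left (s₁ := F'.1) (s₂ := F.1))
            (by rw [F'.2.2]; omega)
          have e2 := Finset.eq_of_subset_of_card_le (Finset.inter_subset_right (s₁ := F'.1) (s₂ := F.1))
            (by rw [F.2.2]; omega)
          exact hFF (Subtype.ext (e1.symm.trans e2))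
        omega
      · push Not at hF
        exact ⟨0, fun F h1 h2 => absurd h2 (hF F h1)⟩
    choose! c hc using hex
    refine ⟨∑ σ ∈ Finset.powersetCard j Finset.univ, mk Γ (C (c σ) * (xm k σ * xm k τ)), fun F => ?_⟩
    rw [map_sum, res_mk, smul_mk, es, Finset.mul_sum, map_sum]
    refine Finset.sum_congr rfl fun σ hσ => ?_
    rw [Finset.mem_powersetCard] at hσ
    rw [res_mk]
    by_cases h1 : σ ⊆ F.1
    · by_cases h2 : τ ⊆ F.1
      · rw [← hc σ hσ.2 F h1 h2]
        congr 1; simp only [g]; ring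
      · have : mk (simplex F.1) (xm k τ) = 0 := xm_eq_zero fun h => h2 (mem_simplex.mp h)
        simp only [g, map_mul, this, mul_zero, zero_mul]
    · have : mk (simplex F.1) (xm k σ) = 0 := xm_eq_zero fun h => h1 (mem_simplex.mp h)
      simp only [g, map_mul, this, mul_zero, zero_mul]
  have hex : ∀ y : I, ∃ z : SRRing k Γ, ∀ F : Fc Γ d,
        res (sub_simplex F.2.1) z = g F • res (sub_simplex F.2.1) y.1 := fun y => y.2
  choose θ hθ using hex
  have huniq : ∀ z w : SRRing k Γ, (∀ F : Fc Γ d, res (sub_simplex F.2.1) z =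
      res (sub_simplex F.2.1) w) → z = w := by
    intro z w hzw
    rw [← sub_eq_zero]
    exact pure_of_depth hΓ (by omega) hC fun F => by rw [map_sub, hzw F, sub_self]
  let Θ : I →ₗ[SRRing k Γ] SRRing k Γ :=
    { toFun := θ
      map_add' := fun x y => huniq _ _ fun F => by
        rw [hθ, map_add, hθ, hθ, ← smul_add, ← map_add]; rfl
      map_smul' := fun c x => huniq _ _ fun F => by
        obtain ⟨p, rfl⟩ := mk_surj c
        have h1 : mk Γ p • θ x = p • θ x := rfl
        have h2 : ((mk Γ p • x : I) : SRRing k Γ) = p • x.1 := rfl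
        rw [hθ, RingHom.id_apply, h1, h2, map_smul, map_smul, hθ, smul_comm] }
  have hses : SES I.subtype I.mkQ :=
    ⟨Subtype.val_injective, Submodule.mkQ_surjective _, LinearMap.exact_subtype_mkQ I⟩
  have hnull := null_of_kill (i := 1) hC (e := d - 1) (by omega) (SRRing k Γ ⧸ I) (by
    intro j hj x
    obtain ⟨y, rfl⟩ := Submodule.mkQ_surjective I x
    rw [← map_smul, Submodule.mkQ_apply, Submodule.Quotient.mk_eq_zero]
    exact I.mul_mem_right _ (hI j hj)) (by omega)
  obtain ⟨s, hs, h0⟩ := hnull (hses.δ (SRRing k Γ) 0 (hom0.symm Θ))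
  rw [← map_smul] at h0
  obtain ⟨y, hy⟩ := hses.exact₁ 0 _ h0
  obtain ⟨f, rfl⟩ := hom0.symm.surjective y
  rw [pre_hom0_symm, ← map_smul] at hy
  have hy := hom0.symm.injective hy
  obtain ⟨p, rfl⟩ := mk_surj s
  obtain ⟨r, hr⟩ := mk_surj (f 1)
  have hp : coeff 0 p ≠ 0 := fun h => hs (mk_mem_srMax.mpr (mem_mS.mpr h))
  have key : ∀ F : Fc Γ d, τ ⊆ F.1 → coeff (ind τ) r = coeff 0 p * h F := by
    intro F hF
    have h1 := LinearMap.congr_fun hy ⟨_, hI d (by omega)⟩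
    have h2 : f (mk Γ (es k n d)) = mk Γ (es k n d * r) := by
      rw [map_mul, hr, ← smul_eq_mul, ← map_smul, smul_eq_mul, mul_one]
    have h3 : mk Γ (es k n d * r) = p • θ ⟨_, hI d (by omega)⟩ := h2.symm.trans h1
    have h4 := congrArg (res (sub_simplex F.2.1)) h3
    rw [map_smul, hθ, res_mk, res_mk, smul_mk, smul_mk] at h4
    have h5 := congrArg (cf (ind τ + ind F.1)) h4
    have hsup : (ind τ + ind F.1).support = F.1 := support_add_ind_sub (by rwa [ind_support])
    have hsup' : (ind τ + ind F.1).support ∈ (simplex F.1).faces := by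
      rw [hsup, mem_simplex]
    have hpc : Finset.powersetCard d F.1 = {F.1} := by
      have := Finset.powersetCard_self F.1
      rwa [F.2.2] at this
    have hes : ∀ q : MvPolynomial (Fin n) k,
        cf (ind τ + ind F.1) (mk (simplex F.1) (es k n d * q)) = coeff (ind τ) q := by
      intro q
      rw [← smul_mk, cf_es hsup', hsup, hpc, Finset.sum_singleton,
        add_tsub_cancel_right, cf_mk]
      rw [ind_support, mem_simplex]; exact hF
    rw [hes] at h5
    have : p * (g F * es k n d) = es k n d * (p * g F) := by ring
    rw [this, hes] at h5
    rw [h5]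
    have : p * g F = xm k τ * (C (h F) * p) := by simp only [g]; ring
    rw [this, coeff_xm_mul, ind_support, if_pos subset_rfl, tsub_self, coeff_C_mul, mul_comm]
  have := (key F hF).symm.trans (key F' hF')
  exact mul_left_cancel₀ hp this

end PureConn

end NG


namespace NG
open MvPolynomial

section Combi

variable {k : Type} [Field k] {n : ℕ} {Γ : SC n} {s : ℕ}

/-- monomial tuple -/
noncomputable def mono (a : Fin n →₀ ℕ) (α : Fc Γ s → k) : PF k Γ s :=
  fun F => mk (simplex F.1) (monomial a (α F))

lemma cf_mono {a b : Fin n →₀ ℕ} {α : Fc Γ s → k} {F : Fc Γ s} (hb : b.support ⊆ F.1) :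
    cf b (mono a α F) = if a = b then α F else 0 := by
  rw [mono, cf_mk (mem_simplex.mpr hb), coeff_monomial]

/-- degreewise ridge relation -/
def Rel (cc : Fc Γ (s+1) → Fc Γ s → k) (a : Fin n →₀ ℕ) (α : Fc Γ (s+1) → k) : Prop :=
  ∀ ρ : Fc Γ s, a.support ⊆ ρ.1 → ∑ F : Fc Γ (s+1), cc F ρ * α F = 0

variable {cc : Fc Γ (s+1) → Fc Γ s → k}

lemma cc_zero (hcc : ∀ F ρ, cc F ρ ≠ 0 ↔ ρ.1 ⊆ F.1) {F : Fc Γ (s+1)} {ρ : Fc Γ s}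
    (h : ¬ ρ.1 ⊆ F.1) : cc F ρ = 0 := by
  by_contra h0
  exact h ((hcc F ρ).mp h0)

lemma mono_rel (hcc : ∀ F ρ, cc F ρ ≠ 0 ↔ ρ.1 ⊆ F.1) {a : Fin n →₀ ℕ} {α : Fc Γ (s+1) → k}
    (h : Rel cc a α) : RidgeRel k Γ s cc (mono a α) := by
  intro ρ b hb
  have : ∀ F : Fc Γ (s+1), cc F ρ * cf b (mono a α F) = cc F ρ * if a = b then α F else 0 := by
    intro F
    by_cases hF : ρ.1 ⊆ F.1
    · rw [cf_mono (hb.trans hF)]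
    · rw [cc_zero hcc hF, zero_mul, zero_mul]
  simp_rw [this]
  by_cases hab : a = b
  · simp only [hab, if_true]
    exact h ρ (hab ▸ hb)
  · simp [hab]

lemma two_sum (hcc : ∀ F ρ, cc F ρ ≠ 0 ↔ ρ.1 ⊆ F.1) {F F' : Fc Γ (s+1)} {ρ : Fc Γ s} (hne : F ≠ F')
    (h2 : ∀ F'', ρ.1 ⊆ F''.1 → F'' = F ∨ F'' = F') (β : Fc Γ (s+1) → k) :
    ∑ G : Fc Γ (s+1), cc G ρ * β G = cc F ρ * β F + cc F' ρ * β F' := by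
  refine Fintype.sum_eq_add F F' hne ?_
  rintro G ⟨h, h'⟩
  rw [cc_zero hcc, zero_mul]
  intro hG
  exact (h2 G hG).elim h h'

lemma one_sum (hcc : ∀ F ρ, cc F ρ ≠ 0 ↔ ρ.1 ⊆ F.1) {F : Fc Γ (s+1)} {ρ : Fc Γ s}
    (h2 : ∀ F'', ρ.1 ⊆ F''.1 → F'' = F) (β : Fc Γ (s+1) → k) :
    ∑ G : Fc Γ (s+1), cc G ρ * β G = cc F ρ * β F := by
  refine Fintype.sum_eq_single F ?_
  intro G h
  rw [cc_zero hcc, zero_mul]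
  intro hG
  exact h (h2 G hG)

lemma inter_eq {F F' : Fc Γ (s+1)} {ρ : Fc Γ s} (hne : F ≠ F') (h : ρ.1 ⊆ F.1) (h' : ρ.1 ⊆ F'.1) :
    F.1 ∩ F'.1 = ρ.1 := by
  classical
  refine (Finset.eq_of_subset_of_card_le (Finset.subset_inter h h') ?_).symm
  rw [ρ.2.2]
  by_contra hlt
  have e1 := Finset.eq_of_subset_of_card_le (Finset.inter_subset_left (s₁ := F.1) (s₂ := F'.1))
    (by rw [F.2.2]; omega)
  have e2 := Finset.eq_of_subset_of_card_le (Finset.inter_subset_right (s₁ := F.1) (s₂ := F'.1))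
    (by rw [F'.2.2]; omega)
  exact hne (Subtype.ext (e1.symm.trans e2))

/-- the ridge opposite to `x` -/
def er (F : Fc Γ (s+1)) (x : Fin n) (hx : x ∈ F.1) : Fc Γ s :=
  ⟨F.1.erase x, Γ.down_closed F.2.1 (Finset.erase_subset _ _), by
    rw [Finset.card_erase_of_mem hx, F.2.2]; rfl⟩

lemma er_sub (F : Fc Γ (s+1)) (x : Fin n) (hx : x ∈ F.1) : (er F x hx).1 ⊆ F.1 :=
  Finset.erase_subset _ _

lemma exists_er {F : Fc Γ (s+1)} {ρ : Fc Γ s} (h : ρ.1 ⊆ F.1) : ∃ x, ∃ hx : x ∈ F.1, ρ = er F x hx := by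
  have hc : ρ.1.card < F.1.card := by rw [ρ.2.2, F.2.2]; omega
  obtain ⟨x, hx, hxρ⟩ := Finset.exists_mem_notMem_of_card_lt_card hc
  refine ⟨x, hx, Subtype.ext (Finset.eq_of_subset_of_card_le ?_ ?_)⟩
  · exact Finset.subset_erase.mpr ⟨h, hxρ⟩
  · rw [(er F x hx).2.2, ρ.2.2]

lemma exists_ridge {F F' : Fc Γ (s+1)} (h : (F.1 ∩ F'.1).card = s) :
    F ≠ F' ∧ ∃ ρ : Fc Γ s, ρ.1 = F.1 ∩ F'.1 := by
  refine ⟨?_, ⟨F.1 ∩ F'.1, Γ.down_closed F.2.1 Finset.inter_subset_left, h⟩, rfl⟩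
  rintro rfl
  rw [Finset.inter_self, F.2.2] at h
  omega

lemma es_not_sub {F : Fc Γ (s+1)} {ρ : Fc Γ s} : ¬ F.1 ⊆ ρ.1 := by
  intro h
  have := Finset.card_le_card h
  rw [F.2.2, ρ.2.2] at this
  omega

section Fact

open Classical in
/-- the basic element of a facet -/
noncomputable def EE (F : Fc Γ (s+1)) : Fc Γ (s+1) → k := fun G => if G = F then 1 else 0

lemma EE_rel (F : Fc Γ (s+1)) : Rel cc (ind F.1) (EE F) := by
  intro ρ h
  rw [ind_support] at h
  exact absurd h es_not_sub

lemma xm_mono (b : Fin n →₀ ℕ) (β : Fc Γ (s+1) → k) (F : Fc Γ (s+1)) :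
    xm k F.1 • mono b β = (monomial b (β F) : MvPolynomial (Fin n) k) • mono (ind F.1) (EE F) := by
  classical
  funext G
  change xm k F.1 • mk (simplex G.1) (monomial b (β G)) =
    (monomial b (β F)) • mk (simplex G.1) (monomial (ind F.1) (EE F G))
  rw [smul_mk, smul_mk, xm_eq, monomial_mul, monomial_mul, one_mul]
  by_cases hG : G = F
  · subst hG
    rw [add_comm b]; simp [EE]
  · have h0 : mk (simplex G.1) (xm k F.1) = 0 := xm_eq_zero fun h => hG (Subtype.ext
      (Finset.eq_of_subset_of_card_le (mem_simplex.mp h) (by rw [G.2.2, F.2.2])).symm)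
    have h1 : (monomial (ind F.1 + b) (β G) : MvPolynomial (Fin n) k) = xm k F.1 * monomial b (β G) := by
      rw [xm_eq, monomial_mul, one_mul]
    rw [h1, map_mul, h0, zero_mul]
    simp [EE, hG]

variable {W : Submodule (MvPolynomial (Fin n) k) (PF k Γ (s+1))}

/-- The coefficients `c_F`. -/
noncomputable def cF (hcc : ∀ F ρ, cc F ρ ≠ 0 ↔ ρ.1 ⊆ F.1) (hW : ∀ f, f ∈ W ↔ RidgeRel k Γ s cc f)
    (φ : W →ₗ[MvPolynomial (Fin n) k] SRRing k Γ) (a : Fin n →₀ ℕ) (v : Fin n)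
    (F : Fc Γ (s+1)) : k :=
  open Classical in
  if a ≤ ind F.1 + Finsupp.single v 1 then
    cf (ind F.1 + Finsupp.single v 1 - a)
      (φ ⟨mono (ind F.1) (EE F), (hW _).mpr (mono_rel hcc (EE_rel F))⟩) else 0

lemma fact0 (hcc : ∀ F ρ, cc F ρ ≠ 0 ↔ ρ.1 ⊆ F.1) (hW : ∀ f, f ∈ W ↔ RidgeRel k Γ s cc f)
    (φ : W →ₗ[MvPolynomial (Fin n) k] SRRing k Γ) {b : Fin n →₀ ℕ} {β : Fc Γ (s+1) → k}
    (hβ : Rel cc b β) (F : Fc Γ (s+1)) {g : Fin n →₀ ℕ} (hg : g.support ⊆ F.1) :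
    (if F.1 ⊆ g.support then cf (g - ind F.1) (φ ⟨mono b β, (hW _).mpr (mono_rel hcc hβ)⟩) else 0) =
    if b ≤ g then β F * cf (g - b)
      (φ ⟨mono (ind F.1) (EE F), (hW _).mpr (mono_rel hcc (EE_rel F))⟩) else 0 := by
  have hg' := Γ.down_closed F.2.1 hg
  rw [← cf_xm_smul hg', ← cf_monomial_smul hg', ← map_smul, ← map_smul]
  congr 2
  exact Subtype.ext (xm_mono b β F)

lemma fact1 (hcc : ∀ F ρ, cc F ρ ≠ 0 ↔ ρ.1 ⊆ F.1) (hW : ∀ f, f ∈ W ↔ RidgeRel k Γ s cc f)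
    (φ : W →ₗ[MvPolynomial (Fin n) k] SRRing k Γ) {a b e : Fin n →₀ ℕ} {v : Fin n}
    {β : Fc Γ (s+1) → k}
    (hβ : Rel cc b β) (F : Fc Γ (s+1)) (he : e.support ⊆ F.1) (hab : e + a = b + Finsupp.single v 1) :
    cf e (φ ⟨mono b β, (hW _).mpr (mono_rel hcc hβ)⟩) = β F * cF hcc hW φ a v F := by
  have hs : (e + ind F.1).support = F.1 := support_add_ind_sub he
  have := fact0 hcc hW φ hβ F (g := e + ind F.1) (by rw [hs])
  rw [hs, if_pos subset_rfl, add_tsub_cancel_right] at this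
  rw [this, cF]
  have hpt : ∀ i, e i + a i = b i + (Finsupp.single v 1 : Fin n →₀ ℕ) i := fun i =>
    DFunLike.congr_fun hab i
  have hiff : b ≤ e + ind F.1 ↔ a ≤ ind F.1 + Finsupp.single v 1 := by
    refine forall_congr' fun i => ?_
    have := hpt i
    simp only [Finsupp.add_apply]
    omega
  by_cases hb : b ≤ e + ind F.1
  · rw [if_pos hb, if_pos (hiff.mp hb)]
    congr 2
    ext i
    have := hpt i
    have := hb i
    simp only [Finsupp.add_apply, Finsupp.tsub_apply] at *
    omega
  · rw [if_neg hb, if_neg (fun h => hb (hiff.mpr h)), mul_zero]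

lemma fact2 (hcc : ∀ F ρ, cc F ρ ≠ 0 ↔ ρ.1 ⊆ F.1) (hW : ∀ f, f ∈ W ↔ RidgeRel k Γ s cc f)
    (φ : W →ₗ[MvPolynomial (Fin n) k] SRRing k Γ) {a b : Fin n →₀ ℕ} {v : Fin n}
    {β : Fc Γ (s+1) → k}
    (hβ : Rel cc b β) (F : Fc Γ (s+1)) (hb : b.support ⊆ F.1) (hv : v ∈ F.1)
    (hab : ¬ a ≤ b + Finsupp.single v 1) :
    β F * cF hcc hW φ a v F = 0 := by
  rw [cF]
  by_cases ha : a ≤ ind F.1 + Finsupp.single v 1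
  swap
  · rw [if_neg ha, mul_zero]
  rw [if_pos ha]
  set D := ind F.1 + Finsupp.single v 1 - a with hD
  have hDs : D.support ⊆ F.1 := by
    refine (support_mono (tsub_le_self : _ ≤ ind F.1 + Finsupp.single v 1)).trans ?_
    rw [support_add, ind_support]
    refine Finset.union_subset subset_rfl ?_
    refine Finsupp.support_single_subset.trans ?_
    simpa using hv
  have hs : (b + D).support ⊆ F.1 := by
    rw [support_add]; exact Finset.union_subset hb hDs
  have := fact0 hcc hW φ hβ F hs
  rw [if_pos le_self_add, add_tsub_cancel_left] at this
  rw [← this, if_neg]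
  intro hsub
  apply hab
  intro i
  by_contra hlt
  have h1 := ha i
  have h2 : D i = (ind F.1 + Finsupp.single v 1 : Fin n →₀ ℕ) i - a i := by rw [hD, Finsupp.tsub_apply]
  have h3 : i ∈ F.1 → (b + D) i ≠ 0 := fun h => Finsupp.mem_support_iff.mp (hsub h)
  simp only [Finsupp.add_apply, ind_apply] at h1 h2 h3 hlt
  by_cases hi : i ∈ F.1
  · have := h3 hi
    simp only [hi, if_true] at h1 h2
    omega
  · simp only [hi, if_false] at h1 h2
    omega

lemma mono_sum (w : PF k Γ s) : ∃ A : Finset (Fin n →₀ ℕ),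
    w = ∑ a ∈ A, mono a (fun F => cf a (w F)) := by
  classical
  choose p hp using fun F => mk_surj (w F)
  refine ⟨Finset.univ.biUnion fun F => (p F).support, ?_⟩
  funext F
  rw [Finset.sum_apply]
  refine cf_ext fun b hb => ?_
  rw [cf_sum]
  simp_rw [cf_mono (mem_simplex.mp hb)]
  rw [Finset.sum_ite_eq']
  split_ifs with h
  · rfl
  · rw [← hp F, cf_mk hb]
    rw [← notMem_support_iff]
    exact fun h' => h (Finset.mem_biUnion.mpr ⟨F, Finset.mem_univ _, h'⟩)

/-- the homogeneous piece of the trace -/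
lemma exists_homog (hcc : ∀ F ρ, cc F ρ ≠ 0 ↔ ρ.1 ⊆ F.1) (hW : ∀ f, f ∈ W ↔ RidgeRel k Γ s cc f)
    (φ : W →ₗ[MvPolynomial (Fin n) k] SRRing k Γ) (w : W) (e : Fin n →₀ ℕ) (h : cf e (φ w) ≠ 0) :
    ∃ a α, ∃ hα : Rel cc a α, cf e (φ ⟨mono a α, (hW _).mpr (mono_rel hcc hα)⟩) ≠ 0 := by
  obtain ⟨A, hA⟩ := mono_sum w.1
  have hrel : ∀ a, Rel cc a (fun F => cf a (w.1 F)) := fun a ρ hρ => (hW _).mp w.2 ρ a hρ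
  have hw : w = ∑ a ∈ A, ⟨mono a (fun F => cf a (w.1 F)), (hW _).mpr (mono_rel hcc (hrel a))⟩ := by
    apply Subtype.ext
    rw [AddSubmonoidClass.coe_finsetSum]
    exact hA
  by_contra hne
  push Not at hne
  apply h
  rw [hw, map_sum, cf_sum]
  exact Finset.sum_eq_zero fun a _ => hne a _ (hrel a)

end Fact

end Combi
end NG


namespace NG
open MvPolynomial

section Vertex

variable {k : Type} [Field k] {n : ℕ} {Γ : SC n} {s : ℕ}
variable {cc : Fc Γ (s+1) → Fc Γ s → k}

open Classical in
/-- the solution of a ridge relation supported on two facets -/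
noncomputable def prr (cc : Fc Γ (s+1) → Fc Γ s → k) (F F' : Fc Γ (s+1)) (ρ : Fc Γ s) :
    Fc Γ (s+1) → k :=
  fun G => if G = F then cc F' ρ else if G = F' then - cc F ρ else 0

lemma prr_left (F F' : Fc Γ (s+1)) (ρ : Fc Γ s) : prr cc F F' ρ F = cc F' ρ := by
  simp [prr]

lemma prr_right {F F' : Fc Γ (s+1)} (ρ : Fc Γ s) (hne : F ≠ F') : prr cc F F' ρ F' = - cc F ρ := by
  simp [prr, hne.symm]

lemma prr_other {F F' G : Fc Γ (s+1)} (ρ : Fc Γ s) (h : G ≠ F) (h' : G ≠ F') :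
    prr cc F F' ρ G = 0 := by
  simp [prr, h, h']

lemma prr_rel {F F' : Fc Γ (s+1)} {ρ : Fc Γ s} (hne : F ≠ F') {b : Fin n →₀ ℕ}
    (hb : b.support = ρ.1) : Rel cc b (prr cc F F' ρ) := by
  intro ρ' h
  rw [hb] at h
  have : ρ' = ρ := Subtype.ext (Finset.eq_of_subset_of_card_le h (by rw [ρ.2.2, ρ'.2.2])).symm
  subst this
  rw [Fintype.sum_eq_add F F' hne, prr_left, prr_right _ hne]
  · ring
  · rintro G ⟨h1, h2⟩
    rw [prr_other _ h1 h2, mul_zero]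

/-- Data attached to a vertex in the trace. -/
structure VD (cc : Fc Γ (s+1) → Fc Γ s → k) (v : Fin n) (a : Fin n →₀ ℕ) (c α : Fc Γ (s+1) → k) :
    Prop where
  cne : ∀ F, v ∈ F.1 → c F ≠ 0
  αne : ∀ F, v ∈ F.1 → α F ≠ 0
  rel : Rel cc a α
  sup : ∀ F : Fc Γ (s+1), v ∈ F.1 → a.support ⊆ F.1
  int : ∀ (ρ : Fc Γ s) (F F' : Fc Γ (s+1)), v ∈ ρ.1 → F ≠ F' → ρ.1 ⊆ F.1 → ρ.1 ⊆ F'.1 → a.support ⊆ ρ.1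
  pair : ∀ (ρ : Fc Γ s) (F F' : Fc Γ (s+1)), v ∈ ρ.1 → F ≠ F' → ρ.1 ⊆ F.1 → ρ.1 ⊆ F'.1 →
    cc F' ρ * c F + cc F ρ * c F' = 0
  only : ∀ (ρ : Fc Γ s) (F F' : Fc Γ (s+1)), v ∈ ρ.1 → F ≠ F' → ρ.1 ⊆ F.1 → ρ.1 ⊆ F'.1 →
    ∀ F'' : Fc Γ (s+1), ρ.1 ⊆ F''.1 → F'' = F ∨ F'' = F'
  bd : ∀ (ρ : Fc Γ s) (F : Fc Γ (s+1)), v ∈ ρ.1 → ρ.1 ⊆ F.1 →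
    (∀ F' : Fc Γ (s+1), ρ.1 ⊆ F'.1 → F' = F) → ¬ a.support ⊆ ρ.1
  one : a = Finsupp.single v 1 → ∀ (ρ : Fc Γ s) (F F' : Fc Γ (s+1)), F ≠ F' → ρ.1 ⊆ F.1 →
    ρ.1 ⊆ F'.1 → cc F' ρ * c F + cc F ρ * c F' = 0
  two : 2 ≤ a v → ∀ (ρ : Fc Γ s) (F F' : Fc Γ (s+1)), v ∈ F.1 → v ∉ ρ.1 → F ≠ F' → ρ.1 ⊆ F.1 →
    ρ.1 ⊆ F'.1 → False

theorem exists_VD {W : Submodule (MvPolynomial (Fin n) k) (PF k Γ (s+1))}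
    (hcc : ∀ F ρ, cc F ρ ≠ 0 ↔ ρ.1 ⊆ F.1) (hW : ∀ f, f ∈ W ↔ RidgeRel k Γ s cc f)
    (φ : W →ₗ[MvPolynomial (Fin n) k] SRRing k Γ) (v : Fin n) (w : W)
    (h : cf (Finsupp.single v 1) (φ w) ≠ 0) : ∃ a c α, VD cc v a c α := by
  obtain ⟨a, α, hα, hne⟩ := exists_homog hcc hW φ w _ h
  have hvs : ∀ {σ : Finset (Fin n)}, v ∈ σ → (Finsupp.single v 1 : Fin n →₀ ℕ).support ⊆ σ := by
    intro σ hv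
    refine Finsupp.support_single_subset.trans ?_
    simpa using hv
  have hαc : ∀ F : Fc Γ (s+1), v ∈ F.1 → α F * cF hcc hW φ a v F ≠ 0 := by
    intro F hv
    rw [← fact1 hcc hW φ hα F (hvs hv) (add_comm _ _)]
    exact hne
  have hc : ∀ F : Fc Γ (s+1), v ∈ F.1 → cF hcc hW φ a v F ≠ 0 := fun F hv => right_ne_zero_of_mul (hαc F hv)
  have hsup : ∀ F : Fc Γ (s+1), v ∈ F.1 → a.support ⊆ F.1 := by
    intro F hv
    have h1 := hc F hv
    rw [cF] at h1
    have h2 : a ≤ ind F.1 + Finsupp.single v 1 := by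
      by_contra h0
      rw [if_neg h0] at h1
      exact h1 rfl
    refine (support_mono h2).trans ?_
    rw [support_add, ind_support]
    exact Finset.union_subset subset_rfl (hvs hv)
  have hint : ∀ (ρ : Fc Γ s) (F F' : Fc Γ (s+1)), v ∈ ρ.1 → F ≠ F' → ρ.1 ⊆ F.1 → ρ.1 ⊆ F'.1 →
      a.support ⊆ ρ.1 := by
    intro ρ F F' hv hne h1 h2
    rw [← inter_eq hne h1 h2]
    exact Finset.subset_inter (hsup F (h1 hv)) (hsup F' (h2 hv))
  -- the pairing identity in a general form
  have hgen : ∀ (ρ : Fc Γ s) (F F' : Fc Γ (s+1)) (b e : Fin n →₀ ℕ), F ≠ F' → ρ.1 ⊆ F.1 →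
      ρ.1 ⊆ F'.1 → b.support = ρ.1 → e.support ⊆ ρ.1 → e + a = b + Finsupp.single v 1 →
      ∀ G : Fc Γ (s+1), ρ.1 ⊆ G.1 →
        prr cc F F' ρ G * cF hcc hW φ a v G = cc F' ρ * cF hcc hW φ a v F := by
    intro ρ F F' b e hne h1 h2 hb he hab G hG
    rw [← fact1 hcc hW φ (prr_rel hne hb) G (he.trans hG) hab,
      fact1 hcc hW φ (prr_rel hne hb) F (he.trans h1) hab, prr_left]
  have hgen' : ∀ (ρ : Fc Γ s) (F F' : Fc Γ (s+1)), v ∈ ρ.1 → F ≠ F' → ρ.1 ⊆ F.1 →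
      ρ.1 ⊆ F'.1 → ∀ G : Fc Γ (s+1), ρ.1 ⊆ G.1 →
        prr cc F F' ρ G * cF hcc hW φ a v G = cc F' ρ * cF hcc hW φ a v F := by
    intro ρ F F' hv hne h1 h2
    refine hgen ρ F F' (a + ind ρ.1) (Finsupp.single v 1 + ind ρ.1) hne h1 h2
      (support_add_ind_sub (hint ρ F F' hv hne h1 h2)) (by rw [support_add_ind_sub (hvs hv)]) ?_
    abel
  refine ⟨a, cF hcc hW φ a v, α, hc, fun F hv => left_ne_zero_of_mul (hαc F hv), hα, hsup, hint,
    ?_, ?_, ?_, ?_, ?_⟩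
  · intro ρ F F' hv hne h1 h2
    have := hgen' ρ F F' hv hne h1 h2 F' h2
    rw [prr_right _ hne] at this
    rw [← this]; ring
  · intro ρ F F' hv hne h1 h2 G hG
    by_contra hcon
    push Not at hcon
    have := hgen' ρ F F' hv hne h1 h2 G hG
    rw [prr_other _ hcon.1 hcon.2, zero_mul] at this
    exact mul_ne_zero ((hcc F' ρ).mpr h2) (hc F (h1 hv)) this.symm
  · intro ρ F hv h1 huniq hsub
    have := hα ρ hsub
    rw [one_sum hcc huniq] at this
    exact mul_ne_zero ((hcc F ρ).mpr h1) (left_ne_zero_of_mul (hαc F (h1 hv))) this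
  · intro ha ρ F F' hne h1 h2
    have := hgen ρ F F' (ind ρ.1) (ind ρ.1) hne h1 h2 (ind_support _) (by rw [ind_support]) (by rw [ha])
      F' h2
    rw [prr_right _ hne] at this
    rw [← this]; ring
  · intro ha ρ F F' hv hvρ hne h1 h2
    have := fact2 hcc hW φ (a := a) (v := v) (prr_rel (cc := cc) hne (ind_support ρ.1)) F
      (by rw [ind_support]; exact h1) hv (by
        intro hle
        have := hle v
        simp only [Finsupp.add_apply, ind_apply, hvρ, if_false, Finsupp.single_eq_same] at this
        omega)
    rw [prr_left] at this
    exact mul_ne_zero ((hcc F' ρ).mpr h2) (hc F hv) this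

/-- Output of the combinatorial analysis. -/
structure GD (cc : Fc Γ (s+1) → Fc Γ s → k) (b : Fc Γ (s+1) → k) : Prop where
  ne : ∀ F, b F ≠ 0
  pair : ∀ (ρ : Fc Γ s) (F F' : Fc Γ (s+1)), F ≠ F' → ρ.1 ⊆ F.1 → ρ.1 ⊆ F'.1 →
    cc F ρ * b F + cc F' ρ * b F' = 0
  only : ∀ (ρ : Fc Γ s) (F F' : Fc Γ (s+1)), F ≠ F' → ρ.1 ⊆ F.1 → ρ.1 ⊆ F'.1 →
    ∀ F'' : Fc Γ (s+1), ρ.1 ⊆ F''.1 → F'' = F ∨ F'' = F'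
  bd : ∀ (F : Fc Γ (s+1)) (x) (hx : x ∈ F.1),
    (∀ F' : Fc Γ (s+1), (er F x hx).1 ⊆ F'.1 → F' = F) → ∀ F' : Fc Γ (s+1), x ∈ F'.1

theorem lemmaG {W : Submodule (MvPolynomial (Fin n) k) (PF k Γ (s+1))}
    (hcc : ∀ F ρ, cc F ρ ≠ 0 ↔ ρ.1 ⊆ F.1) (hW : ∀ f, f ∈ W ↔ RidgeRel k Γ s cc f)
    (hpure : ∀ σ ∈ Γ.faces, ∃ F : Fc Γ (s+1), σ ⊆ F.1)
    (hconn : ∀ (τ : Finset (Fin n)) (h : Fc Γ (s+1) → k),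
      (∀ F F' : Fc Γ (s+1), τ ⊆ F.1 → τ ⊆ F'.1 → (F.1 ∩ F'.1).card = s → h F = h F') →
      ∀ F F' : Fc Γ (s+1), τ ⊆ F.1 → τ ⊆ F'.1 → h F = h F')
    {b : Fc Γ (s+1) → k} (hb : GD cc b) :
    ∃ u : W, Gen (srIdeal k Γ) u := by
  classical
  let K : Finset (Fin n) := Finset.univ.filter fun v => ∀ F : Fc Γ (s+1), v ∈ F.1
  have hK : ∀ F : Fc Γ (s+1), K ⊆ F.1 := fun F v hv => (Finset.mem_filter.mp hv).2 F
  have hrel : Rel cc (ind K) b := by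
    intro ρ hρ
    rw [ind_support] at hρ
    obtain ⟨F, hF⟩ := hpure ρ.1 ρ.2.1
    obtain ⟨x, hx, rfl⟩ := exists_er hF
    by_cases huniq : ∀ F' : Fc Γ (s+1), (er F x hx).1 ⊆ F'.1 → F' = F
    · have : x ∈ K := Finset.mem_filter.mpr ⟨Finset.mem_univ _, hb.bd F x hx huniq⟩
      exact absurd (hρ this) (Finset.notMem_erase _ _)
    · push Not at huniq
      obtain ⟨F', hF', hne⟩ := huniq
      rw [two_sum hcc hne.symm (hb.only _ F F' hne.symm hF hF')]
      exact hb.pair _ F F' hne.symm hF hF'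
  refine ⟨⟨mono (ind K) b, (hW _).mpr (mono_rel hcc hrel)⟩, ?_, ?_⟩
  · rintro ⟨f, hf⟩
    have hf' := (hW f).mp hf
    -- ratios are constant
    have hconst : ∀ a : Fin n →₀ ℕ, ∀ F F' : Fc Γ (s+1), a.support ⊆ F.1 → a.support ⊆ F'.1 →
        cf (a + ind K) (f F) * (b F)⁻¹ = cf (a + ind K) (f F') * (b F')⁻¹ := by
      intro a F F' hF hF'
      have hsub : ∀ F : Fc Γ (s+1), a.support ⊆ F.1 → (a + ind K).support ⊆ F.1 := by
        intro F hF
        rw [support_add, ind_support]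
        exact Finset.union_subset hF (hK F)
      refine hconn (a + ind K).support (fun F => cf (a + ind K) (f F) * (b F)⁻¹) ?_ F F'
        (hsub F hF) (hsub F' hF')
      intro F F' hF hF' hcard
      obtain ⟨hne, ρ, hρ⟩ := exists_ridge hcard
      have h1 : ρ.1 ⊆ F.1 := by rw [hρ]; exact Finset.inter_subset_left
      have h2 : ρ.1 ⊆ F'.1 := by rw [hρ]; exact Finset.inter_subset_right
      have e1 := hf' ρ (a + ind K) (by rw [hρ]; exact Finset.subset_inter hF hF')
      rw [two_sum hcc hne (hb.only _ F F' hne h1 h2) (fun F => cf (a + ind K) (f F))] at e1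
      have e2 := hb.pair ρ F F' hne h1 h2
      have n1 := (hcc F ρ).mpr h1
      have n2 := (hcc F' ρ).mpr h2
      have n3 := hb.ne F
      have n4 := hb.ne F'
      have e3 : cc F' ρ = - (cc F ρ * b F) * (b F')⁻¹ := by
        field_simp
        linear_combination e2
      rw [e3] at e1
      have e4 : cc F ρ * b F * (cf (a + ind K) (f F) * (b F)⁻¹ - cf (a + ind K) (f F') * (b F')⁻¹) = 0 := by
        rw [← e1]
        field_simp
        ring
      exact sub_eq_zero.mp ((mul_eq_zero.mp e4).resolve_left (mul_ne_zero n1 n3))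
    choose p hp using fun F => mk_surj (f F)
    let A : Finset (Fin n →₀ ℕ) := Finset.univ.biUnion fun F => (p F).support.image fun a => a - ind K
    have hA : ∀ a ∉ A, ∀ F : Fc Γ (s+1), cf (a + ind K) (f F) = 0 := by
      intro a ha F
      by_cases hs : (a + ind K).support ∈ (simplex F.1).faces
      · rw [← hp F, cf_mk hs, ← notMem_support_iff]
        intro h
        apply ha
        refine Finset.mem_biUnion.mpr ⟨F, Finset.mem_univ _, Finset.mem_image.mpr ⟨_, h, ?_⟩⟩
        exact add_tsub_cancel_right _ _
      · exact cf_of_not hs _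
    let r : (Fin n →₀ ℕ) → k := fun a =>
      if h : a.support ∈ Γ.faces then
        cf (a + ind K) (f (hpure _ h).choose) * (b (hpure _ h).choose)⁻¹ else 0
    let q : MvPolynomial (Fin n) k := ∑ a ∈ A, monomial a (r a)
    have hq : ∀ a, ∀ F : Fc Γ (s+1), a.support ⊆ F.1 → coeff a q * b F = cf (a + ind K) (f F) := by
      intro a F hF
      have h1 : coeff a q = if a ∈ A then r a else 0 := by
        simp only [q, coeff_sum, coeff_monomial]
        rw [Finset.sum_ite_eq']
      rw [h1]
      split_ifs with h
      · have hface := Γ.down_closed F.2.1 hF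
        simp only [r, dif_pos hface]
        rw [hconst a _ F (hpure _ hface).choose_spec hF, mul_assoc, inv_mul_cancel₀ (hb.ne F), mul_one]
      · rw [hA a h F, zero_mul]
    refine ⟨q, Subtype.ext ?_⟩
    funext F
    change f F = q • mk (simplex F.1) (monomial (ind K) (b F))
    refine cf_ext fun g hg => ?_
    have hgF := mem_simplex.mp hg
    rw [smul_mk, cf_mk hg, coeff_mul_monomial']
    split_ifs with hKg
    · rw [hq _ F ((support_mono tsub_le_self).trans hgF), tsub_add_cancel_of_le hKg]
    · rw [ind_le_iff, Finset.not_subset] at hKg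
      obtain ⟨x, hxK, hxg⟩ := hKg
      have hxF := hK F hxK
      have huniq : ∀ F' : Fc Γ (s+1), (er F x hxF).1 ⊆ F'.1 → F' = F := by
        intro F' h
        have h2 : F.1 ⊆ F'.1 := by
          intro y hy
          by_cases hyx : y = x
          · rw [hyx]; exact hK F' hxK
          · exact h (Finset.mem_erase.mpr ⟨hyx, hy⟩)
        exact Subtype.ext (Finset.eq_of_subset_of_card_le h2 (by rw [F.2.2, F'.2.2])).symm
      have e1 := hf' (er F x hxF) g (Finset.subset_erase.mpr ⟨hgF, hxg⟩)
      rw [one_sum hcc huniq (fun F => cf g (f F))] at e1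
      exact (mul_eq_zero.mp e1).resolve_left ((hcc _ _).mpr (er_sub F x hxF))
  · intro p
    rw [mem_sr]
    have h0 : p • (⟨mono (ind K) b, (hW _).mpr (mono_rel hcc hrel)⟩ : W) = 0 ↔
        ∀ F : Fc Γ (s+1), mk (simplex F.1) (p * monomial (ind K) (b F)) = 0 := by
      rw [← Subtype.coe_inj]
      exact funext_iff
    rw [h0]
    constructor
    · intro h a ha
      obtain ⟨F, hF⟩ := hpure _ ha
      have h1 := mk_eq_zero.mp (h F) (a + ind K) (by
        rw [support_add, ind_support, mem_simplex]
        exact Finset.union_subset hF (hK F))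
      rw [coeff_mul_monomial] at h1
      exact (mul_eq_zero.mp h1).resolve_right (hb.ne F)
    · intro h F
      rw [map_mul]
      have : mk (simplex F.1) p = 0 := by
        rw [mk_eq_zero]
        intro a ha
        exact h a (Γ.down_closed F.2.1 (mem_simplex.mp ha))
      rw [this, zero_mul]

end Vertex
end NG


namespace NG
open MvPolynomial

section Cases

variable {k : Type} [Field k] {n : ℕ} {Γ : SC n} {s : ℕ}
variable {cc : Fc Γ (s+1) → Fc Γ s → k}

/-- passing to inverses in a two-term relation -/
lemma inv_pair {p q x y : k} (hx : x ≠ 0) (hy : y ≠ 0) (h : q * x + p * y = 0) :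
    p * x⁻¹ + q * y⁻¹ = 0 := by
  field_simp
  linear_combination h

lemma only_all (hs : 2 ≤ s)
    (hV : ∀ (F : Fc Γ (s+1)) (v : Fin n), v ∈ F.1 → ∃ a c α, VD cc v a c α)
    (ρ : Fc Γ s) (F F' : Fc Γ (s+1)) (hne : F ≠ F') (h : ρ.1 ⊆ F.1) (h' : ρ.1 ⊆ F'.1)
    (F'' : Fc Γ (s+1)) (h'' : ρ.1 ⊆ F''.1) : F'' = F ∨ F'' = F' := by
  have hc := ρ.2.2
  obtain ⟨v, hv⟩ : ρ.1.Nonempty := by rw [← Finset.card_pos, hc]; omega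
  obtain ⟨a, c, α, V⟩ := hV F v (h hv)
  exact V.only ρ F F' hv hne h h' F'' h''

lemma caseI (hs : 2 ≤ s)
    (hV : ∀ (F : Fc Γ (s+1)) (v : Fin n), v ∈ F.1 → ∃ a c α, VD cc v a c α)
    (F0 : Fc Γ (s+1)) (v : Fin n) (hv : ∀ F : Fc Γ (s+1), v ∈ F.1) : ∃ b, GD cc b := by
  obtain ⟨a, c, α, V⟩ := hV F0 v (hv F0)
  refine ⟨fun F => (c F)⁻¹, fun F => inv_ne_zero (V.cne F (hv F)), ?_, only_all hs hV, ?_⟩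
  · intro ρ F F' hne h h'
    have hvρ : v ∈ ρ.1 := by
      rw [← inter_eq hne h h']
      exact Finset.mem_inter.mpr ⟨hv F, hv F'⟩
    exact inv_pair (V.cne F (hv F)) (V.cne F' (hv F')) (V.pair ρ F F' hvρ hne h h')
  · intro F x hx hu F'
    by_cases hxv : x = v
    · rw [hxv]; exact hv F'
    · have hver : v ∈ (er F x hx).1 := Finset.mem_erase.mpr ⟨fun h => hxv h.symm, hv F⟩
      have h1 := V.bd _ F hver (er_sub F x hx) hu
      obtain ⟨y, hy, hy'⟩ := Finset.not_subset.mp h1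
      have hyx : y = x := by
        by_contra hyx
        exact hy' (Finset.mem_erase.mpr ⟨hyx, V.sup F (hv F) hy⟩)
      rw [← hyx]
      exact V.sup F' (hv F') hy

lemma caseIII_aux
    (hconn : ∀ (τ : Finset (Fin n)) (h : Fc Γ (s+1) → k),
      (∀ F F' : Fc Γ (s+1), τ ⊆ F.1 → τ ⊆ F'.1 → (F.1 ∩ F'.1).card = s → h F = h F') →
      ∀ F F' : Fc Γ (s+1), τ ⊆ F.1 → τ ⊆ F'.1 → h F = h F')
    (F0 : Fc Γ (s+1)) (P : Fc Γ (s+1) → Prop) (h0 : P F0)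
    (hP : ∀ (ρ : Fc Γ s) (F F' : Fc Γ (s+1)), F ≠ F' → ρ.1 ⊆ F.1 → ρ.1 ⊆ F'.1 → P F → P F')
    (F : Fc Γ (s+1)) : P F := by
  classical
  have := hconn ∅ (fun F => if P F then 1 else 0) ?_ F F0 (Finset.empty_subset _)
    (Finset.empty_subset _)
  · simp only [if_pos h0] at this
    by_contra hF
    rw [if_neg hF] at this
    exact zero_ne_one this
  · intro F F' _ _ hcard
    obtain ⟨hne, ρ, hρ⟩ := exists_ridge hcard
    have h1 : ρ.1 ⊆ F.1 := by rw [hρ]; exact Finset.inter_subset_left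
    have h2 : ρ.1 ⊆ F'.1 := by rw [hρ]; exact Finset.inter_subset_right
    have : P F ↔ P F' := ⟨hP ρ F F' hne h1 h2, hP ρ F' F hne.symm h2 h1⟩
    simp only [this]

theorem exists_GD (hs : 2 ≤ s) (hcc : ∀ F ρ, cc F ρ ≠ 0 ↔ ρ.1 ⊆ F.1)
    (hV : ∀ (F : Fc Γ (s+1)) (v : Fin n), v ∈ F.1 → ∃ a c α, VD cc v a c α)
    (hconn : ∀ (τ : Finset (Fin n)) (h : Fc Γ (s+1) → k),
      (∀ F F' : Fc Γ (s+1), τ ⊆ F.1 → τ ⊆ F'.1 → (F.1 ∩ F'.1).card = s → h F = h F') →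
      ∀ F F' : Fc Γ (s+1), τ ⊆ F.1 → τ ⊆ F'.1 → h F = h F')
    (F0 : Fc Γ (s+1)) : ∃ b, GD cc b := by
  classical
  by_cases hbd : ∃ (F : Fc Γ (s+1)) (x : Fin n) (hx : x ∈ F.1),
      ∀ F' : Fc Γ (s+1), (er F x hx).1 ⊆ F'.1 → F' = F
  · obtain ⟨F1, x, hx1, hu1⟩ := hbd
    refine caseI hs hV F0 x fun F => ?_
    refine (caseIII_aux hconn F1 (fun F => ∃ hx : x ∈ F.1,
      ∀ F' : Fc Γ (s+1), (er F x hx).1 ⊆ F'.1 → F' = F) ⟨hx1, hu1⟩ ?_ F).1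
    rintro ρ F G hne h1 h2 ⟨hxF, hu⟩
    have hcρ := ρ.2.2
    have hxρ : x ∈ ρ.1 := by
      by_contra hxρ
      have hsub : ρ.1 ⊆ (er F x hxF).1 := Finset.subset_erase.mpr ⟨h1, hxρ⟩
      have hc2 := (er F x hxF).2.2
      have := Finset.eq_of_subset_of_card_le hsub (by rw [hc2, hcρ])
      exact hne (hu G (this ▸ h2)).symm
    obtain ⟨z, hz⟩ : (ρ.1.erase x).Nonempty := by
      rw [← Finset.card_pos, Finset.card_erase_of_mem hxρ, hcρ]; omega
    obtain ⟨hzx, hzρ⟩ := Finset.mem_erase.mp hz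
    obtain ⟨a, c, α, V⟩ := hV F z (h1 hzρ)
    have h3 := V.bd (er F x hxF) F (Finset.mem_erase.mpr ⟨hzx, h1 hzρ⟩) (er_sub F x hxF) hu
    obtain ⟨y, hy, hy'⟩ := Finset.not_subset.mp h3
    have hyx : y = x := by
      by_contra hyx
      exact hy' (Finset.mem_erase.mpr ⟨hyx, V.sup F (h1 hzρ) hy⟩)
    rw [hyx] at hy
    refine ⟨h2 hxρ, fun G' hG' => ?_⟩
    by_contra hGG
    have := V.int (er G x (h2 hxρ)) G G' (Finset.mem_erase.mpr ⟨hzx, h2 hzρ⟩)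
      (fun h => hGG h.symm) (er_sub _ _ _) hG'
    exact Finset.notMem_erase _ _ (this hy)
  · have hbd' : ∀ (F : Fc Γ (s+1)) (x : Fin n) (hx : x ∈ F.1),
        ∃ F' : Fc Γ (s+1), (er F x hx).1 ⊆ F'.1 ∧ F' ≠ F := by
      intro F x hx
      by_contra hcon
      push Not at hcon
      exact hbd ⟨F, x, hx, hcon⟩
    have hbdv : ∀ (F : Fc Γ (s+1)) (x) (hx : x ∈ F.1),
        (∀ F' : Fc Γ (s+1), (er F x hx).1 ⊆ F'.1 → F' = F) → ∀ F' : Fc Γ (s+1), x ∈ F'.1 :=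
      fun F x hx hu => absurd ⟨F, x, hx, hu⟩ hbd
    have hcF := F0.2.2
    obtain ⟨v, hv⟩ : F0.1.Nonempty := by rw [← Finset.card_pos, hcF]; omega
    obtain ⟨a, c, α, V⟩ := hV F0 v hv
    have hsup : ∀ y, y ≠ v → a y = 0 := by
      intro y hyv
      by_contra hy
      have hy1 : y ∈ a.support := Finsupp.mem_support_iff.mpr hy
      have hyF := V.sup F0 hv hy1
      obtain ⟨F', h', hne⟩ := hbd' F0 y hyF
      have := V.int (er F0 y hyF) F0 F' (Finset.mem_erase.mpr ⟨fun h => hyv h.symm, hv⟩) hne.symm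
        (er_sub _ _ _) h'
      exact Finset.notMem_erase _ _ (this hy1)
    rcases Nat.lt_or_ge (a v) 2 with hav | hav
    · have hav' : a v = 0 ∨ a v = 1 := by omega
      rcases hav' with hav | hav
      · have ha : a = 0 := by
          ext y
          by_cases hy : y = v
          · rw [hy, hav]; rfl
          · exact hsup y hy
        have hpair : ∀ (ρ : Fc Γ s) (F F' : Fc Γ (s+1)), F ≠ F' → ρ.1 ⊆ F.1 → ρ.1 ⊆ F'.1 →
            cc F ρ * α F + cc F' ρ * α F' = 0 := by
          intro ρ F F' hne h h'
          have := V.rel ρ (by rw [ha]; simp)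
          rwa [two_sum hcc hne (only_all hs hV ρ F F' hne h h')] at this
        refine ⟨α, caseIII_aux hconn F0 (fun F => α F ≠ 0) (V.αne F0 hv) ?_, hpair,
          only_all hs hV, hbdv⟩
        intro ρ F F' hne h h' hF hF'
        have := hpair ρ F F' hne h h'
        rw [hF', mul_zero, add_zero] at this
        exact mul_ne_zero ((hcc F ρ).mpr h) hF this
      · have ha : a = Finsupp.single v 1 := by
          ext y
          by_cases hy : y = v
          · rw [hy, hav, Finsupp.single_eq_same]
          · rw [hsup y hy, Finsupp.single_eq_of_ne hy]
        have hpair := V.one ha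
        have hne0 : ∀ F, c F ≠ 0 := by
          refine caseIII_aux hconn F0 (fun F => c F ≠ 0) (V.cne F0 hv) ?_
          intro ρ F F' hne h h' hF hF'
          have := hpair ρ F F' hne h h'
          rw [hF', mul_zero, add_zero] at this
          exact mul_ne_zero ((hcc F' ρ).mpr h') hF this
        exact ⟨fun F => (c F)⁻¹, fun F => inv_ne_zero (hne0 F),
          fun ρ F F' hne h h' => inv_pair (hne0 F) (hne0 F') (hpair ρ F F' hne h h'),
          only_all hs hV, hbdv⟩
    · obtain ⟨F', h', hne⟩ := hbd' F0 v hv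
      exact (V.two hav (er F0 v hv) F0 F' hv (Finset.notMem_erase _ _) hne.symm
        (er_sub _ _ _) h').elim

end Cases
end NG


namespace NG

section Change

variable {P R : Type} [CommRing P] [CommRing R] [Algebra P R]
variable {Y : Type} [AddCommGroup Y] [Module P Y]
variable {N : Type} [AddCommGroup N] [Module R N] [Module P N] [IsScalarTower P R N]
variable {L : Type} [AddCommGroup L] [Module R L] [Module P L] [IsScalarTower P R L]

/-- semilinear maps that are isomorphisms up to `m`-null modules -/
structure NIso (m : Ideal P) {A B : Type} [AddCommGroup A] [Module R A] [AddCommGroup B] [Module P B]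
    (φ : A →+ B) : Prop where
  lin : ∀ (p : P) (x : A), φ (algebraMap P R p • x) = p • φ x
  ker : ∀ x, φ x = 0 → ∃ s : P, s ∉ m ∧ algebraMap P R s • x = 0
  coker : ∀ y, ∃ s : P, s ∉ m ∧ ∃ x, s • y = φ x

/-- the comparison map in degree zero -/
noncomputable def Th {c : ℕ} (η : EX P R Y c) (f : N →ₗ[R] R) : EX P N Y c :=
  pre Y (f.restrictScalars P) c η

lemma Th_add {c : ℕ} (η : EX P R Y c) (f g : N →ₗ[R] R) : Th η (f + g) = Th η f + Th η g :=
  pre_add (f.restrictScalars P) (g.restrictScalars P) c η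

lemma Th_zero {c : ℕ} (η : EX P R Y c) : Th η (0 : N →ₗ[R] R) = 0 :=
  pre_zero (M := N) c η

lemma Th_sum {c : ℕ} (η : EX P R Y c) {ι : Type} (s : Finset ι) (f : ι → (N →ₗ[R] R)) :
    Th η (∑ j ∈ s, f j) = ∑ j ∈ s, Th η (f j) := by
  classical
  induction s using Finset.induction_on with
  | empty => simp [Th_zero]
  | insert a s ha ih => simp [Finset.sum_insert ha, Th_add, ih]

lemma Th_smul {c : ℕ} (η : EX P R Y c) (p : P) (f : N →ₗ[R] R) :
    Th η (algebraMap P R p • f) = p • Th η f := by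
  have : (algebraMap P R p • f).restrictScalars P = p • f.restrictScalars P := by
    refine LinearMap.ext fun x => ?_
    change algebraMap P R p • f x = p • f x
    rw [algebraMap_smul]
  rw [Th, this, pre_smul]
  rfl

lemma Th_comp {c : ℕ} (η : EX P R Y c) (f : N →ₗ[R] R) (g : L →ₗ[R] N) :
    pre Y (g.restrictScalars P) c (Th η f) = Th η (f ∘ₗ g) :=
  pre_pre _ _ _ _

lemma SES.rs {A B C : Type} [AddCommGroup A] [Module R A] [Module P A] [IsScalarTower P R A]
    [AddCommGroup B] [Module R B] [Module P B] [IsScalarTower P R B]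
    [AddCommGroup C] [Module R C] [Module P C] [IsScalarTower P R C]
    {f : A →ₗ[R] B} {g : B →ₗ[R] C} (h : SES f g) :
    SES (f.restrictScalars P) (g.restrictScalars P) where
  inj := h.inj
  surj := h.surj
  exact := h.exact

/-- identity on a finite free module as a sum -/
lemma pi_decomp {m : ℕ} {i : ℕ} (y : EX P (Fin m → R) Y i) :
    y = ∑ j, pre Y ((LinearMap.proj (R := R) (φ := fun _ : Fin m => R) j).restrictScalars P) i
      (pre Y ((LinearMap.single R (fun _ : Fin m => R) j).restrictScalars P) i y) := by
  simp only [pre_pre]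
  rw [← pre_sum]
  conv_lhs => rw [← pre_id i y]
  congr 2
  refine LinearMap.ext fun x => ?_
  rw [LinearMap.sum_apply]
  funext l
  rw [Finset.sum_apply]
  simp [Pi.single_apply]

lemma free_null {m : Ideal P} [hm : m.IsMaximal] {r i : ℕ} (h : Null m (EX P R Y i)) :
    Null m (EX P (Fin r → R) Y i) := by
  intro y
  choose s hs h0 using fun j : Fin r =>
    h (pre Y ((LinearMap.single R (fun _ : Fin r => R) j).restrictScalars P) i y)
  refine ⟨∏ j, s j, ?_, ?_⟩
  · rw [hm.isPrime.prod_mem_iff]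
    push Not
    intro j _
    exact hs j
  · conv_lhs => rw [pi_decomp y]
    rw [Finset.smul_sum]
    refine Finset.sum_eq_zero fun j _ => ?_
    rw [← map_smul, ← Finset.prod_erase_mul _ _ (Finset.mem_univ j), mul_smul, h0, smul_zero, map_zero]

variable {c : ℕ} {η : EX P R Y c}

lemma Th_mul_id (p : P) : Th η (LinearMap.toSpanSingleton R R (algebraMap P R p)) = p • η := by
  have : (LinearMap.toSpanSingleton R R (algebraMap P R p)).restrictScalars P =
      p • (LinearMap.id : R →ₗ[P] R) := by
    refine LinearMap.ext fun x => ?_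
    change x • algebraMap P R p = p • x
    rw [Algebra.smul_def p x, smul_eq_mul, mul_comm]
  rw [Th, this, pre_smul, pre_id]

lemma Th_inj_R (hsurj : Function.Surjective (algebraMap P R))
    (hη : Gen (RingHom.ker (algebraMap P R)) η) (f : R →ₗ[R] R) (h : Th η f = 0) : f = 0 := by
  obtain ⟨p, hp⟩ := hsurj (f 1)
  have hf : f = LinearMap.toSpanSingleton R R (algebraMap P R p) := by
    refine LinearMap.ext_ring ?_
    rw [LinearMap.toSpanSingleton_apply, one_smul, hp]
  rw [hf, Th_mul_id, hη.ann, RingHom.mem_ker] at h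
  rw [hf, h]
  exact LinearMap.toSpanSingleton_zero R R

lemma Th_inj_free (hsurj : Function.Surjective (algebraMap P R))
    (hη : Gen (RingHom.ker (algebraMap P R)) η) {r : ℕ} (f : (Fin r → R) →ₗ[R] R)
    (h : Th η f = 0) : f = 0 := by
  refine LinearMap.pi_ext' fun j => ?_
  rw [LinearMap.zero_comp]
  refine Th_inj_R hsurj hη _ ?_
  rw [← Th_comp, h, map_zero]

lemma Th_surj_free (hη : Gen (RingHom.ker (algebraMap P R)) η) {r : ℕ}
    (y : EX P (Fin r → R) Y c) : ∃ f : (Fin r → R) →ₗ[R] R, Th η f = y := by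
  choose p hp using fun j : Fin r =>
    hη.gen (pre Y ((LinearMap.single R (fun _ : Fin r => R) j).restrictScalars P) c y)
  refine ⟨∑ j, LinearMap.toSpanSingleton R R (algebraMap P R (p j)) ∘ₗ
    LinearMap.proj (R := R) (φ := fun _ : Fin r => R) j, ?_⟩
  rw [Th_sum, pi_decomp y]
  refine Finset.sum_congr rfl fun j _ => ?_
  rw [hp j, ← Th_mul_id, Th_comp]

/-- hypotheses for change of rings -/
structure CR (m : Ideal P) (η : EX P R Y c) : Prop where
  surj : Function.Surjective (algebraMap P R)
  gen : Gen (RingHom.ker (algebraMap P R)) η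
  low : ∀ (N : Type) [AddCommGroup N] [Module R N] [Module P N] [IsScalarTower P R N]
    [Module.Finite R N], ∀ i < c, Null m (EX P N Y i)
  high : ∀ i, c < i → Null m (EX P R Y i)

/-- presentation of a finite module -/
lemma exists_pres [IsNoetherianRing R] (N : Type) [AddCommGroup N] [Module R N] [Module.Finite R N] :
    ∃ (r : ℕ) (g : (Fin r → R) →ₗ[R] N), SES (LinearMap.ker g).subtype g := by
  obtain ⟨r, g, hg⟩ := Module.Finite.exists_fin' R N
  exact ⟨r, g, Subtype.val_injective, hg, LinearMap.exact_subtype_ker_map g⟩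

lemma Th_inj [IsNoetherianRing R] {m : Ideal P} (H : CR m η) [Module.Finite R N]
    (f : N →ₗ[R] R) (h : Th η f = 0) : f = 0 := by
  obtain ⟨r, g, hg⟩ := exists_pres (R := R) N
  have h1 : f ∘ₗ g = 0 := by
    refine Th_inj_free H.surj H.gen _ ?_
    rw [← Th_comp, h, map_zero]
  refine LinearMap.ext fun x => ?_
  obtain ⟨y, rfl⟩ := hg.surj x
  exact LinearMap.congr_fun h1 y

lemma Th_coker [IsNoetherianRing R] {m : Ideal P} [hm : m.IsMaximal] (H : CR m η) [Module.Finite R N]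
    (y : EX P N Y c) : ∃ s : P, s ∉ m ∧ ∃ f : N →ₗ[R] R, s • y = Th η f := by
  obtain ⟨r, g, hg⟩ := exists_pres (R := R) N
  have hgP := hg.rs (P := P)
  obtain ⟨h, hh⟩ := Th_surj_free H.gen (pre Y (g.restrictScalars P) c y)
  have h1 : h ∘ₗ (LinearMap.ker g).subtype = 0 := by
    refine Th_inj H _ ?_
    rw [← Th_comp, hh]
    exact hgP.pre_pre_eq_zero c y
  obtain ⟨f, hf⟩ : ∃ f : N →ₗ[R] R, f ∘ₗ g = h := by
    refine ⟨(LinearMap.ker g).liftQ h ?_ ∘ₗ (g.quotKerEquivOfSurjective hg.surj).symm.toLinearMap, ?_⟩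
    · intro x hx
      exact LinearMap.congr_fun h1 ⟨x, hx⟩
    · refine LinearMap.ext fun x => ?_
      have : (g.quotKerEquivOfSurjective hg.surj).symm (g x) = Submodule.Quotient.mk x := by
        rw [LinearEquiv.symm_apply_eq]; rfl
      rw [LinearMap.comp_apply, LinearMap.comp_apply, LinearEquiv.coe_coe, this]
      rfl
  have h2 : pre Y (g.restrictScalars P) c (y - Th η f) = 0 := by
    rw [map_sub, Th_comp, hf, hh, sub_self]
  have h3 : ∃ s : P, s ∉ m ∧ s • (y - Th η f) = 0 := by
    cases c with
    | zero => exact ⟨1, one_notMem m, by rw [hgP.pre_inj _ h2, smul_zero]⟩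
    | succ c =>
      obtain ⟨z, hz⟩ := hgP.exact₃ c _ h2
      obtain ⟨s, hs, h0⟩ := H.low (LinearMap.ker g) c (Nat.lt_succ_self c) z
      exact ⟨s, hs, by rw [← hz, ← map_smul, h0, map_zero]⟩
  obtain ⟨s, hs, h0⟩ := h3
  refine ⟨s, hs, algebraMap P R s • f, ?_⟩
  rw [Th_smul, ← sub_eq_zero, ← smul_sub, h0]

/-- dimension shifting step -/
lemma shift_step {m : Ideal P} [hm : m.IsMaximal] {r i e : ℕ} {g : (Fin r → R) →ₗ[R] N}
    (hg : SES (LinearMap.ker g).subtype g)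
    (φ : EX R (LinearMap.ker g) R i →+ EX P (LinearMap.ker g) Y e)
    (hlin : ∀ (p : P) x, φ (algebraMap P R p • x) = p • φ x)
    (hco : ∀ y, ∃ s : P, s ∉ m ∧ ∃ x, s • y = φ x)
    (hwd : ∀ x, hg.δ R i x = 0 → (hg.rs (P := P)).δ Y e (φ x) = 0)
    (hker : ∀ x, (hg.rs (P := P)).δ Y e (φ x) = 0 → ∃ s : P, s ∉ m ∧ algebraMap P R s • hg.δ R i x = 0)
    (hnull : Null m (EX P (Fin r → R) Y (e+1))) :
    ∃ ψ : EX R N R (i+1) →+ EX P N Y (e+1), NIso (R := R) m ψ := by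
  have hsurj : Function.Surjective (hg.δ R i) := by
    intro x
    exact hg.exact₃ i x ((subsingleton_of_free i).elim _ _)
  choose σ hσ using hsurj
  have key : ∀ x, (hg.rs (P := P)).δ Y e (φ (σ (hg.δ R i x))) = (hg.rs (P := P)).δ Y e (φ x) := by
    intro x
    rw [← sub_eq_zero, ← map_sub, ← map_sub]
    apply hwd
    rw [map_sub, hσ, sub_self]
  refine ⟨AddMonoidHom.mk' (fun x => (hg.rs (P := P)).δ Y e (φ (σ x))) ?_, ?_, ?_, ?_⟩
  · intro a b
    obtain ⟨x, rfl⟩ : ∃ x, hg.δ R i x = a := ⟨_, hσ a⟩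
    obtain ⟨y, rfl⟩ : ∃ y, hg.δ R i y = b := ⟨_, hσ b⟩
    rw [← map_add (hg.δ R i), key, key, key, map_add, map_add]
  · intro p a
    obtain ⟨x, rfl⟩ : ∃ x, hg.δ R i x = a := ⟨_, hσ a⟩
    change (hg.rs (P := P)).δ Y e (φ (σ _)) = p • (hg.rs (P := P)).δ Y e (φ (σ _))
    rw [← map_smul (hg.δ R i), key, key, hlin, map_smul]
  · intro a ha
    obtain ⟨x, rfl⟩ : ∃ x, hg.δ R i x = a := ⟨_, hσ a⟩
    change (hg.rs (P := P)).δ Y e (φ (σ _)) = 0 at ha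
    rw [key] at ha
    exact hker x ha
  · intro y
    obtain ⟨s, hs, h0⟩ := hnull (pre Y (g.restrictScalars P) (e+1) y)
    rw [← map_smul] at h0
    obtain ⟨z, hz⟩ := (hg.rs (P := P)).exact₃ e _ h0
    obtain ⟨t, ht, x, hx⟩ := hco z
    refine ⟨t * s, mul_notMem ht hs, hg.δ R i x, ?_⟩
    change _ = (hg.rs (P := P)).δ Y e (φ (σ _))
    rw [key, ← hx, map_smul, hz, mul_smul]

theorem change_rings [IsNoetherianRing R] {m : Ideal P} [hm : m.IsMaximal] (H : CR m η) (i : ℕ) :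
    ∀ (N : Type) [AddCommGroup N] [Module R N] [Module P N] [IsScalarTower P R N]
      [Module.Finite R N], ∃ φ : EX R N R i →+ EX P N Y (c+i), NIso (R := R) m φ := by
  induction i with
  | zero =>
    intro N _ _ _ _ _
    refine ⟨AddMonoidHom.mk' (fun x => (Th η (hom0 x) : EX P N Y c)) ?_, ?_, ?_, ?_⟩
    · intro a b
      rw [map_add, Th_add]
    · intro p x
      change Th η (hom0 (algebraMap P R p • x)) = p • Th η (hom0 x)
      rw [map_smul, Th_smul]
    · intro x hx
      have := Th_inj H _ hx
      rw [map_eq_zero_iff _ (LinearEquiv.injective _)] at this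
      exact ⟨1, one_notMem m, by rw [this, smul_zero]⟩
    · intro y
      obtain ⟨s, hs, f, hf⟩ := Th_coker (N := N) H y
      refine ⟨s, hs, hom0.symm f, ?_⟩
      change _ = Th η (hom0 (hom0.symm f))
      rw [LinearEquiv.apply_symm_apply, ← hf]
  | succ i ih =>
    intro N _ _ _ _ _
    obtain ⟨r, g, hg⟩ := exists_pres (R := R) N
    have hnull : Null m (EX P (Fin r → R) Y (c+i+1)) := free_null (H.high _ (by omega))
    cases i with
    | zero =>
      refine shift_step (e := c) hg
        (AddMonoidHom.mk' (fun x => (Th η (hom0 x) : EX P (LinearMap.ker g) Y c)) ?_)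
        ?_ ?_ ?_ ?_ hnull
      · intro a b
        rw [map_add, Th_add]
      · intro p x
        change Th η (hom0 (algebraMap P R p • x)) = p • Th η (hom0 x)
        rw [map_smul, Th_smul]
      · intro y
        obtain ⟨s, hs, f, hf⟩ := Th_coker (N := LinearMap.ker g) H y
        refine ⟨s, hs, hom0.symm f, ?_⟩
        change _ = Th η (hom0 (hom0.symm f))
        rw [LinearEquiv.apply_symm_apply, ← hf]
      · intro x hx
        change (hg.rs (P := P)).δ Y c (Th η (hom0 x)) = 0
        obtain ⟨y, rfl⟩ := hg.exact₁ 0 x hx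
        rw [hom0_pre, ← Th_comp]
        exact (hg.rs (P := P)).δ_pre c _
      · intro x hx
        change (hg.rs (P := P)).δ Y c (Th η (hom0 x)) = 0 at hx
        obtain ⟨w, hw⟩ := (hg.rs (P := P)).exact₁ c _ hx
        obtain ⟨h, rfl⟩ := Th_surj_free H.gen w
        rw [Th_comp] at hw
        have h1 : hom0 x - h ∘ₗ (LinearMap.ker g).subtype = 0 := by
          refine Th_inj H _ ?_
          rw [sub_eq_add_neg, Th_add, ← hw, ← Th_add, ← sub_eq_add_neg, sub_self, Th_zero]
        have h2 : x = pre R (LinearMap.ker g).subtype 0 (hom0.symm h) := by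
          rw [pre_hom0_symm, LinearEquiv.eq_symm_apply]
          exact sub_eq_zero.mp h1
        refine ⟨1, one_notMem m, ?_⟩
        rw [h2, hg.δ_pre, smul_zero]
    | succ i =>
      obtain ⟨φ, hφ⟩ := ih (LinearMap.ker g)
      refine shift_step (e := c+(i+1)) hg φ hφ.lin hφ.coker ?_ ?_ hnull
      · intro x hx
        obtain ⟨y, rfl⟩ := hg.exact₁ (i+1) x hx
        have : y = 0 := (subsingleton_of_free i).elim _ _
        rw [this, map_zero, map_zero, map_zero]
      · intro x hx
        obtain ⟨w, hw⟩ := (hg.rs (P := P)).exact₁ _ _ hx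
        have hn2 : Null m (EX P (Fin r → R) Y (c+(i+1))) := free_null (H.high _ (by omega))
        obtain ⟨s, hs, h0⟩ := hn2 w
        have : φ (algebraMap P R s • x) = 0 := by
          rw [hφ.lin, ← hw, ← map_smul, h0, map_zero]
        obtain ⟨t, ht, h1⟩ := hφ.ker _ this
        refine ⟨t * s, mul_notMem ht hs, ?_⟩
        rw [map_mul, mul_smul, ← map_smul, ← map_smul, h1, map_zero]

/-- on modules killed by the maximal ideal, null isomorphisms are bijective -/
lemma NIso.bij {m : Ideal P} [hm : m.IsMaximal] {A B : Type} [AddCommGroup A] [Module R A]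
    [AddCommGroup B] [Module P B] {φ : A →+ B} (h : NIso (R := R) m φ)
    (hA : ∀ a ∈ m, ∀ x : A, algebraMap P R a • x = 0) (hB : ∀ a ∈ m, ∀ y : B, a • y = 0) :
    Function.Bijective φ := by
  constructor
  · rw [injective_iff_map_eq_zero]
    intro x hx
    obtain ⟨s, hs, h0⟩ := h.ker x hx
    obtain ⟨t, a, ha, hta⟩ := hm.exists_inv hs
    have : x = algebraMap P R (t * s + a) • x := by rw [hta, map_one, one_smul]
    rw [this, map_add, add_smul, hA a ha, add_zero, map_mul, mul_smul, h0, smul_zero]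
  · intro y
    obtain ⟨s, hs, x, hx⟩ := h.coker y
    obtain ⟨t, a, ha, hta⟩ := hm.exists_inv hs
    refine ⟨algebraMap P R t • x, ?_⟩
    have : y = (t * s + a) • y := by rw [hta, one_smul]
    rw [h.lin, ← hx, ← mul_smul]
    conv_rhs => rw [this, add_smul, hB a ha, add_zero]

end Change
end NG


namespace NG
open MvPolynomial
open scoped Pointwise

section Apply

variable {k : Type} [Field k] {n : ℕ}

lemma null_regular (rs : List (MvPolynomial (Fin n) k)) :
    ∀ (M : Type) [AddCommGroup M] [Module (MvPolynomial (Fin n) k) M]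
      [Module.Finite (MvPolynomial (Fin n) k) M], (∀ r ∈ rs, r ∈ mS k n) →
      RingTheory.Sequence.IsWeaklyRegular M rs → ∀ j, n < j + rs.length →
      Null (mS k n) (EX (MvPolynomial (Fin n) k) M (MvPolynomial (Fin n) k) j) := by
  induction rs with
  | nil =>
    intro M _ _ _ _ _ j hj
    rw [List.length_nil, add_zero] at hj
    refine claim (mS k n) (fun i : Fin n => es k n (i+1)) (fun i => es_mem _ (by omega))
      (fun q hq h => es_params hq h) _ _ ∅ rfl M ?_ j ?_
    · intro j hj
      exact absurd hj (Finset.notMem_empty _)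
    · intro l _
      exact ext_simplex_zero k (F := ∅) (by rw [Finset.card_empty]; omega)
  | cons y rs ih =>
    intro M _ _ _ hm hreg j hj
    rw [RingTheory.Sequence.isWeaklyRegular_cons_iff] at hreg
    have h1 := ih (QuotSMulTop y M) (fun r hr => hm r (List.mem_cons_of_mem _ hr)) hreg.2 (j+1)
      (by rw [List.length_cons] at hj; omega)
    have hr : y • (⊤ : Submodule (MvPolynomial (Fin n) k) M) =
        LinearMap.range (y • (LinearMap.id : M →ₗ[MvPolynomial (Fin n) k] M)) := by
      ext x
      rw [Submodule.mem_smul_pointwise_iff_exists, LinearMap.mem_range]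
      simp
    refine Null.step y (hm y List.mem_cons_self) (fun x hx => ?_) j
      (h1.equiv (preEquiv _ (Submodule.quotEquivOfEq _ _ hr).symm _))
    exact hreg.1 (by simpa using hx)

lemma high_null {Γ : SC n} [IsNoetherianRing (SRRing k Γ)] {d : ℕ} (hC : DepthGe k Γ d) (j : ℕ)
    (hj : n < j + d) :
    Null (mS k n) (EX (MvPolynomial (Fin n) k) (SRRing k Γ) (MvPolynomial (Fin n) k) j) := by
  have hlt : srMax k Γ • (⊤ : Submodule (SRRing k Γ) (SRRing k Γ)) < ⊤ := by
    rw [smul_eq_mul, Ideal.mul_top]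
    exact lt_top_iff_ne_top.mpr (srMax_max (k := k) (Γ := Γ)).ne_top
  obtain ⟨rs, hlen, hmem, hreg⟩ := ModuleCat.exists_isRegular_of_exists_subsingleton_ext
    (srMax k Γ) d (ModuleCat.of (SRRing k Γ) (SRRing k Γ)) hlt
    (ModuleCat.of (SRRing k Γ) (SRRing k Γ ⧸ srMax k Γ))
    (by rw [Module.support_eq_zeroLocus, Ideal.annihilator_quotient]) hC
  choose f hf using fun r : SRRing k Γ => mk_surj (k := k) (Γ := Γ) r
  have hrs : (rs.map f).map (algebraMap (MvPolynomial (Fin n) k) (SRRing k Γ)) = rs := by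
    rw [List.map_map]
    conv_rhs => rw [← List.map_id rs]
    exact List.map_congr_left fun r _ => hf r
  refine null_regular (rs.map f) (SRRing k Γ) ?_ ?_ j (by rw [List.length_map, hlen]; exact hj)
  · intro r hr
    obtain ⟨r', hr', rfl⟩ := List.mem_map.mp hr
    rw [← mk_mem_srMax (Γ := Γ), hf]
    exact hmem _ hr'
  · rw [← RingTheory.Sequence.isWeaklyRegular_map_algebraMap_iff (SRRing k Γ), hrs]
    exact hreg.toIsWeaklyRegular

lemma low_null {Γ : SC n} {d c : ℕ} (hΓ : ∀ σ ∈ Γ.faces, σ.card ≤ d) (hc : d + c = n)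
    (N : Type) [AddCommGroup N] [Module (SRRing k Γ) N] [Module (MvPolynomial (Fin n) k) N]
    [IsScalarTower (MvPolynomial (Fin n) k) (SRRing k Γ) N]
    [Module.Finite (SRRing k Γ) N] (i : ℕ) (hi : i < c) :
    Null (mS k n) (EX (MvPolynomial (Fin n) k) N (MvPolynomial (Fin n) k) i) := by
  classical
  have : Module.Finite (MvPolynomial (Fin n) k) N := Module.Finite.trans (SRRing k Γ) N
  let J : Finset (Fin n) := Finset.univ.filter fun j => d < (j : ℕ) + 1
  have hJ : Jᶜ.card ≤ d := by
    have : Jᶜ.card ≤ (Finset.range d).card := by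
      refine Finset.card_le_card_of_injOn (fun j => (j : ℕ)) ?_ ?_
      · intro j hj
        simp only [J, Finset.coe_compl, Set.mem_compl_iff, Finset.mem_coe, Finset.mem_filter,
          Finset.mem_univ, true_and, Finset.mem_range] at hj ⊢
        omega
      · intro a _ b _ h
        exact Fin.ext h
    simpa using this
  refine claim (mS k n) (fun i : Fin n => es k n (i+1)) (fun i => es_mem _ (by omega))
    (fun q hq h => es_params hq h) _ _ J rfl N ?_ i ?_
  · intro j hj
    refine ⟨1, fun x => ?_⟩
    rw [pow_one]
    have h1 := es_zero (k := k) hΓ (Finset.mem_filter.mp hj).2 1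
    rw [← one_smul (SRRing k Γ) x, ← smul_assoc, h1]
    exact zero_smul (SRRing k Γ) x
  · intro l hl
    exact ext_simplex_zero k (F := ∅) (by rw [Finset.card_empty]; omega)

lemma ex_kill {P : Type} [CommRing P] {N Y : Type} [AddCommGroup N] [Module P N] [AddCommGroup Y]
    [Module P Y] (a : P) (h : ∀ x : N, a • x = 0) (i : ℕ) (x : EX P N Y i) : a • x = 0 := by
  have : a • (LinearMap.id : N →ₗ[P] N) = 0 := LinearMap.ext h
  rw [← pre_id i x, ← pre_smul, this, pre_zero]

lemma smul_one_res (Γ : SC n) (p : MvPolynomial (Fin n) k) :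
    p • (1 : SRRing k Γ ⧸ srMax k Γ) = Ideal.Quotient.mk (srMax k Γ) (mk Γ p) := by
  have h1 : p • (mk Γ 1 : SRRing k Γ) = mk Γ p := by rw [smul_mk, mul_one]
  rw [← h1]
  rfl

/-- the residue field as an `S`-module -/
lemma residue_equiv (Γ : SC n) : Nonempty ((SRRing k Γ ⧸ srMax k Γ) ≃ₗ[MvPolynomial (Fin n) k]
    SRRing k (simplex (∅ : Finset (Fin n)))) := by
  have hg : Gen (P := MvPolynomial (Fin n) k) (mS k n) (1 : SRRing k Γ ⧸ srMax k Γ) := by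
    constructor
    · intro x
      obtain ⟨y, rfl⟩ := Ideal.Quotient.mk_surjective x
      obtain ⟨p, rfl⟩ := mk_surj y
      refine ⟨p, ?_⟩
      rw [smul_one_res]
    · intro p
      rw [smul_one_res, ← mk_mem_srMax (Γ := Γ), ← Ideal.Quotient.eq_zero_iff_mem]
  obtain ⟨e, -⟩ := hg.equiv
  exact ⟨e.symm⟩

theorem gor_of_gen {Γ : SC n} [IsNoetherianRing (SRRing k Γ)] {d c : ℕ}
    (hΓ : ∀ σ ∈ Γ.faces, σ.card ≤ d) (hc : d + c = n) (hC : DepthGe k Γ d)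
    (η : EX (MvPolynomial (Fin n) k) (SRRing k Γ) (MvPolynomial (Fin n) k) c)
    (hη : Gen (srIdeal k Γ) η) (i : ℕ) :
    (i ≠ d → Subsingleton (EX (SRRing k Γ) (SRRing k Γ ⧸ srMax k Γ) (SRRing k Γ) i)) ∧
    (i = d → Nonempty (EX (SRRing k Γ) (SRRing k Γ ⧸ srMax k Γ) (SRRing k Γ) i ≃ₗ[SRRing k Γ]
      (SRRing k Γ ⧸ srMax k Γ))) := by
  have H : CR (R := SRRing k Γ) (mS k n) η :=
    { surj := Ideal.Quotient.mk_surjective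
      gen := by
        have : RingHom.ker (algebraMap (MvPolynomial (Fin n) k) (SRRing k Γ)) = srIdeal k Γ :=
          Ideal.mk_ker
        rw [this]
        exact hη
      low := fun N _ _ _ _ _ i hi => low_null hΓ hc N i hi
      high := fun i hi => high_null hC i (by omega) }
  obtain ⟨φ, hφ⟩ := change_rings H i (SRRing k Γ ⧸ srMax k Γ)
  have hkR : ∀ a ∈ srMax k Γ, ∀ x : SRRing k Γ ⧸ srMax k Γ, a • x = 0 := by
    intro a ha x
    obtain ⟨y, rfl⟩ := Ideal.Quotient.mk_surjective x
    exact Ideal.Quotient.eq_zero_iff_mem.mpr (Ideal.mul_mem_right y _ ha)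
  have hbij : Function.Bijective φ := by
    refine hφ.bij ?_ ?_
    · intro a ha x
      exact ex_kill _ (hkR _ (mk_mem_srMax.mpr ha)) _ x
    · intro a ha x
      refine ex_kill _ (fun y => ?_) _ x
      rw [← algebraMap_smul (SRRing k Γ) a y]
      exact hkR _ (mk_mem_srMax.mpr ha) y
  obtain ⟨e⟩ := residue_equiv (k := k) Γ
  let e' := preEquiv (MvPolynomial (Fin n) k) e (c+i)
  constructor
  · intro hi
    have h1 : Subsingleton (EX (MvPolynomial (Fin n) k) (SRRing k (simplex (∅ : Finset (Fin n))))
      (MvPolynomial (Fin n) k) (c+i)) := ext_simplex_zero k (by rw [Finset.card_empty]; omega)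
    have h2 := e'.symm.toEquiv.subsingleton
    exact hbij.1.subsingleton
  · intro hi
    obtain ⟨u, hu⟩ := ext_simplex_gen k (F := (∅ : Finset (Fin n))) (i := c+i)
      (by rw [Finset.card_empty]; omega)
    obtain ⟨x0, hx0⟩ := hbij.2 (e' u)
    have hg : Gen (srMax k Γ) x0 := by
      constructor
      · intro x
        obtain ⟨p, hp⟩ := hu.gen (e'.symm (φ x))
        refine ⟨algebraMap _ _ p, hbij.1 ?_⟩
        rw [hφ.lin, hx0, ← map_smul, ← hp, LinearEquiv.apply_symm_apply]
      · intro r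
        obtain ⟨p, rfl⟩ := mk_surj r
        rw [mk_mem_srMax]
        refine Iff.trans ?_ (hu.ann p)
        rw [← map_eq_zero_iff φ hbij.1]
        have := hφ.lin p x0
        rw [hx0, ← map_smul] at this
        rw [← map_eq_zero_iff e' e'.injective, ← this]
        rfl
    obtain ⟨ee, -⟩ := hg.equiv
    exact ⟨ee.symm⟩

end Apply
end NG


namespace NG
open MvPolynomial

section Final

variable {k : Type} [Field k] {n : ℕ}

theorem core {Γ : SC n} {t c : ℕ} (ht : 1 ≤ t) (hΓ : ∀ σ ∈ Γ.faces, σ.card ≤ t + 2)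
    (hc : t + 2 + c = n) (hC : DepthGe k Γ (t+2)) (F0 : Fc Γ (t+2))
    (hTr : ∀ v : Fin n, {v} ∈ Γ.faces →
      ∃ φ : EX (MvPolynomial (Fin n) k) (SRRing k Γ) (MvPolynomial (Fin n) k) c
        →ₗ[MvPolynomial (Fin n) k] SRRing k Γ, ∃ w, cf (Finsupp.single v 1) (φ w) ≠ 0) :
    ∃ η : EX (MvPolynomial (Fin n) k) (SRRing k Γ) (MvPolynomial (Fin n) k) c,
      Gen (srIdeal k Γ) η := by
  obtain ⟨cc, hcc, Ψ, hinj, hW⟩ := canon (k := k) hΓ c hc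
  let E := LinearEquiv.ofInjective Ψ hinj
  have hV : ∀ (F : Fc Γ (t+1+1)) (v : Fin n), v ∈ F.1 → ∃ a c α, VD (s := t+1) cc v a c α := by
    intro F v hv
    obtain ⟨φ, w, hw⟩ := hTr v (Γ.down_closed F.2.1 (Finset.singleton_subset_iff.mpr hv))
    refine exists_VD (s := t+1) hcc hW (φ ∘ₗ E.symm.toLinearMap) v (E w) ?_
    rw [LinearMap.comp_apply, LinearEquiv.coe_coe, LinearEquiv.symm_apply_apply]
    exact hw
  have hpure : ∀ σ ∈ Γ.faces, ∃ F : Fc Γ (t+1+1), σ ⊆ F.1 := fun σ hσ =>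
    pure_faces hΓ (by omega) hC hσ
  have hconn : ∀ (τ : Finset (Fin n)) (h : Fc Γ (t+1+1) → k),
      (∀ F F' : Fc Γ (t+1+1), τ ⊆ F.1 → τ ⊆ F'.1 → (F.1 ∩ F'.1).card = t+1 → h F = h F') →
      ∀ F F' : Fc Γ (t+1+1), τ ⊆ F.1 → τ ⊆ F'.1 → h F = h F' := fun τ h hh F F' hF hF' =>
    connected_of_depth hΓ (by omega) hC τ h hh F F' hF hF'
  obtain ⟨b, hb⟩ := exists_GD (s := t+1) (by omega) hcc hV hconn F0
  obtain ⟨u, hu⟩ := lemmaG (s := t+1) hcc hW hpure hconn hb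
  refine ⟨E.symm u, ?_, ?_⟩
  · intro x
    obtain ⟨p, hp⟩ := hu.gen (E x)
    exact ⟨p, by rw [← map_smul, ← hp, LinearEquiv.symm_apply_apply]⟩
  · intro p
    rw [← map_smul, map_eq_zero_iff _ E.symm.injective]
    exact hu.ann p

lemma exists_of_trace {Γ : SC n} {ω : Type} [AddCommGroup ω] [Module (SRRing k Γ) ω]
    {a : Fin n →₀ ℕ} {x : SRRing k Γ} (hx : x ∈ traceIdeal (SRRing k Γ) ω) (h : cf a x ≠ 0) :
    ∃ (f : ω →ₗ[SRRing k Γ] SRRing k Γ) (w : ω), cf a (f w) ≠ 0 := by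
  by_contra hcon
  push Not at hcon
  apply h
  refine Submodule.iSup_induction (fun f : ω →ₗ[SRRing k Γ] SRRing k Γ => LinearMap.range f)
    (motive := fun x => cf a x = 0) hx ?_ (cf_zero _) ?_
  · rintro f _ ⟨w, rfl⟩
    exact hcon f w
  · intro x y hx hy
    rw [cf_add, hx, hy, add_zero]

theorem main (Δ : SC n) (hdim : 2 ≤ Δ.dim)
    (hCM : IsCohenMacaulayAt (SRRing k Δ) (srMax k Δ))
    (ω : Type) [AddCommGroup ω] [Module (SRRing k Δ) ω]
    (hω : IsCanonicalModuleQ k (srIdeal k Δ) ω)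
    (hNG : srMax k Δ ≤ traceIdeal (SRRing k Δ) ω) :
    IsGorensteinAt (SRRing k Δ) (srMax k Δ) := by
  obtain ⟨hN, hCM⟩ := hCM
  obtain ⟨F, hF, hFd⟩ := Finset.exists_mem_eq_sup Δ.faces ⟨∅, Δ.empty_mem⟩ Finset.card
  obtain ⟨t, ht, hcard⟩ : ∃ t, 1 ≤ t ∧ F.card = t + 2 := by
    refine ⟨F.card - 2, ?_, ?_⟩ <;>
    · unfold SC.dim at hdim
      rw [hFd] at hdim
      omega
  have hΓ : ∀ σ ∈ Δ.faces, σ.card ≤ t + 2 := by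
    intro σ hσ
    rw [← hcard, ← hFd]
    exact Finset.le_sup (f := Finset.card) hσ
  have hd : ringKrullDim (SRRing k Δ) = ((t+2 : ℕ) : WithBot ℕ∞) :=
    le_antisymm (dim_le hΓ) (by rw [← hcard]; exact le_dim hF)
  have hn : t + 2 ≤ n := by
    rw [← hcard]
    simpa using Finset.card_le_univ F
  obtain ⟨c, hc⟩ := Nat.exists_eq_add_of_le hn
  have hC : DepthGe k Δ (t+2) := by
    intro i hi
    obtain ⟨e⟩ := bridge (SRRing k Δ) (SRRing k Δ ⧸ srMax k Δ) (SRRing k Δ) i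
    have := hCM i (by rw [hd]; exact (Nat.cast_lt (α := WithBot ℕ∞)).mpr hi)
    exact e.symm.toEquiv.subsingleton
  obtain ⟨-, d', hd', hω⟩ := hω
  have hdd : d' = t + 2 := by
    rw [hd] at hd'
    exact ((Nat.cast_inj (R := WithBot ℕ∞)).mp hd').symm
  have hcd : n - d' = c := by omega
  rw [hcd] at hω
  let _ : Module (MvPolynomial (Fin n) k) ω := Module.compHom ω (Ideal.Quotient.mk (srIdeal k Δ))
  obtain ⟨e1⟩ := hω
  obtain ⟨e2⟩ := bridge (MvPolynomial (Fin n) k) (SRRing k Δ) (MvPolynomial (Fin n) k) c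
  let e := e1.trans e2
  obtain ⟨η, hη⟩ := core (k := k) ht hΓ hc.symm hC ⟨F, hF, hcard⟩ (by
    intro v hv
    have hmem : mk (k := k) Δ (X v) ∈ traceIdeal (SRRing k Δ) ω :=
      hNG (mk_mem_srMax.mpr (X_mem_mS v))
    have hne : cf (Finsupp.single v 1) (mk (k := k) Δ (X v)) ≠ 0 := by
      rw [cf_mk (by rw [Finsupp.support_single _ one_ne_zero]; exact hv), coeff_X, if_pos rfl]
      exact one_ne_zero
    obtain ⟨f, w, hw⟩ := exists_of_trace hmem hne
    let f' : ω →ₗ[MvPolynomial (Fin n) k] SRRing k Δ :=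
      { toFun := f
        map_add' := f.map_add
        map_smul' := fun p x => f.map_smul (mk Δ p) x }
    refine ⟨f' ∘ₗ e.symm.toLinearMap, e w, ?_⟩
    rw [LinearMap.comp_apply, LinearEquiv.coe_coe, LinearEquiv.symm_apply_apply]
    exact hw)
  refine ⟨hN, fun i => ?_⟩
  obtain ⟨h1, h2⟩ := gor_of_gen hΓ hc.symm hC η hη i
  obtain ⟨e⟩ := bridge (SRRing k Δ) (SRRing k Δ ⧸ srMax k Δ) (SRRing k Δ) i
  constructor
  · intro hi
    rw [hd] at hi
    obtain ⟨e'⟩ := h2 ((Nat.cast_inj (R := WithBot ℕ∞)).mp hi)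
    exact ⟨e.trans e'⟩
  · intro hi
    rw [hd] at hi
    have := h1 (fun h => hi ((Nat.cast_inj (R := WithBot ℕ∞)).mpr h))
    exact e.toEquiv.subsingleton

end Final
end NG

set_option maxHeartbeats 1000000 in
set_option synthInstance.maxHeartbeats 1000000 in
/-- Every nearly Gorenstein Stanley--Reisner ring of Krull dimension
greater than two (equivalently, `dim Δ ≥ 2`) is Gorenstein. -/
theorem nearlyGorenstein_is_gorenstein
    (k : Type) [Field k] {n : ℕ} (Δ : SC n) (hdim : 2 ≤ Δ.dim)
    (hCM : IsCohenMacaulayAt (SRRing k Δ) (srMax k Δ))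
    (ω : Type) [AddCommGroup ω] [Module (SRRing k Δ) ω]
    (hω : IsCanonicalModuleQ k (srIdeal k Δ) ω)
    (hNG : srMax k Δ ≤ traceIdeal (SRRing k Δ) ω) :
    IsGorensteinAt (SRRing k Δ) (srMax k Δ) := by
  exact NG.main Δ hdim hCM ω hω hNG
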